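/- arXiv:math/0703148 — 4 statements merged into one kernel-verified Lean document; each statement's English description precedes it below -/
import Mathlib

section
/- Let (R,m) be a Noetherian local complete ring and I an ideal of R such that H^l_I(R) = 0 for every l ≠ h. Set H := H^h_I(R). Then there is an isomorphism of R-modules Hom_R(H, D²(H)) ≅ D(H^h_I(D(H))). -/
namespace LCaux
open CategoryTheory Limits Opposite
noncomputable section
variable {R : Type} [CommRing R]

abbrev yF (M : ModuleCat.{0} R) : ModuleCat.{0} R ⥤ (ModuleCat.{0} R)ᵒᵖ :=
  ((linearYoneda R (ModuleCat.{0} R)).obj M).rightOp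

abbrev KK (M N : ModuleCat.{0} R) : ChainComplex (ModuleCat.{0} R)ᵒᵖ ℕ :=
  ((yF M).mapHomologicalComplex _).obj (projectiveResolution N).complex

abbrev AA (R : Type) [CommRing R] : (ModuleCat.{0} R)ᵒᵖ := op (ModuleCat.of R R)

instance : Injective (AA R) := by
  have : Projective (ModuleCat.of R R) := by
    apply ModuleCat.projective_of_categoryTheory_projective
  infer_instance

def toA {M N : ModuleCat.{0} R} {n : ℕ} (f : (projectiveResolution N).complex.X n ⟶ M) :
    (KK M N).X n ⟶ AA R :=
  Quiver.Hom.op (X := ModuleCat.of R R) (Y := ModuleCat.of R ((projectiveResolution N).complex.X n ⟶ M)) (ModuleCat.ofHom (LinearMap.toSpanSingleton R _ f))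

lemma toA_surj {M N : ModuleCat.{0} R} {n : ℕ} (g : (KK M N).X n ⟶ AA R) :
    ∃ f : (projectiveResolution N).complex.X n ⟶ M, toA f = g := by
  refine ⟨g.unop.hom (1 : R), ?_⟩
  apply Quiver.Hom.unop_inj
  apply ModuleCat.hom_ext
  apply LinearMap.ext_ring
  exact one_smul R _

lemma toA_inj {M N : ModuleCat.{0} R} {n : ℕ} {f g : (projectiveResolution N).complex.X n ⟶ M}
    (h : toA f = toA g) : f = g := by
  have := congrArg (fun z : (KK M N).X n ⟶ AA R => z.unop.hom (1 : R)) h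
  exact ((one_smul R f).symm.trans this).trans (one_smul R g)

lemma d_toA {M N : ModuleCat.{0} R} {n m : ℕ} (f : (projectiveResolution N).complex.X n ⟶ M) :
    (KK M N).d m n ≫ toA f = toA ((projectiveResolution N).complex.d m n ≫ f) := by
  apply Quiver.Hom.unop_inj
  apply ModuleCat.hom_ext
  apply LinearMap.ext_ring
  change (projectiveResolution N).complex.d m n ≫ ((1 : R) • f) = (1 : R) • (_ ≫ f)
  simp

lemma toA_zero {M N : ModuleCat.{0} R} {n : ℕ} :
   toA (0 : (projectiveResolution N).complex.X n ⟶ M) = 0 := by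
  apply Quiver.Hom.unop_inj
  apply ModuleCat.hom_ext
  apply LinearMap.ext_ring
  change (1 : R) • (0 : (projectiveResolution N).complex.X n ⟶ M) = 0
  simp

lemma toA_add {M N : ModuleCat.{0} R} {n : ℕ} (f g : (projectiveResolution N).complex.X n ⟶ M) :
   toA (f + g) = toA f + toA g := by
  apply Quiver.Hom.unop_inj
  apply ModuleCat.hom_ext
  apply LinearMap.ext_ring
  change (1 : R) • (f + g) = (1 : R) • f + (1 : R) • g
  simp


section Generic
universe v u
variable {D : Type u} [Category.{v} D] [Abelian D]

def hm (K : ChainComplex D ℕ) {A : D} {n : ℕ} (k : K.X n ⟶ A) (hk : K.d (n+1) n ≫ k = 0) :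
    K.homology n ⟶ A :=
  K.homologyι n ≫ K.descOpcycles k (n+1) (by simp) hk

lemma hm_add (K : ChainComplex D ℕ) {A : D} {n : ℕ} (k l : K.X n ⟶ A) (hk : K.d (n+1) n ≫ k = 0)
    (hl : K.d (n+1) n ≫ l = 0) (hkl : K.d (n+1) n ≫ (k + l) = 0) :
    hm K (k + l) hkl = hm K k hk + hm K l hl := by
  unfold hm
  have : K.descOpcycles (k + l) (n+1) (by simp) hkl = K.descOpcycles k (n+1) (by simp) hk
      + K.descOpcycles l (n+1) (by simp) hl := by
    rw [← cancel_epi (K.pOpcycles n)]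
    simp
  rw [this, Preadditive.comp_add]

lemma hm_surj (K : ChainComplex D ℕ) {A : D} [Injective A] {n : ℕ} (g : K.homology n ⟶ A) :
    ∃ k hk, hm K k hk = g := by
  refine ⟨K.pOpcycles n ≫ Injective.factorThru g (K.homologyι n), by simp, ?_⟩
  unfold hm
  have : K.descOpcycles (K.pOpcycles n ≫ Injective.factorThru g (K.homologyι n)) (n+1) (by simp)
      (by simp) = Injective.factorThru g (K.homologyι n) := by
    rw [← cancel_epi (K.pOpcycles n)]
    simp
  rw [this, Injective.comp_factorThru]

lemma hm_zero_iff (K : ChainComplex D ℕ) {A : D} [Injective A] {n : ℕ} (k : K.X n ⟶ A)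
    (hk : K.d (n+1) n ≫ k = 0) :
    hm K k hk = 0 ↔ ∃ x, k = K.d n ((ComplexShape.down ℕ).next n) ≫ x := by
  constructor
  · intro h
    have ex : (ShortComplex.mk (K.homologyι n) (K.fromOpcycles n ((ComplexShape.down ℕ).next n)) (by simp)).Exact :=
      ShortComplex.exact_of_f_is_kernel _ (K.homologyIsKernel n _ rfl)
    refine ⟨ex.descToInjective _ h, ?_⟩
    have h2 := ex.comp_descToInjective _ h
    have := congrArg (fun z => K.pOpcycles n ≫ z) h2
    simp at this
    exact this.symm
  · rintro ⟨g, rfl⟩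
    exact HomologicalComplex.homologyι_descOpcycles_eq_zero_of_boundary K _ (n+1) (by simp) g rfl

lemma hm_nat {K L : ChainComplex D ℕ} (φ : K ⟶ L) {A : D} {n : ℕ} (k : L.X n ⟶ A)
    (hk : L.d (n+1) n ≫ k = 0) :
    HomologicalComplex.homologyMap φ n ≫ hm L k hk = hm K (φ.f n ≫ k) (by rw [← φ.comm_assoc, hk, comp_zero]) := by
  unfold hm
  rw [HomologicalComplex.homologyι_naturality_assoc]
  simp
end Generic

lemma d_toA0 {M N : ModuleCat.{0} R} {n : ℕ} {f : (projectiveResolution N).complex.X n ⟶ M}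
    (hf : (projectiveResolution N).complex.d (n+1) n ≫ f = 0) :
    (KK M N).d (n+1) n ≫ toA f = 0 := by rw [d_toA, hf, toA_zero]

def eI (M N : ModuleCat.{0} R) (n : ℕ) : ((yF M).leftDerived n).obj N ≅ (KK M N).homology n :=
  (projectiveResolution N).isoLeftDerivedObj (yF M) n

def oldHom (M N : ModuleCat.{0} R) (n : ℕ) (f : (projectiveResolution N).complex.X n ⟶ M)
    (hf : (projectiveResolution N).complex.d (n+1) n ≫ f = 0) :
    ((yF M).leftDerived n).obj N ⟶ AA R :=
  (eI M N n).hom ≫ hm (KK M N) (toA f) (d_toA0 hf)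

def oldMk (M N : ModuleCat.{0} R) (n : ℕ) (f : (projectiveResolution N).complex.X n ⟶ M)
    (hf : (projectiveResolution N).complex.d (n+1) n ≫ f = 0) :
    ((Ext R (ModuleCat.{0} R) n).obj (op N)).obj M :=
  (oldHom M N n f hf).unop.hom (1 : R)

lemma oldHom_add (M N : ModuleCat.{0} R) (n : ℕ) (f g : (projectiveResolution N).complex.X n ⟶ M)
    (hf : (projectiveResolution N).complex.d (n+1) n ≫ f = 0)
    (hg : (projectiveResolution N).complex.d (n+1) n ≫ g = 0)
    (hfg : (projectiveResolution N).complex.d (n+1) n ≫ (f + g) = 0) :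
    oldHom M N n (f + g) hfg = oldHom M N n f hf + oldHom M N n g hg := by
  unfold oldHom
  have : hm (KK M N) (toA (f + g)) (d_toA0 hfg) = hm (KK M N) (toA f) (d_toA0 hf)
      + hm (KK M N) (toA g) (d_toA0 hg) := by
    rw [← hm_add]
    · congr 1
      exact toA_add f g
    · rw [← toA_add]; exact d_toA0 hfg
  rw [this, Preadditive.comp_add]

lemma oldMk_add (M N : ModuleCat.{0} R) (n : ℕ) (f g : (projectiveResolution N).complex.X n ⟶ M)
    (hf : (projectiveResolution N).complex.d (n+1) n ≫ f = 0)
    (hg : (projectiveResolution N).complex.d (n+1) n ≫ g = 0)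
    (hfg : (projectiveResolution N).complex.d (n+1) n ≫ (f + g) = 0) :
    oldMk M N n (f + g) hfg = oldMk M N n f hf + oldMk M N n g hg := by
  unfold oldMk
  rw [oldHom_add M N n f g hf hg hfg]
  rfl

lemma oldHom_surj (M N : ModuleCat.{0} R) (n : ℕ) (g : ((yF M).leftDerived n).obj N ⟶ AA R) :
    ∃ f hf, oldHom M N n f hf = g := by
  obtain ⟨k, hk, h⟩ := hm_surj (KK M N) ((eI M N n).inv ≫ g)
  obtain ⟨f, rfl⟩ := toA_surj k
  have h0 : (projectiveResolution N).complex.d (n+1) n ≫ f = 0 := by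
    apply toA_inj
    rw [← d_toA, hk, toA_zero]
  refine ⟨f, h0, ?_⟩
  unfold oldHom
  rw [h, Iso.hom_inv_id_assoc]

lemma oldMk_surj (M N : ModuleCat.{0} R) (n : ℕ) (x : ((Ext R (ModuleCat.{0} R) n).obj (op N)).obj M) :
    ∃ f hf, oldMk M N n f hf = x := by
  obtain ⟨f, hf, h⟩ := oldHom_surj M N n (Quiver.Hom.op (X := ModuleCat.of R R) (Y := ((Ext R (ModuleCat.{0} R) n).obj (op N)).obj M) (ModuleCat.ofHom (LinearMap.toSpanSingleton R _ x)))
  refine ⟨f, hf, ?_⟩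
  unfold oldMk
  rw [h]
  exact one_smul R x

lemma oldMk_zero_iff_hom (M N : ModuleCat.{0} R) (n : ℕ) (f : (projectiveResolution N).complex.X n ⟶ M)
    (hf : (projectiveResolution N).complex.d (n+1) n ≫ f = 0) :
    oldMk M N n f hf = 0 ↔ oldHom M N n f hf = 0 := by
  constructor
  · intro h
    apply Quiver.Hom.unop_inj
    apply ModuleCat.hom_ext
    apply LinearMap.ext_ring
    exact h
  · intro h
    unfold oldMk
    rw [h]
    rfl

lemma oldMk_zero_iff (M N : ModuleCat.{0} R) (n : ℕ) (f : (projectiveResolution N).complex.X n ⟶ M)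
    (hf : (projectiveResolution N).complex.d (n+1) n ≫ f = 0) :
    oldMk M N n f hf = 0 ↔ ∃ g, f = (projectiveResolution N).complex.d n ((ComplexShape.down ℕ).next n) ≫ g := by
  rw [oldMk_zero_iff_hom]
  have h1 : oldHom M N n f hf = 0 ↔ hm (KK M N) (toA f) (d_toA0 hf) = 0 := by
    unfold oldHom
    constructor
    · intro h
      rw [← cancel_epi (eI M N n).hom, h, comp_zero]
    · intro h
      rw [h, comp_zero]
  rw [h1, hm_zero_iff]
  constructor
  · rintro ⟨x, hx⟩
    obtain ⟨g, rfl⟩ := toA_surj x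
    exact ⟨g, toA_inj (by rw [hx, d_toA])⟩
  · rintro ⟨g, rfl⟩
    exact ⟨toA g, (d_toA g).symm⟩

lemma oldMk_map (M M' N : ModuleCat.{0} R) (n : ℕ) (f : (projectiveResolution N).complex.X n ⟶ M)
    (hf : (projectiveResolution N).complex.d (n+1) n ≫ f = 0) (u : M ⟶ M') :
    ((Ext R (ModuleCat.{0} R) n).obj (op N)).map u (oldMk M N n f hf) =
      oldMk M' N n (f ≫ u) (by rw [← Category.assoc, hf, zero_comp]) := by
  have key : (NatTrans.leftDerived (NatTrans.rightOp ((linearYoneda R (ModuleCat.{0} R)).map u)) n).app N ≫ oldHom M N n f hf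
      = oldHom M' N n (f ≫ u) (by rw [← Category.assoc, hf, zero_comp]) := by
    have e0 : (NatTrans.leftDerived (NatTrans.rightOp ((linearYoneda R (ModuleCat.{0} R)).map u)) n).app N =
        (eI M' N n).hom ≫ HomologicalComplex.homologyMap (K := KK M' N) (L := KK M N)
          ((NatTrans.mapHomologicalComplex (NatTrans.rightOp ((linearYoneda R (ModuleCat.{0} R)).map u)) _).app
            (projectiveResolution N).complex) n ≫ (eI M N n).inv :=
      ProjectiveResolution.leftDerived_app_eq _ (projectiveResolution N) n
    have e1 : (eI M N n).inv ≫ oldHom M N n f hf = hm (KK M N) (toA f) (d_toA0 hf) := by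
      unfold oldHom
      rw [Iso.inv_hom_id_assoc]
    refine (congrArg (fun z : ((yF M').leftDerived n).obj N ⟶ ((yF M).leftDerived n).obj N => z ≫ oldHom M N n f hf) e0).trans ?_
    rw [Category.assoc, Category.assoc, e1]
    unfold oldHom
    congr 1
    refine (hm_nat (K := KK M' N) (L := KK M N) _ _ _).trans ?_
    congr 1
    apply Quiver.Hom.unop_inj
    apply ModuleCat.hom_ext
    apply LinearMap.ext_ring
    change ((1 : R) • f) ≫ u = (1 : R) • (f ≫ u)
    simp
  exact congrArg (fun z : ((yF M').leftDerived n).obj N ⟶ AA R => z.unop.hom (1 : R)) key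

lemma oldMk_map' (M N N' : ModuleCat.{0} R) (n : ℕ) (f : (projectiveResolution N).complex.X n ⟶ M)
    (hf : (projectiveResolution N).complex.d (n+1) n ≫ f = 0) (v : N' ⟶ N)
    (φ : ProjectiveResolution.Hom (projectiveResolution N') (projectiveResolution N) v) :
    ((Ext R (ModuleCat.{0} R) n).map v.op).app M (oldMk M N n f hf) =
      oldMk M N' n (φ.hom.f n ≫ f) (by simp [← φ.hom.comm_assoc, hf]) := by
  have key : ((yF M).leftDerived n).map v ≫ oldHom M N n f hf
      = oldHom M N' n (φ.hom.f n ≫ f) (by simp [← φ.hom.comm_assoc, hf]) := by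
    unfold oldHom eI
    have := ProjectiveResolution.isoLeftDerivedObj_hom_naturality_assoc v (projectiveResolution N')
      (projectiveResolution N) φ.hom (by simpa using φ.hom_f_zero_comp_π_f_zero) (yF M) n
      (hm (KK M N) (toA f) (d_toA0 hf))
    refine this.trans ?_
    congr 1
    refine (hm_nat (K := KK M N') (L := KK M N) _ _ _).trans ?_
    congr 1
  exact congrArg (fun z : ((yF M).leftDerived n).obj N' ⟶ AA R => z.unop.hom (1 : R)) key

section
universe v u
variable {D : Type u} [Category.{v} D] [Abelian D]
lemma hm_comp (K : ChainComplex D ℕ) {A B : D} {n : ℕ} (k : K.X n ⟶ A) (a : A ⟶ B) (hk : K.d (n+1) n ≫ k = 0)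
    (hk' : K.d (n+1) n ≫ k ≫ a = 0) :
    hm K (k ≫ a) hk' = hm K k hk ≫ a := by
  unfold hm
  have : K.descOpcycles (k ≫ a) (n+1) (by simp) hk' = K.descOpcycles k (n+1) (by simp) hk ≫ a := by
    rw [← cancel_epi (K.pOpcycles n)]
    simp
  rw [this, Category.assoc]
end

def rA (r : R) : AA R ⟶ AA R := Quiver.Hom.op (ModuleCat.ofHom (r • LinearMap.id))

lemma toA_smul {M N : ModuleCat.{0} R} {n : ℕ} (r : R) (f : (projectiveResolution N).complex.X n ⟶ M) :
    toA (r • f) = toA f ≫ rA r := by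
  apply Quiver.Hom.unop_inj
  apply ModuleCat.hom_ext
  apply LinearMap.ext_ring
  change (1 : R) • (r • f) = (r • (1 : R)) • f
  simp

lemma oldMk_smul (M N : ModuleCat.{0} R) (n : ℕ) (r : R) (f : (projectiveResolution N).complex.X n ⟶ M)
    (hf : (projectiveResolution N).complex.d (n+1) n ≫ f = 0)
    (hf' : (projectiveResolution N).complex.d (n+1) n ≫ (r • f) = 0) :
    oldMk M N n (r • f) hf' = r • oldMk M N n f hf := by
  have key : oldHom M N n (r • f) hf' = oldHom M N n f hf ≫ rA r := by
    unfold oldHom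
    rw [Category.assoc]
    congr 1
    rw [← hm_comp]
    · congr 1
      exact toA_smul r f
    · rw [← toA_smul]; exact d_toA0 hf'
  have h2 := congrArg (fun z : ((yF M).leftDerived n).obj N ⟶ AA R => z.unop.hom (1 : R)) key
  refine h2.trans ?_
  change (oldHom M N n f hf).unop.hom (r • (1 : R)) = r • (oldHom M N n f hf).unop.hom (1 : R)
  exact map_smul _ _ _

lemma extMk_zero_iff {M N : ModuleCat.{0} R} {n : ℕ} (f : (projectiveResolution N).complex.X n ⟶ M)
    (hf : (projectiveResolution N).complex.d (n+1) n ≫ f = 0) :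
    (projectiveResolution N).extMk f (n+1) rfl hf = 0 ↔
      ∃ g, f = (projectiveResolution N).complex.d n ((ComplexShape.down ℕ).next n) ≫ g := by
  cases n with
  | succ p =>
    rw [ProjectiveResolution.extMk_eq_zero_iff _ _ _ _ _ p rfl]
    have : (ComplexShape.down ℕ).next (p+1) = p := ChainComplex.next_nat_succ p
    rw [this]
    simp only [eq_comm]
  | zero =>
    have h0 : (ComplexShape.down ℕ).next 0 = 0 := ChainComplex.next_nat_zero
    rw [h0]
    have hd : (projectiveResolution N).complex.d 0 0 = 0 :=
      (projectiveResolution N).complex.shape _ _ (by simp)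
    simp only [hd, zero_comp, exists_const]
    constructor
    · intro h
      have h' := congrArg (projectiveResolution N).extEquivCohomologyClass h
      rw [ProjectiveResolution.extEquivCohomologyClass_extMk, ProjectiveResolution.extEquivCohomologyClass_zero,
        CochainComplex.HomComplex.CohomologyClass.mk_eq_zero_iff,
        CochainComplex.HomComplex.Cocycle.toSingleMk_mem_coboundaries_iff _ _ _ _ _ 1 (by simp)] at h'
      obtain ⟨g, hg⟩ := h'
      have hz : IsZero ((projectiveResolution N).cochainComplex.X 1) :=
        CochainComplex.isZero_of_isStrictlyLE _ 0 1 (by norm_num)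
      rw [hz.eq_of_src g 0, comp_zero] at hg
      rw [← cancel_epi ((projectiveResolution N).cochainComplexXIso (-(0:ℕ)) 0 rfl).hom, ← hg, comp_zero]
    · rintro rfl
      simp

lemma cmp_exists {M N : ModuleCat.{0} R} {n : ℕ} (x : Abelian.Ext.{0} N M n) :
    ∃ y : ((Ext R (ModuleCat.{0} R) n).obj (op N)).obj M,
      ∃ (f : (projectiveResolution N).complex.X n ⟶ M) (hf : (projectiveResolution N).complex.d (n+1) n ≫ f = 0),
        x = (projectiveResolution N).extMk f (n+1) rfl hf ∧ y = oldMk M N n f hf := by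
  obtain ⟨f, hf, h⟩ := (projectiveResolution N).extMk_surjective x (n+1) rfl
  exact ⟨_, f, hf, h.symm, rfl⟩

def cmp {M N : ModuleCat.{0} R} {n : ℕ} (x : Abelian.Ext.{0} N M n) :
    ((Ext R (ModuleCat.{0} R) n).obj (op N)).obj M := (cmp_exists x).choose

lemma oldMk_sub (M N : ModuleCat.{0} R) (n : ℕ) (f g : (projectiveResolution N).complex.X n ⟶ M)
    (hf : (projectiveResolution N).complex.d (n+1) n ≫ f = 0)
    (hg : (projectiveResolution N).complex.d (n+1) n ≫ g = 0)
    (hfg : (projectiveResolution N).complex.d (n+1) n ≫ (f - g) = 0) :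
    oldMk M N n (f - g) hfg = oldMk M N n f hf - oldMk M N n g hg := by
  rw [eq_sub_iff_add_eq, ← oldMk_add M N n _ _ hfg hg (by simpa using hf)]
  congr 1
  simp

lemma cmp_extMk {M N : ModuleCat.{0} R} {n : ℕ} (f : (projectiveResolution N).complex.X n ⟶ M)
    (hf : (projectiveResolution N).complex.d (n+1) n ≫ f = 0) :
    cmp ((projectiveResolution N).extMk f (n+1) rfl hf) = oldMk M N n f hf := by
  obtain ⟨g, hg, h1, h2⟩ := (cmp_exists ((projectiveResolution N).extMk f (n+1) rfl hf)).choose_spec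
  refine h2.trans ?_
  have h0 : (projectiveResolution N).complex.d (n+1) n ≫ (g - f) = 0 := by simp [hf, hg]
  rw [← sub_eq_zero, ← oldMk_sub _ _ _ _ _ hg hf h0, oldMk_zero_iff, ← extMk_zero_iff _ h0,
    ← ProjectiveResolution.sub_extMk _ _ _ _ _ hg hf, h1, sub_self]

lemma cmp_add {M N : ModuleCat.{0} R} {n : ℕ} (x y : Abelian.Ext.{0} N M n) :
    cmp (x + y) = cmp x + cmp y := by
  obtain ⟨f, hf, rfl⟩ := (projectiveResolution N).extMk_surjective x (n+1) rfl
  obtain ⟨g, hg, rfl⟩ := (projectiveResolution N).extMk_surjective y (n+1) rfl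
  rw [ProjectiveResolution.add_extMk, cmp_extMk, cmp_extMk, cmp_extMk, oldMk_add]

lemma cmp_surj {M N : ModuleCat.{0} R} {n : ℕ} (y : ((Ext R (ModuleCat.{0} R) n).obj (op N)).obj M) :
    ∃ x : Abelian.Ext.{0} N M n, cmp x = y := by
  obtain ⟨f, hf, rfl⟩ := oldMk_surj _ _ _ y
  exact ⟨_, cmp_extMk f hf⟩

lemma cmp_zero {M N : ModuleCat.{0} R} {n : ℕ} (x : Abelian.Ext.{0} N M n) (h : cmp x = 0) : x = 0 := by
  obtain ⟨f, hf, rfl⟩ := (projectiveResolution N).extMk_surjective x (n+1) rfl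
  rw [cmp_extMk, oldMk_zero_iff] at h
  exact (extMk_zero_iff f hf).2 h

lemma cmp_smul {M N : ModuleCat.{0} R} {n : ℕ} (r : R) (x : Abelian.Ext.{0} N M n) :
    cmp (x.comp (Abelian.Ext.mk₀ (r • 𝟙 M)) (add_zero _)) = r • cmp x := by
  obtain ⟨f, hf, rfl⟩ := (projectiveResolution N).extMk_surjective x (n+1) rfl
  have hf' : (projectiveResolution N).complex.d (n+1) n ≫ (r • f) = 0 := by simp [hf]
  rw [ProjectiveResolution.extMk_comp_mk₀, cmp_extMk, cmp_extMk, ← oldMk_smul _ _ _ _ _ _ hf']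
  congr 1

lemma cmp_nat {M M' N : ModuleCat.{0} R} {n : ℕ} (u : M ⟶ M') (x : Abelian.Ext.{0} N M n) :
    cmp (x.comp (Abelian.Ext.mk₀ u) (add_zero _)) =
      ((Ext R (ModuleCat.{0} R) n).obj (op N)).map u (cmp x) := by
  obtain ⟨f, hf, rfl⟩ := (projectiveResolution N).extMk_surjective x (n+1) rfl
  rw [ProjectiveResolution.extMk_comp_mk₀, cmp_extMk, cmp_extMk, oldMk_map]

def liftHom {N N' : ModuleCat.{0} R} (v : N' ⟶ N) :
    ProjectiveResolution.Hom (projectiveResolution N') (projectiveResolution N) v where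
  hom := ProjectiveResolution.lift v _ _
  hom_f_zero_comp_π_f_zero := by
    have := ProjectiveResolution.lift_commutes_zero v (projectiveResolution N') (projectiveResolution N)
    simpa using this

lemma cmp_nat' {M N N' : ModuleCat.{0} R} {n : ℕ} (v : N' ⟶ N) (x : Abelian.Ext.{0} N M n) :
    cmp ((Abelian.Ext.mk₀ v).comp x (zero_add _)) =
      ((Ext R (ModuleCat.{0} R) n).map v.op).app M (cmp x) := by
  obtain ⟨f, hf, rfl⟩ := (projectiveResolution N).extMk_surjective x (n+1) rfl
  rw [ProjectiveResolution.mk₀_comp_extMk _ _ _ _ (liftHom v), cmp_extMk, cmp_extMk, oldMk_map' _ _ _ _ _ _ _ (liftHom v)]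

section Part2
abbrev Q (J : Ideal R) : ModuleCat.{0} R := ModuleCat.of R (R ⧸ J)
def qm {J K : Ideal R} (h : J ≤ K) : Q J ⟶ Q K := ModuleCat.ofHom (Submodule.mapQ J K LinearMap.id h)

lemma qm_comp {J K L : Ideal R} (h : J ≤ K) (h' : K ≤ L) : qm h ≫ qm h' = qm (h.trans h') := by
  apply ModuleCat.hom_ext
  apply Submodule.linearMap_qext
  rfl

open localCohomology in
def lcCocone (I : Ideal R) (i : ℕ) (M : ModuleCat.{0} R) :
    Cocone (diagram (idealPowersDiagram I) i ⋙ (evaluation _ _).obj M) :=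
  ((evaluation _ _).obj M).mapCocone (colimit.cocone (diagram (idealPowersDiagram I) i))

open localCohomology in
def lcIsColimit (I : Ideal R) (i : ℕ) (M : ModuleCat.{0} R) : IsColimit (lcCocone I i M) :=
  isColimitOfPreserves _ (colimit.isColimit _)

open localCohomology in
def lcι (I : Ideal R) (i t : ℕ) : (Ext R (ModuleCat.{0} R) i).obj (op (Q (I^t))) ⟶ localCohomology I i :=
  colimit.ι (diagram (idealPowersDiagram I) i) (op (op t))

def io (I : Ideal R) {i : ℕ} (t : ℕ) {M : ModuleCat.{0} R} (x : Abelian.Ext.{0} (Q (I^t)) M i) :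
    (localCohomology I i).obj M :=
  ((lcι I i t).app M).hom (cmp x)

variable (I : Ideal R) {i : ℕ} {M M' : ModuleCat.{0} R}

lemma io_add (t : ℕ) (x y : Abelian.Ext.{0} (Q (I^t)) M i) : io I t (x + y) = io I t x + io I t y := by
  unfold io
  rw [cmp_add, map_add]

lemma io_smul (t : ℕ) (r : R) (x : Abelian.Ext.{0} (Q (I^t)) M i) :
    io I t (x.comp (Abelian.Ext.mk₀ (r • 𝟙 M)) (add_zero _)) = r • io I t x := by
  unfold io
  rw [cmp_smul, map_smul]

lemma io_nat (t : ℕ) (u : M ⟶ M') (x : Abelian.Ext.{0} (Q (I^t)) M i) :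
    io I t (x.comp (Abelian.Ext.mk₀ u) (add_zero _)) = ((localCohomology I i).map u).hom (io I t x) := by
  unfold io
  rw [cmp_nat]
  have := congrArg (fun z => z.hom (cmp x)) ((lcι I i t).naturality u)
  exact this

lemma io_nat' {s t : ℕ} (h : t ≤ s) (x : Abelian.Ext.{0} (Q (I^t)) M i) :
    io I s ((Abelian.Ext.mk₀ (qm (Ideal.pow_le_pow_right h))).comp x (zero_add _)) = io I t x := by
  unfold io
  rw [cmp_nat']
  have := colimit.w (localCohomology.diagram (localCohomology.idealPowersDiagram I) i)
    (Quiver.Hom.op (Quiver.Hom.op (homOfLE h : t ⟶ s)))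
  have := congrArg (fun z : (Ext R (ModuleCat.{0} R) i).obj (op (Q (I^t))) ⟶ localCohomology I i => (NatTrans.app z M).hom (cmp x)) this
  exact this

lemma io_surj (y : (localCohomology I i).obj M) : ∃ t, ∃ x : Abelian.Ext.{0} (Q (I^t)) M i, io I t x = y := by
  obtain ⟨j, y', hy⟩ := Concrete.isColimit_exists_rep _ (lcIsColimit I i M) y
  obtain ⟨x, hx⟩ := cmp_surj (N := Q (I ^ j.unop.unop)) y'
  refine ⟨j.unop.unop, x, ?_⟩
  unfold io
  rw [hx]
  exact hy

lemma io_zero (t : ℕ) (x : Abelian.Ext.{0} (Q (I^t)) M i) (h : io I t x = 0) :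
    ∃ s, ∃ h : t ≤ s, (Abelian.Ext.mk₀ (qm (Ideal.pow_le_pow_right h))).comp x (zero_add _) = 0 := by
  have h0 : io I t (0 : Abelian.Ext.{0} (Q (I^t)) M i) = 0 := by
    have := io_add I t (0 : Abelian.Ext.{0} (Q (I^t)) M i) 0
    rw [add_zero] at this
    simpa using this
  have hh : io I t x = io I t 0 := h.trans h0.symm
  obtain ⟨k, f, g, hk⟩ := Concrete.isColimit_exists_of_rep_eq _ (lcIsColimit I i M)
    (i := op (op t)) (j := op (op t)) (cmp x) (cmp 0) hh
  have hts : t ≤ k.unop.unop := leOfHom f.unop.unop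
  refine ⟨k.unop.unop, hts, ?_⟩
  apply cmp_zero
  have hfg : f = g := Subsingleton.elim _ _
  subst hfg
  have e1 := cmp_nat' (qm (Ideal.pow_le_pow_right (I := I) hts)) x
  have e2 := cmp_nat' (qm (Ideal.pow_le_pow_right (I := I) hts)) (0 : Abelian.Ext.{0} (Q (I^t)) M i)
  rw [Abelian.Ext.comp_zero] at e2
  have e3 : cmp (0 : Abelian.Ext.{0} (Q (I^k.unop.unop)) M i) = 0 := by
    have := cmp_add (0 : Abelian.Ext.{0} (Q (I^k.unop.unop)) M i) 0
    rw [add_zero] at this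
    simpa using this
  rw [e1, ← e3, e2]
  exact hk
end Part2
section Part3
open Abelian

def Kills {A B : ModuleCat.{0} R} (f : A ⟶ B) (n : ℕ) : Prop :=
  ∀ (M : ModuleCat.{0} R) (i : ℕ) (_ : n < i) (x : Ext.{0} B M i), (Ext.mk₀ f).comp x (zero_add _) = 0

lemma Kills.precomp {A B C : ModuleCat.{0} R} (f : A ⟶ B) {g : B ⟶ C} {n : ℕ} (hg : Kills g n) :
    Kills (f ≫ g) n := by
  intro M i hi x
  rw [← Ext.mk₀_comp_mk₀_assoc, hg M i hi, Ext.comp_zero]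

lemma Kills.postcomp {A B C : ModuleCat.{0} R} {f : A ⟶ B} (g : B ⟶ C) {n : ℕ} (hf : Kills f n) :
    Kills (f ≫ g) n := by
  intro M i hi x
  rw [← Ext.mk₀_comp_mk₀_assoc, hf M i hi]

lemma kills_of_projective {A B : ModuleCat.{0} R} [Projective A] (f : A ⟶ B) : Kills f 0 := by
  intro M i hi x
  obtain ⟨j, rfl⟩ : ∃ j, i = j + 1 := ⟨i - 1, by omega⟩
  exact Ext.eq_zero_of_projective _

lemma kills_of_ses {S₁ S₂ S₃ : ShortComplex (ModuleCat.{0} R)} (h₁ : S₁.ShortExact) (h₂ : S₂.ShortExact)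
    (φ : S₁ ⟶ S₂) (ψ : S₂ ⟶ S₃) {n : ℕ} (hφ : Kills φ.τ₁ n) (hψ : Kills ψ.τ₂ n) :
    Kills (φ.τ₃ ≫ ψ.τ₃) (n + 1) := by
  intro M i hi x
  obtain ⟨j, rfl⟩ : ∃ j, i = 1 + j := ⟨i - 1, by omega⟩
  rw [← Ext.mk₀_comp_mk₀_assoc]
  have h0 : (Ext.mk₀ S₂.g).comp ((Ext.mk₀ ψ.τ₃).comp x (zero_add _)) (zero_add _) = 0 := by
    rw [Ext.mk₀_comp_mk₀_assoc, ← ψ.comm₂₃, ← Ext.mk₀_comp_mk₀_assoc]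
    exact hψ _ _ (by omega) _
  obtain ⟨y, hy⟩ := Ext.contravariant_sequence_exact₃ h₂ _ _ h0 rfl
  rw [← hy, ← Ext.comp_assoc (Ext.mk₀ φ.τ₃) h₂.extClass y (zero_add 1) rfl (by omega), ← ShortComplex.ShortExact.extClass_naturality h₁ h₂ φ,
    Ext.comp_assoc h₁.extClass (Ext.mk₀ φ.τ₁) y (add_zero 1) (zero_add _) (by omega), hφ M j (by omega), Ext.comp_zero]

/-- multiplication by `a` -/
def mm (A B : Ideal R) (a : R) (h : ∀ r ∈ A, a * r ∈ B) : Q A ⟶ Q B :=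
  ModuleCat.ofHom (Submodule.mapQ A B (LinearMap.lsmul R R a) h)

def col (A : Ideal R) (a : R) : Ideal R := Submodule.comap (LinearMap.lsmul R R a) A

lemma mem_col {A : Ideal R} {a r : R} : r ∈ col A a ↔ a * r ∈ A := Iff.rfl

lemma mm_comp {A B C : Ideal R} {a b c : R} (h h' h'') (hc : c = a * b) : mm A B a h ≫ mm B C b h' = mm A C c h'' := by
  subst hc
  apply ModuleCat.hom_ext
  apply Submodule.linearMap_qext
  apply LinearMap.ext
  intro r
  change Submodule.Quotient.mk (b * (a * r)) = Submodule.Quotient.mk (a * b * r)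
  congr 1
  ring

lemma qm_eq {A B : Ideal R} (h : A ≤ B) : qm h = mm A B 1 (fun r hr => by rw [one_mul]; exact h hr) := by
  apply ModuleCat.hom_ext
  apply Submodule.linearMap_qext
  apply LinearMap.ext
  intro r
  change Submodule.Quotient.mk r = Submodule.Quotient.mk (1 * r)
  simp

def Sc (A : Ideal R) (a : R) : ShortComplex (ModuleCat.{0} R) where
  X₁ := Q (col A a)
  X₂ := Q A
  X₃ := Q (A ⊔ Ideal.span {a})
  f := mm (col A a) A a (fun r hr => mem_col.1 hr)
  g := qm le_sup_left
  zero := by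
    apply ModuleCat.hom_ext
    apply Submodule.linearMap_qext
    apply LinearMap.ext
    intro r
    change Submodule.Quotient.mk (a * r) = 0
    rw [Submodule.Quotient.mk_eq_zero]
    exact Ideal.mul_mem_right _ _ (Ideal.mem_sup_right (Ideal.mem_span_singleton_self a))

lemma Sc_exact (A : Ideal R) (a : R) : (Sc A a).ShortExact where
  exact := by
    rw [ShortComplex.moduleCat_exact_iff]
    intro x hx
    obtain ⟨x, rfl⟩ := Submodule.Quotient.mk_surjective _ x
    replace hx : (Submodule.Quotient.mk x : R ⧸ (A ⊔ Ideal.span {a})) = 0 := hx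
    rw [Submodule.Quotient.mk_eq_zero, Submodule.mem_sup] at hx
    obtain ⟨y, hy, z, hz, rfl⟩ := hx
    obtain ⟨r, rfl⟩ := Ideal.mem_span_singleton'.1 hz
    refine ⟨(Submodule.Quotient.mk r : R ⧸ col A a), ?_⟩
    change (Submodule.Quotient.mk (a * r) : R ⧸ A) = Submodule.Quotient.mk _
    rw [Submodule.Quotient.eq]
    have : a * r - (y + r * a) = -y := by ring
    rw [this]
    exact neg_mem hy
  mono_f := by
    rw [ModuleCat.mono_iff_injective, injective_iff_map_eq_zero]
    intro x hx
    obtain ⟨x, rfl⟩ := Submodule.Quotient.mk_surjective _ x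
    replace hx : (Submodule.Quotient.mk (a * x) : R ⧸ A) = 0 := hx
    rw [Submodule.Quotient.mk_eq_zero] at hx
    change (Submodule.Quotient.mk x : R ⧸ col A a) = 0
    rw [Submodule.Quotient.mk_eq_zero]
    exact hx
  epi_g := by
    rw [ModuleCat.epi_iff_surjective]
    intro x
    obtain ⟨x, rfl⟩ := Submodule.Quotient.mk_surjective _ x
    exact ⟨(Submodule.Quotient.mk x : R ⧸ A), rfl⟩

def ScMap {A B : Ideal R} {a b d : R} (h : A ≤ B) (hd : a = d * b) : Sc A a ⟶ Sc B b where
  τ₁ := mm (col A a) (col B b) d (fun r hr => by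
    rw [mem_col] at hr ⊢
    have : b * (d * r) = a * r := by rw [hd]; ring
    rw [this]
    exact h hr)
  τ₂ := qm h
  τ₃ := qm (sup_le_sup h ((Ideal.span_singleton_le_span_singleton).2 ⟨d, by rw [hd, mul_comm]⟩))
  comm₁₂ := by
    change mm _ _ _ _ ≫ mm _ _ _ _ = mm _ _ _ _ ≫ qm _
    have h3 : ∀ r ∈ col A a, a * r ∈ B := fun r hr => h hr
    refine (mm_comp (c := a) _ _ h3 hd).trans ?_
    rw [qm_eq]
    exact (mm_comp (c := a) _ _ h3 (mul_one a).symm).symm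
  comm₂₃ := by
    change qm _ ≫ qm _ = qm _ ≫ qm _
    rw [qm_comp, qm_comp]

def PP (J : Ideal R) (n : ℕ) : Prop :=
  ∀ t, ∃ s, ∃ h : t ≤ s, Kills (qm (Ideal.pow_le_pow_right (I := J) h)) n

lemma PP_bot : PP (⊥ : Ideal R) 0 := by
  intro t
  refine ⟨t + 1, by omega, ?_⟩
  have h0 : (⊥ : Ideal R) ^ (t + 1) = ⊥ := by
    rw [pow_succ, Ideal.mul_bot]
  have : Module.Projective R (R ⧸ (⊥ : Ideal R) ^ (t + 1)) :=
    Module.Projective.of_equiv (Submodule.quotEquivOfEqBot _ h0).symm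
  have : Projective (Q ((⊥ : Ideal R) ^ (t + 1))) := (IsProjective.iff_projective _).1 this
  exact kills_of_projective _

lemma col_stab [IsNoetherianRing R] (A : Ideal R) (x : R) : ∃ k, ∀ s, k ≤ s → ∀ s', k ≤ s' → ∀ r, x ^ s * r ∈ A → x ^ s' * r ∈ A := by
  let f : ℕ →o Ideal R := ⟨fun s => col A (x ^ s), by
    intro s s' h r hr
    rw [mem_col] at hr ⊢
    have : x ^ s' * r = x ^ (s' - s) * (x ^ s * r) := by
      rw [← mul_assoc, ← pow_add]; congr 2; omega
    rw [this]
    exact Ideal.mul_mem_left _ _ hr⟩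
  obtain ⟨k, hk⟩ := (monotone_stabilizes_iff_noetherian.2 (inferInstanceAs (IsNoetherian R R))) f
  refine ⟨k, fun s hs s' hs' r hr => ?_⟩
  have : f s = f s' := (hk s hs).symm.trans (hk s' hs')
  have hr' : r ∈ f s := hr
  rw [this] at hr'
  exact hr'

lemma PP_step [IsNoetherianRing R] (J : Ideal R) (x : R) (n : ℕ) (hJ : PP J n) :
    PP (J ⊔ Ideal.span {x}) (n + 1) := by
  intro t
  obtain ⟨u, htu, hu⟩ := hJ t
  obtain ⟨v, huv, hv⟩ := hJ u
  obtain ⟨k, hk⟩ := col_stab (J ^ v) x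
  let s := v + k
  have hvs : v ≤ s := by omega
  have hus : u ≤ s := by omega
  let φ : Sc (J ^ s) (x ^ s) ⟶ Sc (J ^ u) (x ^ u) :=
    ScMap (d := x ^ (s - u)) (Ideal.pow_le_pow_right hus) (by rw [← pow_add]; congr 1; omega)
  let ψ : Sc (J ^ u) (x ^ u) ⟶ Sc (J ^ t) (x ^ t) :=
    ScMap (d := x ^ (u - t)) (Ideal.pow_le_pow_right htu) (by rw [← pow_add]; congr 1; omega)
  have hφ : Kills φ.τ₁ n := by
    have h1 : ∀ r ∈ col (J ^ s) (x ^ s), x ^ (s - v) * r ∈ J ^ v := by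
      intro r hr
      exact hk s (by omega) _ (by omega) _ (Ideal.pow_le_pow_right hvs hr)
    have h2 : ∀ r ∈ J ^ u, x ^ (v - u) * r ∈ col (J ^ u) (x ^ u) := fun r hr =>
      Ideal.mul_mem_left _ _ (Ideal.mul_mem_left _ _ hr)
    have e : φ.τ₁ = mm _ _ _ h1 ≫ qm (Ideal.pow_le_pow_right huv) ≫ mm _ _ _ h2 := by
      rw [qm_eq, mm_comp (c := x ^ (v - u)) _ _ (fun r hr => h2 _ (Ideal.pow_le_pow_right huv hr)) (by ring),
        mm_comp (c := x ^ (s - u))]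
      · rfl
      · rw [← pow_add]; congr 1; omega
    rw [e]
    exact (hv.postcomp _).precomp _
  have key := kills_of_ses (Sc_exact _ _) (Sc_exact _ _) φ ψ hφ hu
  refine ⟨s + s, by omega, ?_⟩
  have l1 : (J ⊔ Ideal.span {x}) ^ (s + s) ≤ J ^ s ⊔ Ideal.span {x ^ s} := by
    rw [← Ideal.span_singleton_pow]
    exact Ideal.sup_pow_add_le_pow_sup_pow
  have l2 : J ^ t ⊔ Ideal.span {x ^ t} ≤ (J ⊔ Ideal.span {x}) ^ t := by
    rw [← Ideal.span_singleton_pow]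
    exact sup_le (Ideal.pow_right_mono le_sup_left _) (Ideal.pow_right_mono le_sup_right _)
  have := (key.postcomp (qm l2)).precomp (qm l1)
  have e : qm l1 ≫ (φ.τ₃ ≫ ψ.τ₃) ≫ qm l2 = qm (Ideal.pow_le_pow_right (by omega)) := by
    change qm l1 ≫ (qm _ ≫ qm _) ≫ qm l2 = _
    rw [qm_comp, qm_comp, qm_comp]
  exact Eq.subst (motive := fun z => Kills z (n + 1)) e this

lemma PP_all [IsNoetherianRing R] (I : Ideal R) : ∃ n, PP I n := by
  classical
  obtain ⟨S, rfl⟩ := (isNoetherianRing_iff_ideal_fg R).1 inferInstance I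
  induction S using Finset.induction_on with
  | empty => exact ⟨0, by simpa using PP_bot⟩
  | insert a S _ ih =>
    obtain ⟨n, hn⟩ := ih
    refine ⟨n + 1, ?_⟩
    have := PP_step _ a n hn
    rw [Finset.coe_insert, Ideal.span_insert, sup_comm]
    exact this

lemma io_map_zero (I : Ideal R) {i : ℕ} (t : ℕ) {M : ModuleCat.{0} R} : io I t (0 : Ext.{0} (Q (I^t)) M i) = 0 := by
  have := io_add I t (0 : Abelian.Ext.{0} (Q (I^t)) M i) 0
  rw [add_zero] at this
  simpa using this

lemma lc_vanish_large [IsNoetherianRing R] (I : Ideal R) :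
    ∃ n, ∀ i, n < i → ∀ M : ModuleCat.{0} R, ∀ y : (localCohomology I i).obj M, y = 0 := by
  obtain ⟨n, hn⟩ := PP_all I
  refine ⟨n, fun i hi M y => ?_⟩
  obtain ⟨t, x, rfl⟩ := io_surj I y
  obtain ⟨s, hs, h⟩ := hn t
  rw [← io_nat' I hs, h M i hi x, io_map_zero]
end Part3
section Part4
open Abelian TensorProduct

abbrev LC (I : Ideal R) (i : ℕ) (M : Type) [AddCommGroup M] [Module R M] : ModuleCat.{0} R :=
  (localCohomology I i).obj (ModuleCat.of R M)

variable (I : Ideal R) (i : ℕ) {M M' M'' : Type} [AddCommGroup M] [Module R M] [AddCommGroup M'] [Module R M']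
  [AddCommGroup M''] [Module R M'']

def lm (f : M →ₗ[R] M') : LC I i M →ₗ[R] LC I i M' := ((localCohomology I i).map (ModuleCat.ofHom f)).hom

lemma lm_io (f : M →ₗ[R] M') (t : ℕ) (x : Ext.{0} (Q (I ^ t)) (ModuleCat.of R M) i) :
    lm I i f (io I t x) = io I t (x.comp (Ext.mk₀ (ModuleCat.ofHom f)) (add_zero _)) := (io_nat I t _ x).symm

lemma lm_add (f g : M →ₗ[R] M') (y : LC I i M) : lm I i (f + g) y = lm I i f y + lm I i g y := by
  obtain ⟨t, x, rfl⟩ := io_surj I y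
  rw [lm_io, lm_io, lm_io, ModuleCat.ofHom_add, Ext.mk₀_add, Ext.comp_add, io_add]

lemma lm_smul (r : R) (f : M →ₗ[R] M') (y : LC I i M) : lm I i (r • f) y = r • lm I i f y := by
  obtain ⟨t, x, rfl⟩ := io_surj I y
  rw [lm_io, lm_io, ← io_smul, Ext.comp_assoc_of_third_deg_zero, Ext.mk₀_comp_mk₀]
  congr 3

lemma lm_comp (f : M →ₗ[R] M') (g : M' →ₗ[R] M'') (y : LC I i M) :
    lm I i (g ∘ₗ f) y = lm I i g (lm I i f y) := by
  unfold lm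
  rw [ModuleCat.ofHom_comp, Functor.map_comp]
  rfl

lemma lm_id (y : LC I i M) : lm I i LinearMap.id y = y := by
  unfold lm
  rw [ModuleCat.ofHom_id, CategoryTheory.Functor.map_id]
  rfl

lemma lm_zero (y : LC I i M) : lm I i (0 : M →ₗ[R] M') y = 0 := by
  have := lm_smul I i 0 (0 : M →ₗ[R] M') y
  simpa using this

lemma lm_sum {ι : Type} (S : Finset ι) (f : ι → M →ₗ[R] M') (y : LC I i M) :
    lm I i (∑ s ∈ S, f s) y = ∑ s ∈ S, lm I i (f s) y := by
  classical
  induction S using Finset.induction_on with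
  | empty => simp [lm_zero]
  | insert a S ha ih => rw [Finset.sum_insert ha, Finset.sum_insert ha, lm_add, ih]

def pS (R : Type) [CommRing R] {ι : Type} (S : Finset ι) : (ι →₀ R) →ₗ[R] (ι →₀ R) :=
  ∑ s ∈ S, (Finsupp.lsingle s) ∘ₗ (Finsupp.lapply s)

lemma pS_eq {ι : Type} (S : Finset ι) (v : ι →₀ R) (h : v.support ⊆ S) : pS R S v = v := by
  unfold pS
  rw [LinearMap.sum_apply]
  simp only [LinearMap.comp_apply, Finsupp.lapply_apply, Finsupp.lsingle_apply]
  rw [← Finset.sum_subset h]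
  · exact Finsupp.sum_single v
  · intro s _ hs
    rw [Finsupp.notMem_support_iff.1 hs, Finsupp.single_zero]

lemma finite_supp [IsNoetherianRing R] {ι : Type} (i : ℕ) : ∀ (N : Type) [AddCommGroup N] [Module R N] [Module.Finite R N]
    (y : Ext.{0} (ModuleCat.of R N) (ModuleCat.of R (ι →₀ R)) i),
    ∃ S : Finset ι, y.comp (Ext.mk₀ (ModuleCat.ofHom (pS R S))) (add_zero _) = y := by
  classical
  induction i with
  | zero =>
    intro N _ _ hN y
    obtain ⟨f, rfl⟩ := (Ext.mk₀_bijective _ _).2 y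
    obtain ⟨G, hG⟩ := hN.fg_top
    refine ⟨G.biUnion (fun g => (f.hom g : ι →₀ R).support), ?_⟩
    rw [Ext.mk₀_comp_mk₀]
    congr 1
    apply ModuleCat.hom_ext
    apply LinearMap.ext_on hG
    intro g hg
    exact pS_eq _ _ (Finset.subset_biUnion_of_mem (fun g => (f.hom g : ι →₀ R).support) hg)
  | succ i ih =>
    intro N _ _ hN y
    obtain ⟨n, f, hf⟩ := Module.Finite.exists_fin' R N
    have hS := LinearMap.shortExact_shortComplexKer hf
    have : Projective (ModuleCat.of R (Fin n → R)) := (IsProjective.iff_projective _).1 inferInstance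
    obtain ⟨z, hz⟩ := Ext.contravariant_sequence_exact₃ hS _ y
      (Ext.eq_zero_of_projective (P := ModuleCat.of R (Fin n → R)) _) (n₀ := i) (by omega)
    obtain ⟨S, h⟩ := ih (LinearMap.ker f) z
    refine ⟨S, ?_⟩
    rw [← hz, Ext.comp_assoc_of_third_deg_zero, h]

lemma free_decomp [IsNoetherianRing R] {ι : Type} (y : LC I i (ι →₀ R)) :
    ∃ S : Finset ι, y = ∑ s ∈ S, lm I i (Finsupp.lsingle s) (lm I i (Finsupp.lapply s) y) := by
  obtain ⟨t, x, rfl⟩ := io_surj I y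
  obtain ⟨S, hS⟩ := finite_supp i (R ⧸ I ^ t) x
  refine ⟨S, ?_⟩
  have : lm I i (pS R S) (io I t x) = io I t x := by rw [lm_io, hS]
  conv_lhs => rw [← this]
  unfold pS
  rw [lm_sum]
  simp only [lm_comp]

lemma lc_surj (f : M →ₗ[R] M') (hf : Function.Surjective f)
    (hv : ∀ y : LC I (i + 1) (LinearMap.ker f), y = 0) : Function.Surjective (lm I i f) := by
  intro y
  obtain ⟨t, x, rfl⟩ := io_surj I y
  have hS := LinearMap.shortExact_shortComplexKer hf
  obtain ⟨s, hs, h⟩ := io_zero I t (Ext.comp (Y := (LinearMap.shortComplexKer f).X₃) x hS.extClass rfl) (hv _)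
  rw [← Ext.comp_assoc (Ext.mk₀ (qm (Ideal.pow_le_pow_right (I := I) hs))) (Z := (LinearMap.shortComplexKer f).X₃)  x hS.extClass (zero_add _) rfl (by omega)] at h
  obtain ⟨z, hz⟩ := Ext.covariant_sequence_exact₃ _ hS _ _ h
  refine ⟨io I s z, ?_⟩
  rw [← io_nat' I hs x, ← hz]
  exact lm_io _ _ _ _ _

lemma lc_exact (f : M →ₗ[R] M') (hf : Function.Surjective f) (y : LC I i M) (hy : lm I i f y = 0) :
    ∃ z, lm I i (LinearMap.ker f).subtype z = y := by
  obtain ⟨t, x, rfl⟩ := io_surj I y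
  have hS := LinearMap.shortExact_shortComplexKer hf
  rw [lm_io] at hy
  obtain ⟨s, hs, h⟩ := io_zero I t _ hy
  rw [← Ext.comp_assoc_of_third_deg_zero] at h
  obtain ⟨z, hz⟩ := Ext.covariant_sequence_exact₂ _ hS _ h
  refine ⟨io I s z, ?_⟩
  rw [← io_nat' I hs x, ← hz]
  exact lm_io _ _ _ _ _

def pi (M : Type) [AddCommGroup M] [Module R M] : (M →₀ R) →ₗ[R] M := Finsupp.linearCombination R id

lemma pi_surj (M : Type) [AddCommGroup M] [Module R M] : Function.Surjective (pi (R := R) M) :=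
  Finsupp.linearCombination_id_surjective R M

lemma pi_single (m : M) : pi (R := R) M ∘ₗ Finsupp.lsingle m = LinearMap.toSpanSingleton R M m := by
  apply LinearMap.ext_ring
  simp [pi]

lemma lc_vanish [IsNoetherianRing R] (h : ℕ)
    (hvan : ∀ l : ℕ, h < l → ∀ y : LC I l R, y = 0) :
    ∀ l, h < l → ∀ (M : Type) [AddCommGroup M] [Module R M] (y : LC I l M), y = 0 := by
  obtain ⟨n, hn⟩ := lc_vanish_large I
  have key : ∀ k l, h < l → n < l + k → ∀ (M : Type) [AddCommGroup M] [Module R M] (y : LC I l M), y = 0 := by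
    intro k
    induction k with
    | zero => intro l _ hl M _ _ y; exact hn l hl _ y
    | succ k ih =>
      intro l hl hlk M _ _ y
      obtain ⟨w, rfl⟩ := lc_surj I l (pi M) (pi_surj M) (fun y => ih (l + 1) (by omega) (by omega) _ y) y
      obtain ⟨S, hS⟩ := free_decomp I l w
      rw [hS]
      simp only [hvan l hl (lm I l (Finsupp.lapply _) w), map_zero, Finset.sum_const_zero]
  intro l hl M _ _ y
  exact key (n + 1) l hl (by omega) M y

def th (M : Type) [AddCommGroup M] [Module R M] : LC I i R ⊗[R] M →ₗ[R] LC I i M :=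
  TensorProduct.lift (LinearMap.mk₂ R (fun x m => lm I i (LinearMap.toSpanSingleton R M m) x)
    (fun x y m => map_add _ _ _) (fun c x m => map_smul _ _ _)
    (fun x m m' => by rw [LinearMap.toSpanSingleton_add, lm_add])
    (fun c x m => by rw [LinearMap.toSpanSingleton_smul, lm_smul]))

lemma th_tmul (x : LC I i R) (m : M) : th I i M (x ⊗ₜ m) = lm I i (LinearMap.toSpanSingleton R M m) x := rfl

lemma th_nat (f : M →ₗ[R] M') (z : LC I i R ⊗[R] M) :
    lm I i f (th I i M z) = th I i M' (f.lTensor _ z) := by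
  induction z with
  | zero => simp
  | add a b ha hb => simp only [map_add, ha, hb]
  | tmul x m =>
    rw [LinearMap.lTensor_tmul, th_tmul, th_tmul, ← lm_comp]
    congr 1
    congr 1
    apply LinearMap.ext_ring
    simp

lemma th_surj [IsNoetherianRing R]
    (hv : ∀ (M : Type) [AddCommGroup M] [Module R M] (y : LC I (i+1) M), y = 0) :
    Function.Surjective (th I i M) := by
  intro y
  obtain ⟨w, rfl⟩ := lc_surj I i (pi M) (pi_surj M) (hv _) y
  obtain ⟨S, hS⟩ := free_decomp I i w
  refine ⟨∑ s ∈ S, (lm I i (Finsupp.lapply s) w) ⊗ₜ s, ?_⟩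
  conv_rhs => rw [hS]
  simp only [map_sum, th_tmul, ← lm_comp I i (Finsupp.lsingle _), pi_single]

lemma th_free_inj {ι : Type} (z : LC I i R ⊗[R] (ι →₀ R)) (hz : th I i (ι →₀ R) z = 0) : z = 0 := by
  classical
  have key : ∀ (s : ι) (z : LC I i R ⊗[R] (ι →₀ R)), lm I i (Finsupp.lapply s) (th I i (ι →₀ R) z) =
      TensorProduct.finsuppScalarRight R R (LC I i R) ι z s := by
    intro s z
    induction z with
    | zero => simp
    | add a b ha hb => simp only [map_add, ha, hb, Finsupp.add_apply]
    | tmul x m =>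
      rw [TensorProduct.finsuppScalarRight_apply_tmul_apply, th_tmul, ← lm_comp]
      have : (Finsupp.lapply s ∘ₗ LinearMap.toSpanSingleton R (ι →₀ R) m : R →ₗ[R] R) = m s • LinearMap.id := by
        apply LinearMap.ext_ring
        simp
      rw [this, lm_smul, lm_id]
  apply (TensorProduct.finsuppScalarRight R R (LC I i R) ι).injective
  rw [map_zero]
  ext s
  rw [← key, hz, map_zero]
  rfl

lemma th_inj [IsNoetherianRing R]
    (hv : ∀ (M : Type) [AddCommGroup M] [Module R M] (y : LC I (i+1) M), y = 0) :
    Function.Injective (th I i M) := by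
  rw [injective_iff_map_eq_zero]
  intro z hz
  obtain ⟨z', rfl⟩ := LinearMap.lTensor_surjective (LC I i R) (pi_surj (R := R) M) z
  rw [← th_nat] at hz
  obtain ⟨k, hk⟩ := lc_exact I i (pi M) (pi_surj M) _ hz
  obtain ⟨k', rfl⟩ := th_surj I i hv k
  rw [th_nat] at hk
  have h0 : (LinearMap.ker (pi (R := R) M)).subtype.lTensor (LC I i R) k' - z' = 0 := by
    apply th_free_inj
    rw [map_sub, hk, sub_self]
  rw [sub_eq_zero] at h0
  rw [← h0, ← LinearMap.comp_apply, ← LinearMap.lTensor_comp, LinearMap.comp_ker_subtype, LinearMap.lTensor_zero]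
  rfl

end Part4
end
end LCaux

open CategoryTheory

/-- Let `(R, m)` be a noetherian local complete ring, `E` an injective hull
of the residue field `R/m` and `D = Hom_R(-, E)` the Matlis dual functor.  Let `I` be an
ideal of `R` such that `H^l_I(R) = 0` for every `l ≠ h`, and set `H := H^h_I(R)`.
Then there is an isomorphism of `R`-modules `Hom_R(H, D²(H)) ≅ D(H^h_I(D(H)))`. -/
theorem stmt2 {R : Type} [CommRing R] [IsNoetherianRing R] [IsLocalRing R]
    [IsAdicComplete (IsLocalRing.maximalIdeal R) R]
    (E : Type) [AddCommGroup E] [Module R E] [Module.Injective R E]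
    (e : IsLocalRing.ResidueField R →ₗ[R] E) (he : Function.Injective e)
    (hess : ∀ N : Submodule R E, N ≠ ⊥ → N ⊓ LinearMap.range e ≠ ⊥)
    (I : Ideal R) (h : ℕ)
    (hvan : ∀ l : ℕ, l ≠ h → Subsingleton ((localCohomology I l).obj (ModuleCat.of R R))) :
    Nonempty
      ((((localCohomology I h).obj (ModuleCat.of R R)) →ₗ[R]
          (((((localCohomology I h).obj (ModuleCat.of R R)) →ₗ[R] E) →ₗ[R] E))) ≃ₗ[R]
        (((localCohomology I h).obj
            (ModuleCat.of R ((((localCohomology I h).obj (ModuleCat.of R R)) →ₗ[R] E)))) →ₗ[R]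
          E)) := by
  have hv := LCaux.lc_vanish I h (fun l hl y => by
    have := hvan l (by omega)
    exact Subsingleton.elim _ _)
  let DH := (((localCohomology I h).obj (ModuleCat.of R R)) →ₗ[R] E)
  let θ := LinearEquiv.ofBijective (LCaux.th I h DH)
    ⟨LCaux.th_inj I h (hv (h + 1) (by omega)), LCaux.th_surj I h (hv (h + 1) (by omega))⟩
  exact ⟨(TensorProduct.lift.equiv (RingHom.id R) _ _ _).trans (LinearEquiv.congrLeft E R θ)⟩
end

section
/- Let (R,m) be a Noetherian local ring and I an ideal of R such that H^l_I(R) = 0 for every l ≠ h. Then for every n ∈ ℕ, the submodule (0 :_{H^h_I(R)} I^n) of elements of H^h_I(R) annihilated by I^n is isomorphic to Ext^h_R(R/I^n, R); in particular it is a finitely generated R-module. -/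
open CategoryTheory

namespace Stmt9
open Abelian

variable {R : Type} [CommRing R]

/-- Finitely generated and annihilated by a power of `I`. -/
structure FT (I : Ideal R) (N : ModuleCat.{0} R) : Prop where
  fin : Module.Finite R N
  tors : ∃ t : ℕ, ∀ a ∈ I ^ t, ∀ x : N, a • x = 0

/-- Vanishing of `Ext^l(N, M)` on finitely generated `I`-power torsion modules. -/
def Van (I : Ideal R) (M : ModuleCat.{0} R) (l : ℕ) : Prop :=
  ∀ N : ModuleCat.{0} R, FT I N → ∀ x : Ext N M l, x = 0

lemma precomp_inj [IsNoetherianRing R] {I : Ideal R} {M : ModuleCat.{0} R} {l : ℕ}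
    (hl : ∀ j, j + 1 = l → Van I M j)
    {A B : Type} [AddCommGroup A] [Module R A] [AddCommGroup B] [Module R B]
    (hA : FT I (ModuleCat.of R A)) (g : A →ₗ[R] B) (hg : Function.Surjective g)
    (x : Ext (ModuleCat.of R B) M l)
    (hx : (Ext.mk₀ (ModuleCat.ofHom g)).comp x (zero_add l) = 0) : x = 0 := by
  cases l with
  | zero =>
    have : Epi (ModuleCat.ofHom g) := (ModuleCat.epi_iff_surjective _).2 hg
    apply Ext.precomp_mk₀_injective_of_epi M (ModuleCat.ofHom g)
    simpa using hx
  | succ l =>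
    obtain ⟨y, rfl⟩ := Ext.contravariant_sequence_exact₃
      (LinearMap.shortExact_shortComplexKer hg) M x hx (add_comm 1 l)
    have := hA.fin
    have hA' : Module.Finite R A := hA.fin
    rw [hl l rfl _ ⟨?_, ?_⟩ y, Ext.comp_zero]
    · change Module.Finite R (LinearMap.ker g)
      infer_instance
    · obtain ⟨t, ht⟩ := hA.tors
      exact ⟨t, fun a ha x => Subtype.ext (ht a ha x.1)⟩

lemma pi_detect {M : ModuleCat.{0} R} {l k : ℕ} {A : Type} [AddCommGroup A] [Module R A]
    (y : Ext (ModuleCat.of R (Fin k → A)) M l)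
    (hy : ∀ i, (Ext.mk₀ (ModuleCat.ofHom (LinearMap.single R (fun _ : Fin k => A) i))).comp y
      (zero_add l) = 0) : y = 0 := by
  have h1 : 𝟙 (ModuleCat.of R (Fin k → A)) = ∑ i, ModuleCat.ofHom (LinearMap.proj i) ≫
      ModuleCat.ofHom (LinearMap.single R (fun _ : Fin k => A) i) := by
    apply ModuleCat.hom_ext
    rw [ModuleCat.hom_sum]
    ext x j
    simp [Pi.single_apply]
  rw [← Ext.mk₀_id_comp y, h1, Ext.mk₀_sum, Ext.sum_comp]
  refine Finset.sum_eq_zero fun i _ => ?_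
  rw [← Ext.mk₀_comp_mk₀, Ext.comp_assoc_of_second_deg_zero, hy, Ext.comp_zero]

lemma ft_pi (I : Ideal R) (t k : ℕ) : FT I (ModuleCat.of R (Fin k → R ⧸ I ^ t)) := by
  refine ⟨inferInstanceAs (Module.Finite R (Fin k → R ⧸ I ^ t)), t, fun a ha x => ?_⟩
  change Fin k → R ⧸ I ^ t at x
  funext i
  obtain ⟨b, hb⟩ := Submodule.Quotient.mk_surjective _ (x i)
  change a • x i = 0
  rw [← hb, ← Submodule.Quotient.mk_smul, Submodule.Quotient.mk_eq_zero]
  exact Ideal.mul_mem_right _ _ ha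

lemma ft_quot (I : Ideal R) (t : ℕ) : FT I (ModuleCat.of R (R ⧸ I ^ t)) := by
  refine ⟨inferInstanceAs (Module.Finite R (R ⧸ I ^ t)), t, fun a ha x => ?_⟩
  change R ⧸ I ^ t at x
  obtain ⟨b, hb⟩ := Submodule.Quotient.mk_surjective _ x
  change a • x = 0
  rw [← hb, ← Submodule.Quotient.mk_smul, Submodule.Quotient.mk_eq_zero]
  exact Ideal.mul_mem_right _ _ ha

lemma detect [IsNoetherianRing R] {I : Ideal R} {M : ModuleCat.{0} R} {l : ℕ}
    (hl : ∀ j, j + 1 = l → Van I M j) (N : ModuleCat.{0} R) [Module.Finite R N] (t : ℕ)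
    (ht : ∀ a ∈ I ^ t, ∀ x : N, a • x = 0) (x : Ext N M l)
    (hx : ∀ f : (R ⧸ I ^ t) →ₗ[R] N,
      (Ext.mk₀ (ModuleCat.ofHom f)).comp x (zero_add l) = 0) : x = 0 := by
  obtain ⟨k, v, hv⟩ := Module.Finite.exists_fin (R := R) (M := N)
  let f : Fin k → (R ⧸ I ^ t) →ₗ[R] N := fun i =>
    Submodule.liftQ _ (LinearMap.toSpanSingleton R N (v i)) (fun a ha => by
      exact (LinearMap.mem_ker).2 ((LinearMap.toSpanSingleton_apply R N (v i) a).trans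
        (ht a ha (v i))))
  let g : (Fin k → R ⧸ I ^ t) →ₗ[R] N := LinearMap.lsum R _ R f
  have hgs : ∀ i, g ∘ₗ LinearMap.single R (fun _ : Fin k => R ⧸ I ^ t) i = f i := by
    intro i
    refine LinearMap.ext fun y => ?_
    exact LinearMap.lsum_piSingle _ _ _ _ _ _
  have hg : Function.Surjective g := by
    rw [← LinearMap.range_eq_top, eq_top_iff, ← hv, Submodule.span_le]
    rintro _ ⟨i, rfl⟩
    refine ⟨Pi.single i (Submodule.Quotient.mk 1), ?_⟩
    have := LinearMap.congr_fun (hgs i) (Submodule.Quotient.mk 1)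
    refine this.trans ?_
    simp only [f]
    erw [Submodule.liftQ_apply]
    simp
  refine precomp_inj hl (ft_pi I t k) g hg x (pi_detect _ fun i => ?_)
  rw [← Ext.comp_assoc_of_second_deg_zero, Ext.mk₀_comp_mk₀, ← ModuleCat.ofHom_comp, hgs]
  exact hx _

/-- The projection `R/I^s → R/I^t`. -/
def q (I : Ideal R) {t s : ℕ} (h : t ≤ s) : (R ⧸ I ^ s) →ₗ[R] (R ⧸ I ^ t) :=
  Submodule.mapQ _ _ LinearMap.id (Ideal.pow_le_pow_right h)

lemma q_surj (I : Ideal R) {t s : ℕ} (h : t ≤ s) : Function.Surjective (q I h) := by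
  intro x
  obtain ⟨b, rfl⟩ := Submodule.Quotient.mk_surjective _ x
  exact ⟨Submodule.Quotient.mk b, rfl⟩

lemma van [IsNoetherianRing R] {I : Ideal R} {M : ModuleCat.{0} R} {h : ℕ}
    (hv : ∀ l < h, ∀ t, ∀ x : Ext (ModuleCat.of R (R ⧸ I ^ t)) M l, ∃ s, ∃ hs : t ≤ s,
      (Ext.mk₀ (ModuleCat.ofHom (q I hs))).comp x (zero_add l) = 0) (l : ℕ) (hl : l < h) :
    Van I M l := by
  induction l with
  | zero =>
    have hj : ∀ j, j + 1 = 0 → Van I M j := by omega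
    rintro N ⟨_, t, ht⟩ x
    refine detect hj N t ht x fun f => ?_
    obtain ⟨s, hs, hx⟩ := hv _ hl t ((Ext.mk₀ (ModuleCat.ofHom f)).comp x (zero_add _))
    exact precomp_inj hj (ft_quot I s) _ (q_surj I hs) _ hx
  | succ l ih =>
    have hj : ∀ j, j + 1 = l + 1 → Van I M j := by
      intro j hj
      obtain rfl : j = l := by omega
      exact ih (by omega)
    rintro N ⟨_, t, ht⟩ x
    refine detect hj N t ht x fun f => ?_
    obtain ⟨s, hs, hx⟩ := hv _ hl t ((Ext.mk₀ (ModuleCat.ofHom f)).comp x (zero_add _))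
    exact precomp_inj hj (ft_quot I s) _ (q_surj I hs) _ hx

lemma smul_comp_id {M N : ModuleCat.{0} R} {l : ℕ} (a : R) (x : Ext N M l) :
    (Ext.mk₀ (a • 𝟙 N)).comp x (zero_add l) = a • x := by
  rw [Ext.mk₀_smul, Ext.smul_comp, Ext.mk₀_id_comp]

lemma smul_zero_of_mem {I : Ideal R} {M : ModuleCat.{0} R} {l n : ℕ} (a : R) (ha : a ∈ I ^ n)
    (x : Ext (ModuleCat.of R (R ⧸ I ^ n)) M l) : a • x = 0 := by
  rw [← smul_comp_id]
  have : a • 𝟙 (ModuleCat.of R (R ⧸ I ^ n)) = 0 := by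
    apply ModuleCat.hom_ext
    refine LinearMap.ext fun y => ?_
    obtain ⟨t, ht⟩ := ft_quot I n
    change R ⧸ I ^ n at y
    obtain ⟨b, rfl⟩ := Submodule.Quotient.mk_surjective _ y
    change a • (Submodule.Quotient.mk b : R ⧸ I ^ n) = 0
    rw [← Submodule.Quotient.mk_smul, Submodule.Quotient.mk_eq_zero]
    exact Ideal.mul_mem_right _ _ ha
  rw [this, Ext.mk₀_zero, Ext.zero_comp]

lemma lift_of_torsion [IsNoetherianRing R] {I : Ideal R} {M : ModuleCat.{0} R} {l n m : ℕ}
    (hl : ∀ j, j + 1 = l → Van I M j) (hnm : n ≤ m)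
    (x : Ext (ModuleCat.of R (R ⧸ I ^ m)) M l) (hx : ∀ a ∈ I ^ n, a • x = 0) :
    ∃ y : Ext (ModuleCat.of R (R ⧸ I ^ n)) M l,
      (Ext.mk₀ (ModuleCat.ofHom (q I hnm))).comp y (zero_add l) = x := by
  refine Ext.contravariant_sequence_exact₂
    (LinearMap.shortExact_shortComplexKer (q_surj I hnm)) M x ?_
  have : Module.Finite R (q I hnm).shortComplexKer.X₁ :=
    inferInstanceAs (Module.Finite R (LinearMap.ker (q I hnm)))
  refine detect hl _ m ?_ _ fun f => ?_
  · intro a ha x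
    refine Subtype.ext ?_
    obtain ⟨b, hb⟩ := Submodule.Quotient.mk_surjective _ x.1
    change a • x.1 = 0
    rw [← hb, ← Submodule.Quotient.mk_smul, Submodule.Quotient.mk_eq_zero]
    exact Ideal.mul_mem_right _ _ ha
  · rw [← Ext.comp_assoc_of_second_deg_zero, Ext.mk₀_comp_mk₀]
    change (R ⧸ I ^ m) →ₗ[R] LinearMap.ker (q I hnm) at f
    obtain ⟨a, ha⟩ := Submodule.Quotient.mk_surjective _ (f (Submodule.Quotient.mk 1)).1
    have ha' : a ∈ I ^ n := by
      have := (f (Submodule.Quotient.mk 1)).2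
      rw [LinearMap.mem_ker, ← ha] at this
      exact (Submodule.Quotient.mk_eq_zero _).1 this
    have key : ModuleCat.ofHom f ≫ (q I hnm).shortComplexKer.f =
        a • 𝟙 (ModuleCat.of R (R ⧸ I ^ m)) := by
      apply ModuleCat.hom_ext
      refine LinearMap.ext fun y => ?_
      change R ⧸ I ^ m at y
      obtain ⟨b, rfl⟩ := Submodule.Quotient.mk_surjective _ y
      have h1 : (Submodule.Quotient.mk b : R ⧸ I ^ m) = b • Submodule.Quotient.mk 1 := by
        rw [← Submodule.Quotient.mk_smul]; simp
      change (f (Submodule.Quotient.mk b)).1 = a • (Submodule.Quotient.mk b : R ⧸ I ^ m)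
      rw [h1, map_smul]
      change b • (f (Submodule.Quotient.mk 1)).1 = _
      rw [← ha, smul_comm a b, ← Submodule.Quotient.mk_smul _ (1 : R) (r := a)]
      simp
    refine (congrArg (fun z => (Ext.mk₀ z).comp x (zero_add l)) key).trans ?_
    exact (smul_comp_id a x).trans (hx a ha')

end Stmt9

namespace Stmt9
open Abelian

section compare
variable {R : Type} [CommRing R] {X Y : ModuleCat.{0} R}

/-- The cocycle attached to an element of `cycles`. -/
noncomputable def cocyc (P : ProjectiveResolution X) (n : ℕ)
    (z : (P.complex.linearYonedaObj R Y).cycles n) : P.complex.X n ⟶ Y :=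
  ((P.complex.linearYonedaObj R Y).iCycles n).hom z

lemma d_cocyc (P : ProjectiveResolution X) (n : ℕ)
    (z : (P.complex.linearYonedaObj R Y).cycles n) : P.complex.d (n + 1) n ≫ cocyc P n z = 0 := by
  have := (P.complex.linearYonedaObj R Y).iCycles_d n (n + 1)
  exact congrArg (fun k => k.hom z) this

lemma exists_cocyc (P : ProjectiveResolution X) (n : ℕ) (f : P.complex.X n ⟶ Y)
    (hf : P.complex.d (n + 1) n ≫ f = 0) :
    ∃ z : (P.complex.linearYonedaObj R Y).cycles n, cocyc P n z = f := by
  let K := P.complex.linearYonedaObj R Y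
  let g : ModuleCat.of R R ⟶ K.X n := ModuleCat.ofHom (LinearMap.toSpanSingleton R (K.X n) f)
  have hg : g ≫ K.d n (n + 1) = 0 := by
    apply ModuleCat.hom_ext
    apply LinearMap.ext_ring
    change (K.d n (n + 1)).hom ((1 : R) • f) = 0
    rw [one_smul]
    exact hf
  refine ⟨(K.liftCycles g (n + 1) (by simp) hg).hom (1 : R), ?_⟩
  have := congrArg (fun k => k.hom (1 : R)) (K.liftCycles_i g (n + 1) (by simp) hg)
  refine Eq.trans this ?_
  exact one_smul R f

lemma cocyc_inj (P : ProjectiveResolution X) (n : ℕ) :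
    Function.Injective (cocyc (Y := Y) P n) :=
  (ModuleCat.mono_iff_injective ((P.complex.linearYonedaObj R Y).iCycles n)).1 inferInstance

/-- The class in `Abelian.Ext` of a cycle. -/
noncomputable def newMk (P : ProjectiveResolution X) (n : ℕ) :
    (P.complex.linearYonedaObj R Y).cycles n →ₗ[R] Ext X Y n where
  toFun z := P.extMk (cocyc P n z) (n + 1) rfl (d_cocyc P n z)
  map_add' z w := by
    rw [P.add_extMk]
    congr 1
    exact map_add ((P.complex.linearYonedaObj R Y).iCycles n).hom z w
  map_smul' r z := by
    rw [RingHom.id_apply, Ext.smul_eq_comp_mk₀, P.extMk_comp_mk₀]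
    congr 1
    refine (map_smul ((P.complex.linearYonedaObj R Y).iCycles n).hom r z).trans ?_
    change r • cocyc P n z = _
    rw [Linear.comp_smul, Category.comp_id]

lemma newMk_surj (P : ProjectiveResolution X) (n : ℕ) :
    Function.Surjective (newMk (Y := Y) P n) := by
  intro x
  obtain ⟨f, hf, rfl⟩ := P.extMk_surjective x (n + 1) rfl
  obtain ⟨z, rfl⟩ := exists_cocyc P n f hf
  exact ⟨z, rfl⟩

lemma extMk_zero_inj (P : ProjectiveResolution X) (f : P.complex.X 0 ⟶ Y)
    (hf : P.complex.d 1 0 ≫ f = 0) (h : P.extMk f 1 rfl hf = 0) : f = 0 := by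
  rw [← P.extEquivCohomologyClass.apply_eq_iff_eq, P.extEquivCohomologyClass_extMk,
    P.extEquivCohomologyClass_zero, CochainComplex.HomComplex.CohomologyClass.mk_eq_zero_iff,
    CochainComplex.HomComplex.Cocycle.toSingleMk_mem_coboundaries_iff _ _ _ _ _ 1 (by simp)] at h
  obtain ⟨g, hg⟩ := h
  have : P.cochainComplex.d (-((0 : ℕ) : ℤ)) 1 = 0 := by
    apply Limits.IsZero.eq_of_tgt
    exact P.cochainComplex.isZero_of_isStrictlyLE 0 1 (by simp)
  rw [this, Limits.zero_comp] at hg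
  rw [← cancel_epi (P.cochainComplexXIso (-((0 : ℕ) : ℤ)) 0 rfl).hom, ← hg, Limits.comp_zero]

lemma homologyπ_eq_zero_iff (K : CochainComplex (ModuleCat.{0} R) ℕ) (i j : ℕ)
    (hi : (ComplexShape.up ℕ).prev j = i) (z : K.cycles j) :
    (K.homologyπ j).hom z = 0 ↔ ∃ y : K.X i, (K.d i j).hom y = (K.iCycles j).hom z := by
  have ex := ShortComplex.exact_of_g_is_cokernel
    (ShortComplex.mk (K.toCycles i j) (K.homologyπ j) (by simp)) (K.homologyIsCokernel i j hi)
  rw [ShortComplex.moduleCat_exact_iff] at ex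
  have hd (y : K.X i) : (K.iCycles j).hom ((K.toCycles i j).hom y) = (K.d i j).hom y :=
    congrArg (fun k => k.hom y) (K.toCycles_i i j)
  constructor
  · intro h
    obtain ⟨y, rfl⟩ := ex z h
    exact ⟨y, (hd y).symm⟩
  · rintro ⟨y, hy⟩
    rw [← hd] at hy
    rw [← (ModuleCat.mono_iff_injective (K.iCycles j)).1 inferInstance hy]
    exact congrArg (fun k => k.hom y) (K.toCycles_comp_homologyπ i j)

lemma ker_newMk (P : ProjectiveResolution X) (n : ℕ) :
    LinearMap.ker ((P.complex.linearYonedaObj R Y).homologyπ n).hom =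
      LinearMap.ker (newMk (Y := Y) P n) := by
  ext z
  rw [LinearMap.mem_ker, LinearMap.mem_ker]
  cases n with
  | zero =>
    rw [homologyπ_eq_zero_iff _ 0 0 (by simp)]
    constructor
    · rintro ⟨y, hy⟩
      have h0 : cocyc P 0 z = 0 := by
        refine hy.symm.trans ?_
        rw [HomologicalComplex.shape _ _ _ (by simp)]
        rfl
      change P.extMk (cocyc P 0 z) (0 + 1) rfl (d_cocyc P 0 z) = 0
      simp only [h0]
      exact P.extMk_zero _ _
    · intro h
      refine ⟨0, ?_⟩
      rw [map_zero]
      exact (extMk_zero_inj P _ (d_cocyc P 0 z) h).symm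
  | succ p =>
    rw [homologyπ_eq_zero_iff _ p (p + 1) (by simp)]
    exact (P.extMk_eq_zero_iff _ _ rfl (d_cocyc P (p + 1) z) p rfl).symm

/-- Two quotient maps with the same kernel. -/
noncomputable def eqv {Z A B : Type} [AddCommGroup Z] [AddCommGroup A] [AddCommGroup B] [Module R Z]
    [Module R A] [Module R B] (p : Z →ₗ[R] A) (p' : Z →ₗ[R] B) (hp : Function.Surjective p)
    (hp' : Function.Surjective p') (h : LinearMap.ker p = LinearMap.ker p') : A ≃ₗ[R] B :=
  (p.quotKerEquivOfSurjective hp).symm ≪≫ₗ Submodule.quotEquivOfEq _ _ h ≪≫ₗ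
    p'.quotKerEquivOfSurjective hp'

lemma eqv_apply {Z A B : Type} [AddCommGroup Z] [AddCommGroup A] [AddCommGroup B] [Module R Z]
    [Module R A] [Module R B] (p : Z →ₗ[R] A) (p' : Z →ₗ[R] B) (hp : Function.Surjective p)
    (hp' : Function.Surjective p') (h : LinearMap.ker p = LinearMap.ker p') (z : Z) :
    eqv p p' hp hp' h (p z) = p' z := by
  have : (p.quotKerEquivOfSurjective hp).symm (p z) = Submodule.Quotient.mk z := by
    rw [LinearEquiv.symm_apply_eq]; rfl
  simp only [eqv, LinearEquiv.trans_apply, this]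
  rfl

lemma homologyπ_surj (K : CochainComplex (ModuleCat.{0} R) ℕ) (n : ℕ) :
    Function.Surjective (K.homologyπ n).hom :=
  (ModuleCat.epi_iff_surjective _).1 inferInstance

/-- The homology of the Hom complex is `Abelian.Ext`. -/
noncomputable def homEqv (P : ProjectiveResolution X) (n : ℕ) :
    (P.complex.linearYonedaObj R Y).homology n ≃ₗ[R] Ext X Y n :=
  eqv ((P.complex.linearYonedaObj R Y).homologyπ n).hom (newMk P n) (homologyπ_surj _ n)
    (newMk_surj P n) (ker_newMk P n)

/-- Comparison of the two `Ext`s -/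
noncomputable def cmp (Y : ModuleCat.{0} R) (n : ℕ) (X : ModuleCat.{0} R) :
    ((_root_.Ext R (ModuleCat R) n).obj (Opposite.op X)).obj Y ≃ₗ[R] Ext X Y n :=
  ((projectiveResolution X).isoExt n Y).toLinearEquiv ≪≫ₗ homEqv (projectiveResolution X) n

/-- The map on Hom complexes. -/
noncomputable def starMap {P Q : ChainComplex (ModuleCat.{0} R) ℕ} (φ : P ⟶ Q)
    (Y : ModuleCat.{0} R) : Q.linearYonedaObj R Y ⟶ P.linearYonedaObj R Y :=
  ((HomologicalComplex.unopFunctor _ _).map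
    ((((linearYoneda R (ModuleCat.{0} R)).obj Y).rightOp.mapHomologicalComplex _).map φ).op)

lemma glue {C : Type*} [Category C] {E E' U U' H H' : C} (e : E' ⟶ E) (a : E ⟶ U) (b : E' ⟶ U')
    (c : U' ⟶ U) (d : U' ⟶ H') (m : H' ⟶ H) (g : U ⟶ H) (h1 : e ≫ a = b ≫ c)
    (h2 : d ≫ m = c ≫ g) : e ≫ (a ≫ g) = (b ≫ d) ≫ m := by
  rw [← Category.assoc, h1, Category.assoc, Category.assoc, h2]

lemma glue_inv {C : Type*} [Category C] {A B A' B' : C} (m : A ⟶ B) (i : B ≅ B') (j : A ≅ A')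
    (k : A' ⟶ B') (h : m ≫ i.hom = j.hom ≫ k) : k ≫ i.inv = j.inv ≫ m := by
  rw [Iso.eq_inv_comp, ← Category.assoc, Iso.comp_inv_eq, h]

lemma isoExt_nat {X' : ModuleCat.{0} R} (f : X ⟶ X') (P : ProjectiveResolution X)
    (Q : ProjectiveResolution X') (φ : ProjectiveResolution.Hom P Q f) (n : ℕ) :
    ((_root_.Ext R (ModuleCat R) n).map f.op).app Y ≫ (P.isoExt n Y).hom =
      (Q.isoExt n Y).hom ≫ HomologicalComplex.homologyMap (starMap φ.hom Y) n := by
  have h1 := ProjectiveResolution.isoLeftDerivedObj_inv_naturality f P Q φ.hom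
    φ.hom_f_zero_comp_π_f_zero ((linearYoneda R (ModuleCat.{0} R)).obj Y).rightOp n
  have h2 : (HomologicalComplex.homologyMap (starMap φ.hom Y) n).op ≫
      ((Q.complex.linearYonedaObj R Y).homologyOp n).inv =
      ((P.complex.linearYonedaObj R Y).homologyOp n).inv ≫
        HomologicalComplex.homologyMap ((HomologicalComplex.opFunctor _ _).map
          (starMap φ.hom Y).op) n := by
    exact glue_inv _ _ _ _ (HomologicalComplex.homologyOp_hom_naturality (starMap φ.hom Y) n)
  exact glue _ _ _ _ _ _ _ (congrArg Quiver.Hom.unop h1) (congrArg Quiver.Hom.unop h2)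

lemma cmp_nat (Y : ModuleCat.{0} R) (n : ℕ) {X X' : ModuleCat.{0} R} (f : X ⟶ X')
    (x : ((_root_.Ext R (ModuleCat R) n).obj (Opposite.op X')).obj Y) :
    cmp Y n X ((((_root_.Ext R (ModuleCat R) n).map f.op).app Y).hom x) =
      (Ext.mk₀ f).comp (cmp Y n X' x) (zero_add n) := by
  let P := projectiveResolution X
  let Q := projectiveResolution X'
  let φ : ProjectiveResolution.Hom P Q f := ⟨ProjectiveResolution.lift f P Q, by
    rw [← HomologicalComplex.comp_f, ProjectiveResolution.lift_commutes,
      HomologicalComplex.comp_f]⟩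
  have h1 := congrArg (fun k => k.hom x) (isoExt_nat (Y := Y) f P Q φ n)
  obtain ⟨z, hz⟩ := homologyπ_surj _ _ ((Q.isoExt n Y).hom.hom x)
  have h2 : (P.isoExt n Y).hom.hom ((((_root_.Ext R (ModuleCat R) n).map f.op).app Y).hom x) =
    ((P.complex.linearYonedaObj R Y).homologyπ n).hom
      ((HomologicalComplex.cyclesMap (starMap φ.hom Y) n).hom z) := by
    refine h1.trans ?_
    refine (congrArg (HomologicalComplex.homologyMap (starMap φ.hom Y) n).hom hz.symm).trans ?_
    exact congrArg (fun k => k.hom z) (HomologicalComplex.homologyπ_naturality (starMap φ.hom Y) n)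
  have h3 : cmp Y n X' x = newMk Q n z := by
    change homEqv Q n ((Q.isoExt n Y).hom.hom x) = _
    rw [← hz]
    exact eqv_apply ..
  rw [h3]
  change homEqv P n ((P.isoExt n Y).hom.hom _) = _
  rw [h2]
  refine (eqv_apply ..).trans ?_
  refine Eq.trans ?_ (ProjectiveResolution.mk₀_comp_extMk _ _ rfl (d_cocyc Q n z) φ).symm
  have key : cocyc P n ((HomologicalComplex.cyclesMap (starMap φ.hom Y) n).hom z) =
      φ.hom.f n ≫ cocyc Q n z :=
    congrArg (fun k => k.hom z) (HomologicalComplex.cyclesMap_i (starMap φ.hom Y) n)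
  change P.extMk (cocyc P n ((HomologicalComplex.cyclesMap (starMap φ.hom Y) n).hom z))
    (n + 1) rfl (d_cocyc P n _) = _
  simp only [key]

end compare
end Stmt9

namespace Stmt9
open Abelian

section colim
variable {R : Type} [CommRing R] (I : Ideal R) (M : ModuleCat.{0} R) (l : ℕ)

/-- The diagram of Ext modules. -/
noncomputable def dia : (ℕᵒᵖ)ᵒᵖ ⥤ ModuleCat.{0} R :=
  localCohomology.diagram (localCohomology.idealPowersDiagram I) l ⋙ (evaluation _ _).obj M

/-- The cocone. -/
noncomputable def coc : Limits.Cocone (dia I M l) :=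
  ((evaluation _ _).obj M).mapCocone
    (Limits.colimit.cocone (localCohomology.diagram (localCohomology.idealPowersDiagram I) l))

/-- It is colimiting. -/
noncomputable def cocIs : Limits.IsColimit (coc I M l) :=
  Limits.isColimitOfPreserves ((evaluation _ _).obj M) (Limits.colimit.isColimit _)

/-- The map from Ext to local cohomology. -/
noncomputable def inc (t : ℕ) :
    ((_root_.Ext R (ModuleCat R) l).obj (Opposite.op (ModuleCat.of R (R ⧸ I ^ t)))).obj M →ₗ[R]
      (localCohomology I l).obj M :=
  ((coc I M l).ι.app (Opposite.op (Opposite.op t))).hom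

/-- The transition maps. -/
noncomputable def tr {t s : ℕ} (h : t ≤ s) :
    ((_root_.Ext R (ModuleCat R) l).obj (Opposite.op (ModuleCat.of R (R ⧸ I ^ t)))).obj M →ₗ[R]
    ((_root_.Ext R (ModuleCat R) l).obj (Opposite.op (ModuleCat.of R (R ⧸ I ^ s)))).obj M :=
  (((_root_.Ext R (ModuleCat R) l).map (ModuleCat.ofHom (q I h)).op).app M).hom

lemma inc_tr {t s : ℕ} (h : t ≤ s) (x) : inc I M l s (tr I M l h x) = inc I M l t x :=
  congrArg (fun k => k.hom x) ((coc I M l).w (homOfLE h).op.op)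

lemma inc_rep (y : (localCohomology I l).obj M) : ∃ t x, inc I M l t x = y := by
  obtain ⟨j, x, hx⟩ := Limits.Concrete.isColimit_exists_rep _ (cocIs I M l) y
  exact ⟨j.unop.unop, x, hx⟩

lemma inc_zero (t : ℕ) (x) (hx : inc I M l t x = 0) :
    ∃ s, ∃ h : t ≤ s, tr I M l h x = 0 := by
  have hx' : (coc I M l).ι.app (Opposite.op (Opposite.op t)) x =
      (coc I M l).ι.app (Opposite.op (Opposite.op t))
        (0 : (dia I M l).obj (Opposite.op (Opposite.op t))) := by
    rw [map_zero]
    exact hx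
  obtain ⟨k, f, g, hk⟩ := Limits.Concrete.isColimit_exists_of_rep_eq _ (cocIs I M l) _ _ hx'
  refine ⟨k.unop.unop, leOfHom f.unop.unop, ?_⟩
  rw [map_zero] at hk
  exact hk

lemma cmp_tr {t s : ℕ} (h : t ≤ s) (x) :
    cmp M l _ (tr I M l h x) =
      (Ext.mk₀ (ModuleCat.ofHom (q I h))).comp (cmp M l _ x) (zero_add l) :=
  cmp_nat M l (ModuleCat.ofHom (q I h)) x

end colim
end Stmt9



/-- Let `(R, m)` be a noetherian local ring and `I` an ideal of `R` such
that `H^l_I(R) = 0` for every `l ≠ h`.  Then for every `n ∈ ℕ` the submodule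
`(0 :_{H^h_I(R)} Iⁿ)` of elements of `H^h_I(R)` annihilated by `Iⁿ` is isomorphic to
`Ext^h_R(R/Iⁿ, R)`; in particular it is a finitely generated `R`-module. -/
theorem stmt9 {R : Type} [CommRing R] [IsNoetherianRing R] [IsLocalRing R]
    (I : Ideal R) (h : ℕ)
    (hvan : ∀ l : ℕ, l ≠ h → Subsingleton ((localCohomology I l).obj (ModuleCat.of R R)))
    (n : ℕ) :
    Nonempty
        ((Submodule.torsionBySet R ((localCohomology I h).obj (ModuleCat.of R R))
            ((I ^ n : Ideal R) : Set R)) ≃ₗ[R]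
          ((Ext R (ModuleCat R) h).obj
              (Opposite.op (ModuleCat.of R (R ⧸ I ^ n)))).obj (ModuleCat.of R R)) ∧
      Module.Finite R
        (Submodule.torsionBySet R ((localCohomology I h).obj (ModuleCat.of R R))
          ((I ^ n : Ideal R) : Set R)) := by
  have hv : ∀ l < h, Stmt9.Van I (ModuleCat.of R R) l := by
    apply Stmt9.van
    intro l hl t x
    obtain ⟨x, rfl⟩ := (Stmt9.cmp (ModuleCat.of R R) l _).surjective x
    have := hvan l (by omega)
    obtain ⟨s, hs, h0⟩ := Stmt9.inc_zero I (ModuleCat.of R R) l t x (Subsingleton.elim _ _)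
    refine ⟨s, hs, ?_⟩
    rw [← Stmt9.cmp_tr, h0, map_zero]
  have hj : ∀ j, j + 1 = h → Stmt9.Van I (ModuleCat.of R R) j := fun j hj => hv j (by omega)
  have hinj : ∀ t x, Stmt9.inc I (ModuleCat.of R R) h t x = 0 → x = 0 := by
    intro t x hx
    obtain ⟨s, hs, h0⟩ := Stmt9.inc_zero I (ModuleCat.of R R) h t x hx
    apply (Stmt9.cmp (ModuleCat.of R R) h _).injective
    rw [map_zero]
    refine Stmt9.precomp_inj hj (Stmt9.ft_quot I s) _ (Stmt9.q_surj I hs) _ ?_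
    rw [← Stmt9.cmp_tr, h0, map_zero]
  have hrange : LinearMap.range (Stmt9.inc I (ModuleCat.of R R) h n) =
      Submodule.torsionBySet R ((localCohomology I h).obj (ModuleCat.of R R))
        ((I ^ n : Ideal R) : Set R) := by
    ext y
    rw [Submodule.mem_torsionBySet_iff]
    constructor
    · rintro ⟨x, rfl⟩ ⟨a, ha⟩
      change a • _ = _
      rw [← map_smul]
      have : a • x = 0 := by
        apply (Stmt9.cmp (ModuleCat.of R R) h _).injective
        rw [map_smul, map_zero]
        exact Stmt9.smul_zero_of_mem a ha _
      rw [this, map_zero]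
    · intro hy
      obtain ⟨t, x, rfl⟩ := Stmt9.inc_rep I (ModuleCat.of R R) h y
      rw [← Stmt9.inc_tr I (ModuleCat.of R R) h (le_max_right n t)] at hy ⊢
      generalize Stmt9.tr I (ModuleCat.of R R) h (le_max_right n t) x = z at hy ⊢
      obtain ⟨w, hw⟩ := Stmt9.lift_of_torsion hj (le_max_left n t)
        (Stmt9.cmp (ModuleCat.of R R) h _ z) (fun a ha => by
          rw [← map_smul, hinj _ (a • z) (by rw [map_smul]; exact hy ⟨a, ha⟩), map_zero])
      obtain ⟨w, rfl⟩ := (Stmt9.cmp (ModuleCat.of R R) h _).surjective w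
      rw [← Stmt9.cmp_tr] at hw
      have hw' := (Stmt9.cmp (ModuleCat.of R R) h _).injective hw
      refine ⟨w, ?_⟩
      rw [← hw', Stmt9.inc_tr]
  let e := (LinearEquiv.ofInjective (Stmt9.inc I (ModuleCat.of R R) h n)
    ((injective_iff_map_eq_zero _).2 (hinj n))) ≪≫ₗ LinearEquiv.ofEq _ _ hrange
  refine ⟨⟨e.symm⟩, ?_⟩
  have : Module.Finite R (Abelian.Ext (ModuleCat.of R (R ⧸ I ^ n)) (ModuleCat.of R R) h) := by
    have : Module.Finite R (ModuleCat.of R (R ⧸ I ^ n)) := (Stmt9.ft_quot I n).fin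
    have : Module.Finite R (ModuleCat.of R R) := Module.Finite.self R
    infer_instance
  exact Module.Finite.equiv ((Stmt9.cmp (ModuleCat.of R R) h _).symm ≪≫ₗ e)
end

section
/- Let (R,m) be a Noetherian local ring and I an ideal of R such that H^l_I(R) = 0 for every l > h. Set H := H^h_I(R). Then there is an isomorphism of R-modules H ⊗_R D(H) ≅ H^h_I(D(H)). -/
open CategoryTheory

section LCHelpers
open Limits Opposite
variable {R : Type} [CommRing R]

namespace LC

theorem fg_proj_lift [IsNoetherianRing R] {P : FGModuleCat.{0} R} (h : Module.Projective R P.obj) :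
    Projective P where
  factors {E X} f e he := by
    have hs : Function.Surjective e.hom.hom := by
      have : Epi ((forget₂ (FGModuleCat R) (ModuleCat.{0} R)).map e) := inferInstance
      exact (ModuleCat.epi_iff_surjective _).1 this
    obtain ⟨g, hg⟩ := Module.projective_lifting_property e.hom.hom f.hom.hom hs
    refine ⟨ObjectProperty.homMk (ModuleCat.ofHom g), ?_⟩
    ext x
    exact LinearMap.congr_fun hg x

theorem fg_cover [IsNoetherianRing R] (M : FGModuleCat.{0} R) :
    ∃ (P : FGModuleCat.{0} R) (f : P ⟶ M), Module.Projective R P.obj ∧ Epi f := by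
  obtain ⟨n, g, hg⟩ := Module.Finite.exists_fin' R M
  refine ⟨FGModuleCat.of R (Fin n → R), ObjectProperty.homMk (ModuleCat.ofHom g), ?_, ?_⟩
  · exact inferInstanceAs (Module.Projective R (Fin n → R))
  · have : Epi ((forget₂ (FGModuleCat R) (ModuleCat.{0} R)).map
        (ObjectProperty.homMk (ModuleCat.ofHom g) : FGModuleCat.of R (Fin n → R) ⟶ M)) :=
      (ModuleCat.epi_iff_surjective _).2 hg
    exact (forget₂ (FGModuleCat R) (ModuleCat.{0} R)).epi_of_epi_map this

theorem fg_enough [IsNoetherianRing R] : EnoughProjectives (FGModuleCat.{0} R) where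
  presentation M := by
    obtain ⟨P, f, hP, hf⟩ := fg_cover M
    have := fg_proj_lift hP
    exact ⟨{ p := P, f := f, projective := this, epi := hf }⟩

theorem fg_pres [IsNoetherianRing R] :
    (forget₂ (FGModuleCat R) (ModuleCat.{0} R)).PreservesProjectiveObjects where
  projective_obj {M} hM := by
    obtain ⟨P, f, hP, hf⟩ := fg_cover M
    have hP' : Projective ((forget₂ (FGModuleCat R) (ModuleCat.{0} R)).obj P) :=
      (IsProjective.iff_projective (R := R) (P := P.obj)).1 hP
    have r : Retract M P := ⟨Projective.factorThru (𝟙 M) f, f, by simp⟩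
    exact (r.map (forget₂ (FGModuleCat R) (ModuleCat.{0} R))).projective

theorem exists_fg_res [IsNoetherianRing R] (M : Type) [AddCommGroup M] [Module R M]
    [Module.Finite R M] :
    ∃ P : ProjectiveResolution (ModuleCat.of R M), ∀ i, Module.Finite R (P.complex.X i) := by
  have := fg_enough (R := R)
  have := fg_pres (R := R)
  let Q := ProjectiveResolution.of (FGModuleCat.of R M)
  let F := forget₂ (FGModuleCat R) (ModuleCat.{0} R)
  have : F.Additive := inferInstance
  have : F.PreservesHomology := inferInstance
  refine ⟨F.mapProjectiveResolution Q, fun i => ?_⟩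
  exact inferInstanceAs (Module.Finite R (Q.complex.X i).obj)
end LC

noncomputable section
namespace LC
abbrev Gf (M : ModuleCat.{0} R) : ModuleCat.{0} R ⥤ (ModuleCat.{0} R)ᵒᵖ := ((linearYoneda R (ModuleCat.{0} R)).obj M).rightOp
abbrev KK (P : ChainComplex (ModuleCat.{0} R) ℕ) (M : ModuleCat.{0} R) : ChainComplex (ModuleCat.{0} R)ᵒᵖ ℕ :=
  ((Gf M).mapHomologicalComplex _).obj P

/-- cocycles -/
def Zc (P : ChainComplex (ModuleCat.{0} R) ℕ) (i : ℕ) (M : ModuleCat.{0} R) : Submodule R (P.X i ⟶ M) where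
  carrier := {z | P.d (i+1) i ≫ z = 0}
  add_mem' := by intro a b ha hb; simp_all
  zero_mem' := by simp
  smul_mem' := by intro a b hb; simp_all

/-- inclusion of opposite opcycles -/
def opI (P : ChainComplex (ModuleCat.{0} R) ℕ) (i : ℕ) (M : ModuleCat.{0} R) :
    ((KK P M).opcycles i).unop →ₗ[R] (P.X i ⟶ M) :=
  ((KK P M).pOpcycles i).unop.hom

theorem opI_inj (P : ChainComplex (ModuleCat.{0} R) ℕ) (i : ℕ) (M : ModuleCat.{0} R) :
    Function.Injective (opI P i M) :=
  (ModuleCat.mono_iff_injective ((KK P M).pOpcycles i).unop).1 inferInstance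

theorem opI_range (P : ChainComplex (ModuleCat.{0} R) ℕ) (i : ℕ) (M : ModuleCat.{0} R) :
    LinearMap.range (opI P i M) = Zc P i M := by
  have h1 := ShortComplex.exact_of_g_is_cokernel (ShortComplex.mk _ _ ((KK P M).d_pOpcycles (i+1) i))
    ((KK P M).opcyclesIsCokernel (i+1) i (by simp))
  have h2 := (ShortComplex.moduleCat_exact_iff _).1 h1.unop
  ext z
  constructor
  · rintro ⟨w, rfl⟩
    have := ((KK P M).d_pOpcycles (i+1) i)
    exact LinearMap.congr_fun (congrArg (fun f => f.unop.hom) this) w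
  · intro hz
    exact h2 z hz

def eqZ (P : ChainComplex (ModuleCat.{0} R) ℕ) (i : ℕ) (M : ModuleCat.{0} R) :
    ((KK P M).opcycles i).unop ≃ₗ[R] Zc P i M :=
  (LinearEquiv.ofInjective (opI P i M) (opI_inj P i M)).trans (LinearEquiv.ofEq _ _ (opI_range P i M))

theorem eqZ_coe (P : ChainComplex (ModuleCat.{0} R) ℕ) (i : ℕ) (M : ModuleCat.{0} R) (w) :
    (eqZ P i M w : P.X i ⟶ M) = opI P i M w := rfl

theorem opI_eqZ_symm (P : ChainComplex (ModuleCat.{0} R) ℕ) (i : ℕ) (M : ModuleCat.{0} R) (z) :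
    opI P i M ((eqZ P i M).symm z) = z := by
  rw [← eqZ_coe]; simp

/-- to homology -/
def toH (P : ChainComplex (ModuleCat.{0} R) ℕ) (i : ℕ) (M : ModuleCat.{0} R) :
    Zc P i M →ₗ[R] ((KK P M).homology i).unop :=
  ((KK P M).homologyι i).unop.hom ∘ₗ (eqZ P i M).symm.toLinearMap

theorem toH_surj (P : ChainComplex (ModuleCat.{0} R) ℕ) (i : ℕ) (M : ModuleCat.{0} R) :
    Function.Surjective (toH P i M) := by
  have : Function.Surjective ((KK P M).homologyι i).unop.hom :=
    (ModuleCat.epi_iff_surjective _).1 inferInstance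
  exact this.comp (eqZ P i M).symm.surjective

def IsBd (P : ChainComplex (ModuleCat.{0} R) ℕ) (i : ℕ) (M : ModuleCat.{0} R) (z : P.X i ⟶ M) : Prop :=
  ∃ w : P.X (i-1) ⟶ M, P.d i (i-1) ≫ w = z

theorem toH_zero_iff (P : ChainComplex (ModuleCat.{0} R) ℕ) (i : ℕ) (M : ModuleCat.{0} R) (z) :
    toH P i M z = 0 ↔ IsBd P i M z.1 := by
  have h1 := ShortComplex.exact_of_f_is_kernel
    (ShortComplex.mk _ _ ((KK P M).homologyι_comp_fromOpcycles i (i-1)))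
    ((KK P M).homologyIsKernel i (i-1) (by cases i <;> simp))
  have h2 := (ShortComplex.moduleCat_exact_iff _).1 h1.unop
  have h3 : ∀ w : P.X (i-1) ⟶ M,
      opI P i M (((KK P M).fromOpcycles i (i-1)).unop.hom w) = P.d i (i-1) ≫ w := fun w =>
    LinearMap.congr_fun (congrArg (fun f => f.unop.hom) ((KK P M).p_fromOpcycles i (i-1))) w
  constructor
  · intro hz
    obtain ⟨w, hw⟩ := h2 ((eqZ P i M).symm z) hz
    exact ⟨w, (h3 w).symm.trans ((congrArg (opI P i M) hw).trans (opI_eqZ_symm P i M z))⟩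
  · rintro ⟨w, hw⟩
    have : (eqZ P i M).symm z = ((KK P M).fromOpcycles i (i-1)).unop.hom w := by
      apply opI_inj
      rw [opI_eqZ_symm, h3, hw]
    change ((KK P M).homologyι i).unop.hom ((eqZ P i M).symm z) = 0
    rw [this]
    exact LinearMap.congr_fun (congrArg (fun f => f.unop.hom) ((KK P M).homologyι_comp_fromOpcycles i (i-1))) w

theorem toH_nat {P Q : ChainComplex (ModuleCat.{0} R) ℕ} (i : ℕ) {M N : ModuleCat.{0} R}
    (α : KK P N ⟶ KK Q M) (z : Zc Q i M) (z' : Zc P i N) (h : (α.f i).unop.hom z.1 = z'.1) :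
    (HomologicalComplex.homologyMap α i).unop.hom (toH Q i M z) = toH P i N z' := by
  have h1 := LinearMap.congr_fun (congrArg (fun f => f.unop.hom)
    (HomologicalComplex.homologyι_naturality α i)) ((eqZ Q i M).symm z)
  refine h1.trans ?_
  change ((KK P N).homologyι i).unop.hom ((HomologicalComplex.opcyclesMap α i).unop.hom ((eqZ Q i M).symm z)) = ((KK P N).homologyι i).unop.hom ((eqZ P i N).symm z')
  congr 1
  apply opI_inj
  rw [opI_eqZ_symm, ← h, ← opI_eqZ_symm]
  exact LinearMap.congr_fun (congrArg (fun f => f.unop.hom)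
    (HomologicalComplex.p_opcyclesMap α i)) ((eqZ Q i M).symm z)

def extCls {X : ModuleCat.{0} R} (P : ProjectiveResolution X) (i : ℕ) (M : ModuleCat.{0} R) :
    Zc P.complex i M →ₗ[R] (((Ext R (ModuleCat.{0} R) i).obj (op X)).obj M) :=
  (P.isoLeftDerivedObj (Gf M) i).hom.unop.hom ∘ₗ toH P.complex i M

theorem iso_bij {X : ModuleCat.{0} R} (P : ProjectiveResolution X) (i : ℕ) (M : ModuleCat.{0} R) :
   Function.Bijective (P.isoLeftDerivedObj (Gf M) i).hom.unop.hom :=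
  (P.isoLeftDerivedObj (Gf M) i).unop.toLinearEquiv.bijective

theorem extCls_surj {X : ModuleCat.{0} R} (P : ProjectiveResolution X) (i : ℕ) (M : ModuleCat.{0} R) :
    Function.Surjective (extCls P i M) :=
  (iso_bij P i M).2.comp (toH_surj _ _ _)

theorem extCls_zero_iff {X : ModuleCat.{0} R} (P : ProjectiveResolution X) (i : ℕ) (M : ModuleCat.{0} R) (z) :
    extCls P i M z = 0 ↔ IsBd P.complex i M z.1 := by
  rw [← toH_zero_iff]
  exact (map_eq_zero_iff (P.isoLeftDerivedObj (Gf M) i).hom.unop.hom (iso_bij P i M).1)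

theorem extCls_map {X : ModuleCat.{0} R} (P : ProjectiveResolution X) (i : ℕ) {M N : ModuleCat.{0} R}
    (f : M ⟶ N) (z : Zc P.complex i M) (z' : Zc P.complex i N) (h : z.1 ≫ f = z'.1) :
    (((Ext R (ModuleCat.{0} R) i).obj (op X)).map f).hom (extCls P i M z) = extCls P i N z' := by
  let α : Gf N ⟶ Gf M := NatTrans.rightOp ((linearYoneda R (ModuleCat.{0} R)).map f)
  have h1 := P.leftDerived_app_eq α i
  rw [← cancel_mono (P.isoLeftDerivedObj (Gf M) i).hom] at h1
  simp only [Category.assoc, Iso.inv_hom_id, Category.comp_id] at h1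
  have h2 := LinearMap.congr_fun (congrArg (fun f => f.unop.hom) h1) (toH P.complex i M z)
  refine h2.trans ?_
  refine congrArg (P.isoLeftDerivedObj (Gf N) i).hom.unop.hom ?_
  exact toH_nat i _ z z' h

theorem extCls_res {X Y : ModuleCat.{0} R} (P : ProjectiveResolution X) (Q : ProjectiveResolution Y)
    (g : X ⟶ Y) (φ : P.complex ⟶ Q.complex) (comm : φ.f 0 ≫ Q.π.f 0 = P.π.f 0 ≫ g)
    (i : ℕ) {M : ModuleCat.{0} R}
    (z : Zc Q.complex i M) (z' : Zc P.complex i M) (h : φ.f i ≫ z.1 = z'.1) :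
    (((Ext R (ModuleCat.{0} R) i).map g.op).app M).hom (extCls Q i M z) = extCls P i M z' := by
  have h1 := ProjectiveResolution.isoLeftDerivedObj_hom_naturality g P Q φ comm (Gf M) i
  have h2 := LinearMap.congr_fun (congrArg (fun f => f.unop.hom) h1) (toH Q.complex i M z)
  refine h2.trans ?_
  refine congrArg (P.isoLeftDerivedObj (Gf M) i).hom.unop.hom ?_
  exact toH_nat i _ z z' h
end LC
end

noncomputable section
namespace LC
open localCohomology

def tr (I : Ideal R) {s t : ℕ} (h : t ≤ s) : ModuleCat.of R (R ⧸ I ^ s) ⟶ ModuleCat.of R (R ⧸ I ^ t) :=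
  (ringModIdeals (idealPowersDiagram I)).map (homOfLE h).op

theorem tr_mk (I : Ideal R) {s t : ℕ} (h : t ≤ s) (x : R) :
    (tr I h).hom (Ideal.Quotient.mk _ x) = Ideal.Quotient.mk _ x := rfl

/-- A choice of resolutions of the modules `R / I ^ t`. -/
abbrev Sys (I : Ideal R) := ∀ t : ℕ, ProjectiveResolution (ModuleCat.of R (R ⧸ I ^ t))

def ph {I : Ideal R} (P : Sys I) {s t : ℕ} (h : t ≤ s) : (P s).complex ⟶ (P t).complex :=
  ProjectiveResolution.lift (tr I h) (P s) (P t)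

theorem ph_comm {I : Ideal R} (P : Sys I) {s t : ℕ} (h : t ≤ s) :
    (ph P h).f 0 ≫ (P t).π.f 0 = (P s).π.f 0 ≫ tr I h :=
  ProjectiveResolution.lift_commutes_zero _ _ _

def lcι (I : Ideal R) (i t : ℕ) (M : ModuleCat.{0} R) :
    ((Ext R (ModuleCat.{0} R) i).obj (op (ModuleCat.of R (R ⧸ I ^ t)))).obj M ⟶
      (localCohomology I i).obj M :=
  (colimit.ι (diagram (idealPowersDiagram I) i) (op (op t))).app M

def lcColim (I : Ideal R) (i : ℕ) (M : ModuleCat.{0} R) :=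
  isColimitOfPreserves ((evaluation (ModuleCat.{0} R) (ModuleCat.{0} R)).obj M)
    (colimit.isColimit (diagram (idealPowersDiagram I) i))

def lcCls {I : Ideal R} (P : Sys I) (i t : ℕ) (M : ModuleCat.{0} R) :
    Zc (P t).complex i M →ₗ[R] (localCohomology I i).obj M :=
  (lcι I i t M).hom ∘ₗ extCls (P t) i M

theorem lcCls_surj {I : Ideal R} (P : Sys I) (i : ℕ) {M : ModuleCat.{0} R}
    (x : (localCohomology I i).obj M) : ∃ t z, lcCls P i t M z = x := by
  obtain ⟨j, y, hy⟩ := Concrete.isColimit_exists_rep _ (lcColim I i M) x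
  obtain ⟨z, hz⟩ := extCls_surj (P j.unop.unop) i M y
  refine ⟨j.unop.unop, z, ?_⟩
  refine Eq.trans ?_ hy
  exact congrArg (lcι I i j.unop.unop M).hom hz

theorem lcCls_map {I : Ideal R} (P : Sys I) (i t : ℕ) {M N : ModuleCat.{0} R} (f : M ⟶ N)
    (z : Zc (P t).complex i M) (z' : Zc (P t).complex i N) (h : z.1 ≫ f = z'.1) :
    ((localCohomology I i).map f).hom (lcCls P i t M z) = lcCls P i t N z' := by
  have h1 := (colimit.ι (diagram (idealPowersDiagram I) i) (op (op t))).naturality f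
  have h2 := LinearMap.congr_fun (congrArg (fun f => f.hom) h1) (extCls (P t) i M z)
  refine h2.symm.trans ?_
  exact congrArg (lcι I i t N).hom (extCls_map (P t) i f z z' h)

theorem lcCls_res {I : Ideal R} (P : Sys I) (i : ℕ) {s t : ℕ} (hst : t ≤ s) {M : ModuleCat.{0} R}
    (z : Zc (P t).complex i M) (z' : Zc (P s).complex i M) (h : (ph P hst).f i ≫ z.1 = z'.1) :
    lcCls P i t M z = lcCls P i s M z' := by
  have h1 := congrArg (fun f => f.app M) (colimit.w (diagram (idealPowersDiagram I) i) (homOfLE hst).op.op)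
  have h2 := LinearMap.congr_fun (congrArg (fun f => f.hom) h1) (extCls (P t) i M z)
  refine h2.symm.trans ?_
  exact congrArg (lcι I i s M).hom (extCls_res (P s) (P t) (tr I hst) (ph P hst) (ph_comm P hst) i z z' h)

theorem ph_cocycle {I : Ideal R} (P : Sys I) {i s t : ℕ} (hst : t ≤ s) {M : ModuleCat.{0} R}
    (z : Zc (P t).complex i M) : (ph P hst).f i ≫ z.1 ∈ Zc (P s).complex i M := by
  have : (P t).complex.d (i+1) i ≫ z.1 = 0 := z.2
  change (P s).complex.d (i+1) i ≫ (ph P hst).f i ≫ z.1 = 0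
  rw [← HomologicalComplex.Hom.comm_assoc, this, comp_zero]

theorem lcCls_zero {I : Ideal R} (P : Sys I) (i t : ℕ) {M : ModuleCat.{0} R}
    (z : Zc (P t).complex i M) (h : lcCls P i t M z = 0) :
    ∃ (s : ℕ) (hst : t ≤ s), IsBd (P s).complex i M ((ph P hst).f i ≫ z.1) := by
  have h0 : lcCls P i t M z = lcCls P i t M 0 := by rw [h, map_zero]
  obtain ⟨k, f, g, hfg⟩ := (Concrete.isColimit_rep_eq_iff_exists _ (lcColim I i M)
    (i := op (op t)) (j := op (op t)) (extCls (P t) i M z) (extCls (P t) i M 0)).1 h0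
  rw [map_zero] at hfg
  have hst : t ≤ k.unop.unop := leOfHom f.unop.unop
  refine ⟨k.unop.unop, hst, ?_⟩
  rw [← extCls_zero_iff (P k.unop.unop) i M ⟨_, ph_cocycle P hst z⟩]
  rw [← extCls_res (P k.unop.unop) (P t) (tr I hst) (ph P hst) (ph_comm P hst) i z _ rfl]
  exact hfg.trans (map_zero ((diagram (idealPowersDiagram I) i ⋙
    (evaluation (ModuleCat.{0} R) (ModuleCat.{0} R)).obj M).map g).hom)

theorem lcCls_zero_of {I : Ideal R} (P : Sys I) (i t : ℕ) {M : ModuleCat.{0} R}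
    (z : Zc (P t).complex i M) (h : IsBd (P t).complex i M z.1) : lcCls P i t M z = 0 := by
  have := (extCls_zero_iff (P t) i M z).2 h
  change (lcι I i t M).hom _ = 0
  rw [this, map_zero]
end LC
end

noncomputable section
namespace LC

theorem lift_exact {A B C X : ModuleCat.{0} R} {f : A ⟶ B} {g : B ⟶ C}
    (hf : Function.Injective f.hom) (hfg : Function.Exact f.hom g.hom) (k : X ⟶ B)
    (hk : k ≫ g = 0) : ∃ k' : X ⟶ A, k' ≫ f = k := by
  have h1 : ∀ x, k.hom x ∈ LinearMap.range f.hom := fun x =>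
    (hfg _).1 (LinearMap.congr_fun (congrArg (fun f => f.hom) hk) x)
  let e := LinearEquiv.ofInjective f.hom hf
  refine ⟨ModuleCat.ofHom (e.symm.toLinearMap ∘ₗ k.hom.codRestrict _ h1), ?_⟩
  ext x
  change f.hom (e.symm ⟨k.hom x, h1 x⟩) = k.hom x
  exact congrArg Subtype.val (e.apply_symm_apply ⟨k.hom x, h1 x⟩)

theorem lift_proj {B C X : ModuleCat.{0} R} [Projective X] {g : B ⟶ C}
    (hg : Function.Surjective g.hom) (k : X ⟶ C) : ∃ k' : X ⟶ B, k' ≫ g = k := by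
  have : Epi g := (ModuleCat.epi_iff_surjective _).2 hg
  exact ⟨Projective.factorThru k g, by simp⟩

theorem comp_zero_of_exact {A B C : ModuleCat.{0} R} {f : A ⟶ B} {g : B ⟶ C}
    (hfg : Function.Exact f.hom g.hom) : f ≫ g = 0 := by
  ext x
  exact (hfg _).2 ⟨x, rfl⟩

variable {I : Ideal R} (P : Sys I)

abbrev H (I : Ideal R) (i : ℕ) (M : ModuleCat.{0} R) : ModuleCat.{0} R := (localCohomology I i).obj M
abbrev Hm (I : Ideal R) (i : ℕ) {M N : ModuleCat.{0} R} (f : M ⟶ N) : H I i M →ₗ[R] H I i N :=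
  ((localCohomology I i).map f).hom

theorem d_comp_mem (i t : ℕ) {M : ModuleCat.{0} R} (w : (P t).complex.X (i-1) ⟶ M) :
    (P t).complex.d i (i-1) ≫ w ∈ Zc (P t).complex i M := by
  change _ ≫ _ = 0
  simp

theorem map_mem {i t : ℕ} {M N : ModuleCat.{0} R} (z : Zc (P t).complex i M) (f : M ⟶ N) :
    z.1 ≫ f ∈ Zc (P t).complex i N := by
  have : (P t).complex.d (i+1) i ≫ z.1 = 0 := z.2
  change _ ≫ _ = 0
  rw [← Category.assoc, this, zero_comp]

theorem lcCls_map' (i t : ℕ) {M N : ModuleCat.{0} R} (f : M ⟶ N) (z : Zc (P t).complex i M) :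
    Hm I i f (lcCls P i t M z) = lcCls P i t N ⟨z.1 ≫ f, map_mem P z f⟩ :=
  lcCls_map P i t f z _ rfl

theorem lcCls_res' (i : ℕ) {s t : ℕ} (hst : t ≤ s) {M : ModuleCat.{0} R} (z : Zc (P t).complex i M) :
    lcCls P i t M z = lcCls P i s M ⟨(ph P hst).f i ≫ z.1, ph_cocycle P hst z⟩ :=
  lcCls_res P i hst z _ rfl

include P

theorem exact_mid (i : ℕ) {A B C : ModuleCat.{0} R} {f : A ⟶ B} {g : B ⟶ C}
    (hf : Function.Injective f.hom) (hfg : Function.Exact f.hom g.hom)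
    (hg : Function.Surjective g.hom) (y : H I i B) (hy : Hm I i g y = 0) :
    ∃ x : H I i A, Hm I i f x = y := by
  have : Mono f := (ModuleCat.mono_iff_injective _).2 hf
  obtain ⟨t, z, rfl⟩ := lcCls_surj P i y
  rw [lcCls_map'] at hy
  obtain ⟨s, hst, w, hw⟩ := lcCls_zero P i t _ hy
  dsimp only at hw
  obtain ⟨w', rfl⟩ := lift_proj hg w
  have hz : (P s).complex.d (i+1) i ≫ (ph P hst).f i ≫ z.1 = 0 := ph_cocycle P hst z
  obtain ⟨k, hk⟩ := lift_exact hf hfg ((ph P hst).f i ≫ z.1 - (P s).complex.d i (i-1) ≫ w') (by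
    rw [Preadditive.sub_comp, Category.assoc, Category.assoc, hw, sub_self])
  have hkz : k ∈ Zc (P s).complex i A := by
    change _ ≫ _ = 0
    rw [← cancel_mono f, Category.assoc, hk, Preadditive.comp_sub, hz]
    simp
  refine ⟨lcCls P i s A ⟨k, hkz⟩, ?_⟩
  rw [lcCls_map', lcCls_res' P i hst z, ← sub_eq_zero, ← map_sub]
  apply lcCls_zero_of
  refine ⟨-w', ?_⟩
  simp [hk]

theorem vanish_left (i : ℕ) {A B C : ModuleCat.{0} R} {f : A ⟶ B} {g : B ⟶ C}
    (hf : Function.Injective f.hom) (hfg : Function.Exact f.hom g.hom)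
    (hg : Function.Surjective g.hom) (hs : Function.Surjective (Hm I i g))
    (hB : ∀ y : H I (i+1) B, y = 0) (x : H I (i+1) A) : x = 0 := by
  have : Mono f := (ModuleCat.mono_iff_injective _).2 hf
  obtain ⟨t, z, rfl⟩ := lcCls_surj P (i+1) x
  have h1 := hB (Hm I (i+1) f (lcCls P (i+1) t A z))
  rw [lcCls_map'] at h1
  obtain ⟨s, hst, w, hw⟩ := lcCls_zero P (i+1) t _ h1
  rw [lcCls_res' P (i+1) hst z]
  dsimp only at hw
  change (P s).complex.X i ⟶ B at w
  change (P s).complex.d (i+1) i ≫ w = _ at hw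
  generalize hz' : (⟨(ph P hst).f (i+1) ≫ z.1, ph_cocycle P hst z⟩ : Zc (P s).complex (i+1) A) = z'
  have hw2 : (P s).complex.d (i+1) i ≫ w = z'.1 ≫ f := by rw [hw, ← hz', Category.assoc]
  have hfg0 := comp_zero_of_exact hfg
  have hwg : w ≫ g ∈ Zc (P s).complex i C := by
    change _ ≫ _ = 0
    rw [← Category.assoc, hw2, Category.assoc, hfg0, comp_zero]
  obtain ⟨y, hy⟩ := hs (lcCls P i s C ⟨_, hwg⟩)
  obtain ⟨r, v, rfl⟩ := lcCls_surj P i y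
  rw [lcCls_map'] at hy
  have hsq : s ≤ max s r := le_max_left _ _
  have hrq : r ≤ max s r := le_max_right _ _
  generalize max s r = q at hsq hrq
  rw [lcCls_res' P i hsq, lcCls_res' P i hrq, eq_comm, ← sub_eq_zero, ← map_sub] at hy
  obtain ⟨q', hq, b, hb⟩ := lcCls_zero P i q _ hy
  obtain ⟨b', rfl⟩ := lift_proj hg b
  have hv : (P r).complex.d (i+1) i ≫ v.1 = 0 := v.2
  dsimp at hb
  obtain ⟨k, hk⟩ := lift_exact hf hfg ((ph P hq).f i ≫ (ph P hsq).f i ≫ w -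
      (ph P hq).f i ≫ (ph P hrq).f i ≫ v.1 - (P q').complex.d i (i-1) ≫ b') (by
    simp only [Preadditive.sub_comp, Category.assoc, hb, Preadditive.comp_sub]
    simp)
  rw [lcCls_res' P (i+1) hsq, lcCls_res' P (i+1) hq]
  apply lcCls_zero_of
  refine ⟨k, ?_⟩
  change (P q').complex.d (i+1) i ≫ k = _
  rw [← cancel_mono f]
  simp only [Category.assoc, hk, Preadditive.comp_sub]
  simp only [← HomologicalComplex.Hom.comm_assoc, hv, hw2]
  simp

theorem surj_right (i : ℕ) {A B C : ModuleCat.{0} R} {f : A ⟶ B} {g : B ⟶ C}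
    (hf : Function.Injective f.hom) (hfg : Function.Exact f.hom g.hom)
    (hg : Function.Surjective g.hom) (hA : ∀ x : H I (i+1) A, x = 0) :
    Function.Surjective (Hm I i g) := by
  have : Mono f := (ModuleCat.mono_iff_injective _).2 hf
  have hfg0 := comp_zero_of_exact hfg
  intro x
  obtain ⟨t, z, rfl⟩ := lcCls_surj P i x
  have hz : (P t).complex.d (i+1) i ≫ z.1 = 0 := z.2
  obtain ⟨z', hz'⟩ := lift_proj hg z.1
  obtain ⟨k, hk⟩ := lift_exact hf hfg ((P t).complex.d (i+1) i ≫ z') (by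
    rw [Category.assoc, hz', hz])
  have hkz : k ∈ Zc (P t).complex (i+1) A := by
    change _ ≫ _ = 0
    rw [← cancel_mono f, Category.assoc, hk]
    simp
  obtain ⟨s, hst, w, hw⟩ := lcCls_zero P (i+1) t ⟨k, hkz⟩ (hA _)
  change (P s).complex.X i ⟶ A at w
  change (P s).complex.d (i+1) i ≫ w = (ph P hst).f (i+1) ≫ k at hw
  have hy : (ph P hst).f i ≫ z' - w ≫ f ∈ Zc (P s).complex i B := by
    change _ ≫ _ = 0
    rw [Preadditive.comp_sub, ← HomologicalComplex.Hom.comm_assoc, ← hk, ← Category.assoc _ w f, hw]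
    simp
  refine ⟨lcCls P i s B ⟨_, hy⟩, ?_⟩
  rw [lcCls_map', lcCls_res' P i hst]
  congr 2
  simp [hz', hfg0]

theorem inj_vanish (i : ℕ) {Q : ModuleCat.{0} R} [Injective Q] (x : H I (i+1) Q) : x = 0 := by
  obtain ⟨t, z, rfl⟩ := lcCls_surj P (i+1) x
  apply lcCls_zero_of
  exact ⟨((P t).exact_succ i).descToInjective z.1 z.2, ((P t).exact_succ i).comp_descToInjective z.1 z.2⟩

theorem Hm_add (i : ℕ) {M N : ModuleCat.{0} R} (f g : M ⟶ N) : Hm I i (f + g) = Hm I i f + Hm I i g := by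
  ext x
  obtain ⟨t, z, rfl⟩ := lcCls_surj P i x
  rw [LinearMap.add_apply, lcCls_map', lcCls_map', lcCls_map', ← map_add]
  congr 2

theorem Hm_smul (i : ℕ) {M N : ModuleCat.{0} R} (r : R) (f : M ⟶ N) : Hm I i (r • f) = r • Hm I i f := by
  ext x
  obtain ⟨t, z, rfl⟩ := lcCls_surj P i x
  rw [LinearMap.smul_apply, lcCls_map', lcCls_map', ← map_smul]
  congr 2
omit P
theorem Hm_id (i : ℕ) {M : ModuleCat.{0} R} : Hm I i (𝟙 M) = LinearMap.id := by
  simp [Hm]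
theorem Hm_comp (i : ℕ) {M N K : ModuleCat.{0} R} (f : M ⟶ N) (g : N ⟶ K) (x) :
    Hm I i (f ≫ g) x = Hm I i g (Hm I i f x) := by
  simp [Hm]
include P

theorem torsion_elt (i : ℕ) {M : ModuleCat.{0} R} {x : R} (hx : x ∈ I) (y : H I i M) :
    ∃ n, x ^ n • y = 0 := by
  obtain ⟨t, z, rfl⟩ := lcCls_surj P i y
  refine ⟨t, ?_⟩
  rw [← map_smul]
  apply lcCls_zero_of
  let a : (P t).complex ⟶ (P t).complex := x ^ t • 𝟙 _
  have ha : a ≫ (P t).π = 0 := by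
    ext m
    change (P t).π.f 0 (x ^ t • m) = 0
    rw [map_smul]
    generalize (P t).π.f 0 m = q
    change R ⧸ I ^ t at q
    obtain ⟨q, rfl⟩ := Ideal.Quotient.mk_surjective q
    change Ideal.Quotient.mk (I ^ t) (x ^ t * q) = 0
    exact Ideal.Quotient.eq_zero_iff_mem.2 (Ideal.mul_mem_right _ _ (Ideal.pow_mem_pow hx t))
  have hh := ProjectiveResolution.liftHomotopyZero a ha
  have hc := hh.comm i
  rw [dNext_nat, prevD_eq (w := (by simp : (ComplexShape.down ℕ).Rel (i+1) i))] at hc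
  have hz : (P t).complex.d (i+1) i ≫ z.1 = 0 := z.2
  have hc2 := congrArg (fun f => f ≫ z.1) hc
  refine ⟨hh.hom (i-1) i ≫ z.1, ?_⟩
  simp [a, hz] at hc2
  simp [hc2]

theorem loc_vanish (i : ℕ) {M : ModuleCat.{0} R} {x : R} (hx : x ∈ I) (g : M ⟶ M)
    (hg : (x • 𝟙 M) ≫ g = 𝟙 M) (y : H I i M) : y = 0 := by
  obtain ⟨n, hn⟩ := torsion_elt P i hx y
  induction n with
  | zero => simpa using hn
  | succ n ih =>
    apply ih
    have h1 : ∀ v : H I i M, Hm I i g (x • v) = v := fun v => by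
      have : x • v = Hm I i (x • 𝟙 M) v := by
        rw [Hm_smul P, Hm_id]; rfl
      rw [this, ← Hm_comp, hg, Hm_id]; rfl
    rw [← h1 (x ^ n • y), smul_smul, ← pow_succ', hn, map_zero]

end LC
end

noncomputable section
namespace LC

def gam (I : Ideal R) (M : Type) [AddCommGroup M] [Module R M] : Submodule R M where
  carrier := {m | ∃ n, ∀ r ∈ I ^ n, r • m = 0}
  zero_mem' := ⟨0, by simp⟩
  add_mem' := by
    rintro a b ⟨n, hn⟩ ⟨k, hk⟩
    refine ⟨max n k, fun r hr => ?_⟩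
    rw [smul_add, hn r (Ideal.pow_le_pow_right (le_max_left _ _) hr),
      hk r (Ideal.pow_le_pow_right (le_max_right _ _) hr), add_zero]
  smul_mem' := by
    rintro c a ⟨n, hn⟩
    exact ⟨n, fun r hr => by rw [smul_comm, hn r hr, smul_zero]⟩

def Tors (I : Ideal R) (M : Type) [AddCommGroup M] [Module R M] : Prop :=
  ∀ m : M, ∃ n, ∀ r ∈ I ^ n, r • m = 0

theorem gam_fg [IsNoetherianRing R] {I : Ideal R} {M : Type} [AddCommGroup M] [Module R M]
    (J : Ideal R) (f : J →ₗ[R] gam I M) : ∃ n, ∀ r ∈ I ^ n, ∀ j, r • f j = 0 := by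
  have hfg : (⊤ : Submodule R J).FG := Module.Finite.fg_top
  obtain ⟨S, hS⟩ := hfg
  have h1 : ∀ j : J, ∃ n, ∀ r ∈ I ^ n, r • f j = 0 := fun j => by
    obtain ⟨n, hn⟩ := (f j).2
    exact ⟨n, fun r hr => Subtype.ext (hn r hr)⟩
  choose n hn using h1
  refine ⟨S.sup n, fun r hr j => ?_⟩
  have hj : j ∈ Submodule.span R (S : Set J) := hS ▸ Submodule.mem_top
  have : Submodule.span R (S : Set J) ≤ LinearMap.ker (r • f) := by
    rw [Submodule.span_le]
    intro s hs
    exact hn s r (Ideal.pow_le_pow_right (Finset.le_sup (f := n) hs) hr)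
  exact this hj

theorem gam_injective [IsNoetherianRing R] (I : Ideal R) (Q : Type) [AddCommGroup Q] [Module R Q]
    [hQ : Module.Injective R Q] : Module.Injective R (gam I Q) := by
  apply Module.Baer.injective
  intro J f
  obtain ⟨t, ht⟩ := gam_fg J f
  obtain ⟨k, hk⟩ := Ideal.exists_pow_inf_eq_pow_smul I J
  have hk := hk (t + k) (by omega)
  -- `J ∩ I^(t+k) ≤ I^t J`
  have hker : ∀ (x : R) (hx : x ∈ J), x ∈ I ^ (t + k) → f ⟨x, hx⟩ = 0 := by
    intro x hx hxI
    have h1 : x ∈ I ^ (t + k - k) • (I ^ k • (⊤ : Submodule R R) ⊓ J) := by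
      rw [← hk]; refine ⟨?_, hx⟩; simpa using hxI
    have h2 : x ∈ I ^ t • J := by
      have : t + k - k = t := by omega
      rw [this] at h1
      exact Submodule.smul_mono le_rfl inf_le_right h1
    have h3 : ∀ y ∈ I ^ t • J, ∃ hy : y ∈ J, f ⟨y, hy⟩ = 0 := by
      intro y hy
      induction hy using Submodule.smul_induction_on' with
      | smul r hr n hn =>
        refine ⟨J.smul_mem r hn, ?_⟩
        have := ht r hr ⟨n, hn⟩
        rw [← map_smul] at this
        exact this
      | add x hx y hy h1 h2 =>
        obtain ⟨h1, e1⟩ := h1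
        obtain ⟨h2, e2⟩ := h2
        refine ⟨J.add_mem h1 h2, ?_⟩
        have : f (⟨x, h1⟩ + ⟨y, h2⟩) = 0 := by rw [map_add, e1, e2, add_zero]
        exact this
    exact (h3 x h2).2
  let q : J →ₗ[R] R ⧸ I ^ (t + k) := (Submodule.mkQ _) ∘ₗ J.subtype
  have hq : LinearMap.ker q ≤ LinearMap.ker f := by
    rintro ⟨x, hx⟩ h
    exact hker x hx (Ideal.Quotient.eq_zero_iff_mem.1 h)
  -- `f` factors through the range of `q`
  let f' : LinearMap.range q →ₗ[R] gam I Q :=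
    (Submodule.liftQ _ f hq) ∘ₗ q.quotKerEquivRange.symm.toLinearMap
  have hf' : ∀ j, f' ⟨q j, LinearMap.mem_range_self q j⟩ = f j := by
    intro j
    have : q.quotKerEquivRange.symm ⟨q j, LinearMap.mem_range_self q j⟩ = Submodule.Quotient.mk j := by
      rw [LinearEquiv.symm_apply_eq]; rfl
    change Submodule.liftQ _ f hq (q.quotKerEquivRange.symm _) = _
    rw [this]; rfl
  obtain ⟨g, hg⟩ := hQ.out (LinearMap.range q).subtype (Submodule.injective_subtype _)
    ((gam I Q).subtype ∘ₗ f')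
  have hmem : ∀ y, g y ∈ gam I Q := by
    intro y
    refine ⟨t + k, fun r hr => ?_⟩
    obtain ⟨y, rfl⟩ := Ideal.Quotient.mk_surjective y
    rw [← map_smul]
    have : r • (Ideal.Quotient.mk (I ^ (t+k)) y) = 0 :=
      Ideal.Quotient.eq_zero_iff_mem.2 (Ideal.mul_mem_right _ _ hr)
    rw [this, map_zero]
  refine ⟨(g.codRestrict _ hmem) ∘ₗ Submodule.mkQ _, fun x hx => ?_⟩
  apply Subtype.ext
  have := hg ⟨q ⟨x, hx⟩, LinearMap.mem_range_self q _⟩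
  refine this.trans ?_
  exact congrArg Subtype.val (hf' ⟨x, hx⟩)

variable {I : Ideal R} (P : Sys I)
def pi0 (P : Sys I) (t : ℕ) : (P t).complex.X 0 ⟶ ModuleCat.of R (R ⧸ I ^ t) := (P t).π.f 0

theorem d_pi0 (t : ℕ) : (P t).complex.d 1 0 ≫ pi0 P t = 0 := (P t).complex_d_comp_π_f_zero

theorem ph_pi0 {s t : ℕ} (h : t ≤ s) : (ph P h).f 0 ≫ pi0 P t = pi0 P s ≫ tr I h := ph_comm P h

theorem pi0_fac (t : ℕ) {C : ModuleCat.{0} R} (z : Zc (P t).complex 0 C) :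
    ∃ a : ModuleCat.of R (R ⧸ I ^ t) ⟶ C, pi0 P t ≫ a = z.1 :=
  ⟨(P t).isColimitCokernelCofork.desc (CokernelCofork.ofπ z.1 z.2),
      (P t).isColimitCokernelCofork.fac (CokernelCofork.ofπ z.1 z.2) WalkingParallelPair.one⟩

include P
theorem H0_surj {B C : ModuleCat.{0} R} {g : B ⟶ C} (hg : Function.Surjective g.hom)
    (hB : Tors I B) : Function.Surjective (Hm I 0 g) := by
  intro x
  obtain ⟨t, z, rfl⟩ := lcCls_surj P 0 x
  obtain ⟨a, ha⟩ := pi0_fac P t z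
  obtain ⟨b, hb⟩ := hg (a.hom (Ideal.Quotient.mk _ 1))
  obtain ⟨n, hn⟩ := hB b
  have hts : t ≤ max t n := le_max_left _ _
  have hns : n ≤ max t n := le_max_right _ _
  generalize max t n = s at hts hns
  let a' : ModuleCat.of R (R ⧸ I ^ s) ⟶ B := ModuleCat.ofHom
    (Submodule.liftQ (I ^ s) (LinearMap.toSpanSingleton R B b) (fun r hr =>
      hn r (Ideal.pow_le_pow_right hns hr)))
  have haa : a' ≫ g = tr I hts ≫ a := by
    apply ModuleCat.hom_ext
    apply LinearMap.ext
    intro r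
    obtain ⟨r, rfl⟩ := Ideal.Quotient.mk_surjective r
    change g.hom (r • b) = a.hom (Ideal.Quotient.mk _ r)
    rw [map_smul, hb, ← map_smul]
    congr 1
    change Ideal.Quotient.mk _ (r * 1) = _
    rw [mul_one]
  have hm : pi0 P s ≫ a' ∈ Zc (P s).complex 0 B := by
    change (P s).complex.d 1 0 ≫ _ ≫ _ = 0
    rw [← Category.assoc, d_pi0, zero_comp]
  refine ⟨lcCls P 0 s B ⟨_, hm⟩, ?_⟩
  rw [lcCls_map', lcCls_res' P 0 hts z]
  congr 2
  change (pi0 P s ≫ a') ≫ g = _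
  rw [Category.assoc, haa, ← Category.assoc, ← ph_pi0, Category.assoc, ha]

omit P
theorem tors_embed [IsNoetherianRing R] (M : ModuleCat.{0} R) (hM : Tors I M) :
    ∃ (G : ModuleCat.{0} R) (_ : Injective G) (f : M →ₗ[R] G), Function.Injective f ∧ Tors I G := by
  obtain ⟨Q, hQ, ι, hι⟩ : ∃ (Q : ModuleCat.{0} R) (_ : Injective Q) (ι : M ⟶ Q), Mono ι :=
    ⟨Injective.under M, inferInstance, Injective.ι M, inferInstance⟩
  have hQ' : Injective (ModuleCat.of R Q) := hQ
  have : Module.Injective R Q := Module.injective_module_of_injective_object R Q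
  have := gam_injective I Q
  have : Injective (ModuleCat.of R (gam I Q)) := Module.injective_object_of_injective_module R _
  have hι : Function.Injective ι.hom := (ModuleCat.mono_iff_injective _).1 hι
  let f : M →ₗ[R] gam I Q := ι.hom.codRestrict _ (fun m => by
    obtain ⟨n, hn⟩ := hM m
    exact ⟨n, fun r hr => by rw [← map_smul, hn r hr, map_zero]⟩)
  have hf : Function.Injective f := fun a b h => hι (congrArg Subtype.val h)
  refine ⟨ModuleCat.of R (gam I Q), this, f, hf, fun m => ?_⟩
  obtain ⟨n, hn⟩ := m.2
  exact ⟨n, fun r hr => Subtype.ext (hn r hr)⟩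

include P
theorem tors_vanish [IsNoetherianRing R] (i : ℕ) : ∀ (M : ModuleCat.{0} R), Tors I M →
    ∀ x : H I (i+1) M, x = 0 := by
  induction i with
  | zero =>
    intro M hM
    obtain ⟨G, hG, f, hf, hT⟩ := tors_embed M hM
    exact vanish_left P 0 (f := ModuleCat.ofHom f) (g := ModuleCat.ofHom (LinearMap.range f).mkQ) hf
      (LinearMap.exact_iff.2 (Submodule.ker_mkQ _)) (Submodule.mkQ_surjective _)
      (H0_surj P (Submodule.mkQ_surjective _) hT) (inj_vanish P 0)
  | succ i ih =>
    intro M hM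
    obtain ⟨G, hG, f, hf, hT⟩ := tors_embed M hM
    have hT : Tors I (G ⧸ LinearMap.range f) := fun m => by
      obtain ⟨m, rfl⟩ := Submodule.mkQ_surjective _ m
      obtain ⟨n, hn⟩ := hT m
      refine ⟨n, fun r hr => ?_⟩
      rw [← map_smul, hn r hr, map_zero]
    exact vanish_left P (i+1) (f := ModuleCat.ofHom f) (g := ModuleCat.ofHom (LinearMap.range f).mkQ) hf
      (LinearMap.exact_iff.2 (Submodule.ker_mkQ _)) (Submodule.mkQ_surjective _)
      (fun y => ⟨0, by rw [ih (ModuleCat.of R (G ⧸ LinearMap.range f)) hT y, map_zero]⟩)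
      (inj_vanish P (i+1))

omit P
def Tx (x : R) (M : Type) [AddCommGroup M] [Module R M] : Prop := ∀ m : M, ∃ n : ℕ, x ^ n • m = 0
theorem Tx.inj {x : R} {M N : Type} [AddCommGroup M] [Module R M] [AddCommGroup N] [Module R N]
    (h : Tx x N) (f : M →ₗ[R] N) (hf : Function.Injective f) : Tx x M := fun m => by
  obtain ⟨n, hn⟩ := h (f m)
  exact ⟨n, hf (by rw [map_smul, hn, map_zero])⟩
theorem Tx.surj {x : R} {M N : Type} [AddCommGroup M] [Module R M] [AddCommGroup N] [Module R N]
    (h : Tx x M) (f : M →ₗ[R] N) (hf : Function.Surjective f) : Tx x N := fun m => by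
  obtain ⟨m, rfl⟩ := hf m
  obtain ⟨n, hn⟩ := h m
  exact ⟨n, by rw [← map_smul, hn, map_zero]⟩
theorem Tx.loc {x y : R} {M : Type} [AddCommGroup M] [Module R M] (h : Tx x M) :
    Tx x (LocalizedModule (Submonoid.powers y) M) := fun m => by
  induction m using LocalizedModule.induction_on with | h m s
  obtain ⟨n, hn⟩ := h m
  exact ⟨n, by
    rw [LocalizedModule.smul'_mk, hn, LocalizedModule.zero_mk]⟩

theorem tors_of_Tx [IsNoetherianRing R] {T : Set R} (hT : I ≤ Ideal.span T) {M : Type} [AddCommGroup M]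
    [Module R M] (h : ∀ x ∈ T, Tx x M) : Tors I M := fun m => by
  have h1 : I ≤ Ideal.radical (LinearMap.ker (LinearMap.toSpanSingleton R M m)) := by
    refine hT.trans (Ideal.span_le.2 fun x hx => ?_)
    obtain ⟨n, hn⟩ := h x hx m
    exact ⟨n, hn⟩
  obtain ⟨k, hk⟩ := Ideal.exists_pow_le_of_le_radical_of_fg h1 (IsNoetherian.noetherian I)
  exact ⟨k, fun r hr => hk hr⟩

include P
theorem cech [IsNoetherianRing R] (l : List R) : ∀ (T : Set R), (∀ y ∈ l, y ∈ I) →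
    I ≤ Ideal.span (T ∪ {x | x ∈ l}) → ∀ M : ModuleCat.{0} R, (∀ x ∈ T, Tx x M) →
    ∀ i, l.length < i → ∀ x : H I i M, x = 0 := by
  induction l with
  | nil =>
    intro T _ hT M hM i hi
    obtain ⟨i, rfl⟩ : ∃ j, i = j + 1 := ⟨i - 1, by simp at hi; omega⟩
    exact tors_vanish P i M (tors_of_Tx (by simpa using hT) hM)
  | cons y l ih =>
    intro T hl hT M hM i hi
    have ih := ih (insert y T) (fun z hz => hl z (by simp [hz])) (by
      refine hT.trans (Ideal.span_mono ?_)
      rintro z (hz | hz)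
      · exact Or.inl (Or.inr hz)
      · rcases List.mem_cons.1 hz with rfl | hz
        · exact Or.inl (Or.inl rfl)
        · exact Or.inr hz)
    let L := LocalizedModule (Submonoid.powers y) M
    let f : M →ₗ[R] L := LocalizedModule.mkLinearMap _ _
    let ys : Submonoid.powers y := ⟨y, Submonoid.mem_powers y⟩
    obtain ⟨i, rfl⟩ : ∃ j, i = j + 1 := ⟨i - 1, by omega⟩
    simp only [List.length_cons] at hi
    have hL : ∀ k, ∀ x : H I k (ModuleCat.of R L), x = 0 := fun k => by
      refine loc_vanish P k (hl y (by simp)) (ModuleCat.ofHom (LocalizedModule.divBy (M := M) ys |>.restrictScalars R)) ?_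
      ext m
      exact LocalizedModule.divBy_mul_by ys m
    have hA : ∀ k, l.length < k → ∀ x : H I k (ModuleCat.of R (LinearMap.ker f)), x = 0 := by
      refine ih _ ?_
      rintro x (rfl | hx)
      · rintro ⟨m, hm⟩
        obtain ⟨⟨s, n, rfl⟩, hs⟩ := (IsLocalizedModule.eq_zero_iff (Submonoid.powers x) f).1 hm
        exact ⟨n, Subtype.ext hs⟩
      · exact (hM x hx).inj (LinearMap.ker f).subtype (Submodule.injective_subtype _)
    have hC : ∀ k, l.length < k → ∀ x : H I k (ModuleCat.of R (L ⧸ LinearMap.range f)), x = 0 := by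
      refine ih _ ?_
      rintro x (rfl | hx)
      · intro m
        obtain ⟨m₀, rfl⟩ := Submodule.mkQ_surjective _ m
        obtain ⟨⟨m, s⟩, hs⟩ := IsLocalizedModule.surj (Submonoid.powers x) f m₀
        obtain ⟨n, hn⟩ := s.2
        refine ⟨n, ?_⟩
        rw [← map_smul]
        refine (Submodule.Quotient.mk_eq_zero _).2 ⟨m, ?_⟩
        rw [← hs]
        change (s : R) • m₀ = x ^ n • m₀
        rw [← hn]
      · exact (hM x hx).loc.surj (LinearMap.range f).mkQ (Submodule.mkQ_surjective _)
    have hN : ∀ x : H I (i+1) (ModuleCat.of R (LinearMap.range f)), x = 0 :=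
      vanish_left P i (f := ModuleCat.ofHom (LinearMap.range f).subtype)
        (g := ModuleCat.ofHom (LinearMap.range f).mkQ) (Submodule.injective_subtype _)
        (LinearMap.exact_subtype_mkQ _) (Submodule.mkQ_surjective _)
        (fun y => ⟨0, by rw [hC i (by omega) y, map_zero]⟩) (hL _)
    intro x
    obtain ⟨a, rfl⟩ := exact_mid P (i+1) (f := ModuleCat.ofHom (LinearMap.ker f).subtype)
      (g := ModuleCat.ofHom f.rangeRestrict) (Submodule.injective_subtype _)
      (by
        change Function.Exact (LinearMap.ker f).subtype f.rangeRestrict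
        rw [LinearMap.exact_iff, LinearMap.ker_rangeRestrict, Submodule.range_subtype])
      f.surjective_rangeRestrict x (hN _)
    rw [hA (i+1) (by omega) a, map_zero]

theorem bound [IsNoetherianRing R] : ∃ n, ∀ i, n < i → ∀ (M : ModuleCat.{0} R) (x : H I i M), x = 0 := by
  obtain ⟨S, hS⟩ := IsNoetherian.noetherian I
  refine ⟨S.toList.length, fun i hi M => cech P S.toList ∅ ?_ ?_ M (by simp) i hi⟩
  · intro y hy
    rw [← hS]
    exact Submodule.subset_span (by simpa using hy)
  · rw [← hS]
    refine Ideal.span_mono ?_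
    intro x hx
    simpa using hx

end LC
end

noncomputable section
namespace LC
open TensorProduct
variable {I : Ideal R} (P : Sys I)

def sp {M : ModuleCat.{0} R} (m : M) : ModuleCat.of R R ⟶ M :=
  ModuleCat.ofHom (LinearMap.toSpanSingleton R M m)

theorem sp_add {M : ModuleCat.{0} R} (m n : M) : sp (m + n) = sp m + sp n := by
  apply ModuleCat.hom_ext
  apply LinearMap.ext
  intro r
  exact smul_add r m n

theorem sp_smul {M : ModuleCat.{0} R} (c : R) (m : M) : sp (c • m) = c • sp m := by
  apply ModuleCat.hom_ext
  apply LinearMap.ext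
  intro r
  exact smul_comm r c m

theorem sp_comp {M N : ModuleCat.{0} R} (m : M) (f : M ⟶ N) : sp m ≫ f = sp (f.hom m) := by
  apply ModuleCat.hom_ext
  apply LinearMap.ext
  intro r
  exact map_smul f.hom r m

def theta (i : ℕ) (M : ModuleCat.{0} R) :
    TensorProduct R (H I i (ModuleCat.of R R)) M →ₗ[R] H I i M :=
  TensorProduct.lift (LinearMap.mk₂ R (fun ξ m => Hm I i (sp m) ξ)
    (fun a b m => map_add _ a b) (fun c a m => map_smul _ c a)
    (fun a m n => by rw [sp_add, Hm_add P]; rfl)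
    (fun c a m => by rw [sp_smul, Hm_smul P]; rfl))

theorem theta_tmul (i : ℕ) (M : ModuleCat.{0} R) (ξ) (m : M) :
    theta P i M (ξ ⊗ₜ m) = Hm I i (sp m) ξ := rfl

theorem theta_nat (i : ℕ) {M N : ModuleCat.{0} R} (f : M ⟶ N) (u) :
    Hm I i f (theta P i M u) = theta P i N (LinearMap.lTensor _ f.hom u) := by
  induction u with
  | zero => simp only [map_zero]
  | add a b ha hb => simp only [map_add, ha, hb]
  | tmul ξ m =>
    rw [LinearMap.lTensor_tmul, theta_tmul, theta_tmul, ← Hm_comp, sp_comp]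

theorem theta_free_inj (i : ℕ) (J : Type) :
    Function.Injective (theta P i (ModuleCat.of R (J →₀ R))) := by
  classical
  rw [injective_iff_map_eq_zero]
  intro u hu
  have key : ∀ (u : TensorProduct R (H I i (ModuleCat.of R R)) (J →₀ R)) (k : J),
      TensorProduct.finsuppScalarRight R R (H I i (ModuleCat.of R R)) J u k =
      Hm I i (ModuleCat.ofHom (Finsupp.lapply (R := R) (M := R) k) :
        ModuleCat.of R (J →₀ R) ⟶ ModuleCat.of R R) (theta P i (ModuleCat.of R (J →₀ R)) u) := by
    intro u k
    induction u with
    | zero => simp only [map_zero]; rfl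
    | add a b ha hb => simp only [map_add, ← ha, ← hb]; rfl
    | tmul ξ f =>
      rw [TensorProduct.finsuppScalarRight_apply_tmul_apply]
      erw [theta_tmul]
      rw [← Hm_comp]
      have : sp (M := ModuleCat.of R (J →₀ R)) f ≫ (ModuleCat.ofHom (Finsupp.lapply (R := R) (M := R) k) :
        ModuleCat.of R (J →₀ R) ⟶ ModuleCat.of R R) = f k • 𝟙 _ := by
        rw [sp_comp]
        apply ModuleCat.hom_ext
        apply LinearMap.ext
        intro r
        exact mul_comm r (f k)
      erw [this]
      rw [Hm_smul P, Hm_id]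
      rfl
  apply (TensorProduct.finsuppScalarRight R R (H I i (ModuleCat.of R R)) J).injective
  rw [map_zero]
  ext k
  erw [key u k, hu]
  rw [map_zero]
  rfl

theorem theta_free_surj (hP : ∀ t i, Module.Finite R ((P t).complex.X i)) (i : ℕ) (J : Type) :
    Function.Surjective (theta P i (ModuleCat.of R (J →₀ R))) := by
  classical
  intro x
  obtain ⟨t, z, hz⟩ := lcCls_surj P i x
  obtain ⟨T, hT⟩ := (hP t i).fg_top
  let ζ : (P t).complex.X i →ₗ[R] (J →₀ R) := z.1.hom
  let S : Finset J := T.biUnion (fun a => (ζ a).support)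
  have hS : ∀ a, ζ a ∈ Finsupp.supported R R (S : Set J) := by
    intro a
    have ha : a ∈ Submodule.span R (T : Set ((P t).complex.X i)) := hT ▸ Submodule.mem_top
    have : Submodule.span R (T : Set ((P t).complex.X i)) ≤ (Finsupp.supported R R (S : Set J)).comap ζ := by
      rw [Submodule.span_le]
      intro b hb
      change ((ζ b).support : Set J) ⊆ S
      exact_mod_cast Finset.subset_biUnion_of_mem (fun a => (ζ a).support) hb
    exact this ha
  let F := ModuleCat.of R (J →₀ R)
  let pr : J → (F ⟶ ModuleCat.of R R) := fun k => ModuleCat.ofHom (Finsupp.lapply (R := R) (M := R) k)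
  let si : J → F := fun k => (Finsupp.single k 1 : J →₀ R)
  have hp : z.1 ≫ (∑ k ∈ S, pr k ≫ sp (si k)) = z.1 := by
    apply ModuleCat.hom_ext
    apply LinearMap.ext
    intro a
    rw [ModuleCat.hom_comp, ModuleCat.hom_sum, LinearMap.comp_apply, LinearMap.sum_apply]
    change ∑ k ∈ S, (ζ a k) • (Finsupp.single k 1 : J →₀ R) = ζ a
    have h1 := hS a
    rw [Finsupp.mem_supported] at h1
    conv_rhs => rw [← Finsupp.sum_single (ζ a)]
    rw [Finsupp.sum_of_support_subset (s := S) _ (by exact_mod_cast h1) _ (by simp)]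
    simp
  have hx : Hm I i (∑ k ∈ S, pr k ≫ sp (si k)) x = x := by
    rw [← hz]
    exact lcCls_map P i t _ z z hp
  refine ⟨∑ k ∈ S, (Hm I i (pr k) x) ⊗ₜ si k, ?_⟩
  rw [map_sum]
  conv_rhs => rw [← hx]
  have h2 := map_sum (AddMonoidHom.mk' (fun f : F ⟶ F => Hm I i f) (Hm_add P i)) (fun k => pr k ≫ sp (si k)) S
  have h3 : Hm I i (∑ k ∈ S, pr k ≫ sp (si k)) = ∑ k ∈ S, Hm I i (pr k ≫ sp (si k)) := h2
  rw [h3, LinearMap.sum_apply]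
  refine Finset.sum_congr rfl fun k _ => ?_
  rw [Hm_comp]
  rfl

theorem pres (M : ModuleCat.{0} R) : ∃ (J : Type) (K : ModuleCat.{0} R)
    (f : K ⟶ ModuleCat.of R (J →₀ R)) (g : ModuleCat.of R (J →₀ R) ⟶ M),
    Function.Injective f.hom ∧ Function.Exact f.hom g.hom ∧ Function.Surjective g.hom := by
  let g : (M →₀ R) →ₗ[R] M := Finsupp.linearCombination R id
  refine ⟨M, ModuleCat.of R (LinearMap.ker g), ModuleCat.ofHom (LinearMap.ker g).subtype,
    ModuleCat.ofHom g, Submodule.injective_subtype _, ?_, ?_⟩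
  · exact LinearMap.exact_subtype_ker_map g
  · exact Finsupp.linearCombination_id_surjective R M

theorem theta_surj (hP : ∀ t i, Module.Finite R ((P t).complex.X i)) (i : ℕ)
    (hv : ∀ (M : ModuleCat.{0} R) (x : H I (i+1) M), x = 0) (M : ModuleCat.{0} R) :
    Function.Surjective (theta P i M) := by
  obtain ⟨J, K, f, g, hf, hfg, hg⟩ := pres M
  intro x
  obtain ⟨y, rfl⟩ := surj_right P i hf hfg hg (hv K) x
  obtain ⟨u, rfl⟩ := theta_free_surj P hP i J y
  exact ⟨_, (theta_nat P i g u).symm⟩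

theorem theta_inj (hP : ∀ t i, Module.Finite R ((P t).complex.X i)) (i : ℕ)
    (hv : ∀ (M : ModuleCat.{0} R) (x : H I (i+1) M), x = 0) (M : ModuleCat.{0} R) :
    Function.Injective (theta P i M) := by
  obtain ⟨J, K, f, g, hf, hfg, hg⟩ := pres M
  rw [injective_iff_map_eq_zero]
  intro u hu
  obtain ⟨v, rfl⟩ := LinearMap.lTensor_surjective (H I i (ModuleCat.of R R)) hg u
  rw [← theta_nat] at hu
  obtain ⟨w, hw⟩ := exact_mid P i hf hfg hg _ hu
  obtain ⟨w, rfl⟩ := theta_surj P hP i hv K w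
  rw [theta_nat] at hw
  have := theta_free_inj P i J hw
  rw [← this]
  exact (lTensor_exact (H I i (ModuleCat.of R R)) hfg hg _).2 ⟨w, rfl⟩

theorem vanish_above [IsNoetherianRing R] (hP : ∀ t i, Module.Finite R ((P t).complex.X i)) (h : ℕ)
    (hvan : ∀ l, h < l → Subsingleton (H I l (ModuleCat.of R R))) :
    ∀ l, h < l → ∀ (M : ModuleCat.{0} R) (x : H I l M), x = 0 := by
  obtain ⟨n, hn⟩ := bound P
  have key : ∀ d l, h < l → n < l + d → ∀ (M : ModuleCat.{0} R) (x : H I l M), x = 0 := by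
    intro d
    induction d with
    | zero => intro l _ hl; exact hn l (by omega)
    | succ d ih =>
      intro l hl hd M x
      obtain ⟨u, rfl⟩ := theta_surj P hP l (ih (l+1) (by omega) (by omega)) M x
      have := hvan l hl
      rw [Subsingleton.elim u 0, map_zero]
  intro l hl
  exact key (n+1) l hl (by omega)

theorem main [IsNoetherianRing R] (I : Ideal R) (h : ℕ)
    (hvan : ∀ l, h < l → Subsingleton (H I l (ModuleCat.of R R))) (M : ModuleCat.{0} R) :
    Nonempty (TensorProduct R (H I h (ModuleCat.of R R)) M ≃ₗ[R] H I h M) := by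
  have h1 : ∀ t : ℕ, ∃ P : ProjectiveResolution (ModuleCat.of R (R ⧸ I ^ t)),
      ∀ i, Module.Finite R (P.complex.X i) := fun t => exists_fg_res (R ⧸ I ^ t)
  choose P hP using h1
  have hv := vanish_above P hP h hvan (h+1) (by omega)
  exact ⟨LinearEquiv.ofBijective (theta P h M) ⟨theta_inj P hP h hv M, theta_surj P hP h hv M⟩⟩

end LC
end

end LCHelpers

/-- Let `(R, m)` be a noetherian local ring, `E` an injective hull of the
residue field `R/m` and `D(-) = Hom_R(-, E)` the Matlis dual functor.  Let `I` be an
ideal of `R` such that `H^l_I(R) = 0` for every `l > h`, and set `H := H^h_I(R)`.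
Then there is an isomorphism of `R`-modules `H ⊗_R D(H) ≅ H^h_I(D(H))`. -/
theorem stmt10 {R : Type} [CommRing R] [IsNoetherianRing R] [IsLocalRing R]
    (E : Type) [AddCommGroup E] [Module R E] [Module.Injective R E]
    (e : IsLocalRing.ResidueField R →ₗ[R] E) (he : Function.Injective e)
    (hess : ∀ N : Submodule R E, N ≠ ⊥ → N ⊓ LinearMap.range e ≠ ⊥)
    (I : Ideal R) (h : ℕ)
    (hvan : ∀ l : ℕ, h < l → Subsingleton ((localCohomology I l).obj (ModuleCat.of R R))) :
    Nonempty
      ((TensorProduct R ((localCohomology I h).obj (ModuleCat.of R R))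
          (((localCohomology I h).obj (ModuleCat.of R R)) →ₗ[R] E)) ≃ₗ[R]
        ((localCohomology I h).obj
          (ModuleCat.of R ((((localCohomology I h).obj (ModuleCat.of R R)) →ₗ[R] E))))) := by
  exact LC.main I h hvan (ModuleCat.of R _)
end

section
/- Let (R,m) be a Noetherian local ring, I an ideal of R, h ∈ ℕ, and x = x_1,…,x_h ∈ I an R-regular sequence. Then H^h_I(R) = Γ_I(H^h_{xR}(R)); in particular H^h_I(R) is a submodule of H^h_{xR}(R). -/
open CategoryTheory


noncomputable section Bridge
open Limits Opposite

variable {R : Type} [CommRing R]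

/-- The additive functor `Hom(-, Y)` with values in the opposite category. -/
abbrev homOp (Y : ModuleCat.{0} R) : ModuleCat.{0} R ⥤ (ModuleCat.{0} R)ᵒᵖ :=
  ((linearYoneda R (ModuleCat.{0} R)).obj Y).rightOp

/-- The contravariant functor `Ext^n(-, Y)` -/
abbrev FExt (Y : ModuleCat.{0} R) (n : ℕ) : (ModuleCat.{0} R)ᵒᵖ ⥤ ModuleCat.{0} R :=
  (Ext R (ModuleCat.{0} R) n).flip.obj Y

variable {Y : ModuleCat.{0} R} {n : ℕ}

/-- an element of `Hom(X, Y)` as a morphism from `R`, in the opposite category -/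
def hatMor {X : ModuleCat.{0} R} (f : X ⟶ Y) : (homOp Y).obj X ⟶ op (ModuleCat.of R R) :=
  (ModuleCat.ofHom (LinearMap.toSpanSingleton R (X ⟶ Y) f)).op

lemma hatMor_surj {X : ModuleCat.{0} R} (u : (homOp Y).obj X ⟶ op (ModuleCat.of R R)) :
    ∃ f : X ⟶ Y, hatMor f = u := by
  refine ⟨u.unop.hom (1 : R), ?_⟩
  apply Quiver.Hom.unop_inj
  apply ModuleCat.hom_ext
  apply LinearMap.ext_ring
  exact one_smul _ _

lemma hatMor_inj {X : ModuleCat.{0} R} {f g : X ⟶ Y} (h : hatMor f = hatMor g) : f = g := by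
  have := congrArg (fun u => u.unop.hom (1 : R)) h
  have h2 : (1:R) • f = (1:R) • g := this
  simpa using h2

lemma map_hatMor {X X' : ModuleCat.{0} R} (g : X ⟶ X') (f : X' ⟶ Y) :
    (homOp Y).map g ≫ hatMor f = hatMor (g ≫ f) := by
  apply Quiver.Hom.unop_inj
  apply ModuleCat.hom_ext
  apply LinearMap.ext_ring
  change g ≫ ((1:R) • f) = (1:R) • (g ≫ f)
  simp

lemma hatMor_zero {X : ModuleCat.{0} R} : hatMor (0 : X ⟶ Y) = 0 := by
  apply Quiver.Hom.unop_inj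
  apply ModuleCat.hom_ext
  apply LinearMap.ext_ring
  exact smul_zero (M := R) (A := X ⟶ Y) _

lemma hatMor_add {X : ModuleCat.{0} R} (f g : X ⟶ Y) :
    hatMor (f + g) = hatMor f + hatMor g := by
  apply Quiver.Hom.unop_inj
  apply ModuleCat.hom_ext
  apply LinearMap.ext_ring
  change (1:R) • (f + g) = (1:R) • f + (1:R) • g
  simp

lemma hatMor_smul {X : ModuleCat.{0} R} (r : R) (f : X ⟶ Y) :
    hatMor (r • f) = hatMor f ≫ (r • 𝟙 (ModuleCat.of R R)).op := by
  apply Quiver.Hom.unop_inj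
  apply ModuleCat.hom_ext
  apply LinearMap.ext_ring
  change (1:R) • (r • f) = (r • (1 : R)) • f
  simp


section General
variable {D : Type*} [Category* D] [Abelian D] {ι : Type*} {c : ComplexShape ι}

/-- A cocycle with values in `J` gives a morphism from homology. -/
def hcls (K : HomologicalComplex D c) {J : D} {i : ι} (k : K.X i ⟶ J) (j : ι) (hj : c.prev i = j)
    (hk : K.d j i ≫ k = 0) : K.homology i ⟶ J :=
  K.homologyι i ≫ K.descOpcycles k j hj hk

variable (K : HomologicalComplex D c) {J : D} {i j : ι} (hj : c.prev i = j)

lemma hcls_surj [Injective J] (v : K.homology i ⟶ J) : ∃ k hk, hcls K k j hj hk = v := by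
  let w := Injective.factorThru v (K.homologyι i)
  have hw : K.homologyι i ≫ w = v := Injective.comp_factorThru v (K.homologyι i)
  refine ⟨K.pOpcycles i ≫ w, by simp, ?_⟩
  rw [hcls, ← hw]
  congr 1
  rw [← cancel_epi (K.pOpcycles i), HomologicalComplex.p_descOpcycles]

lemma hcls_add (k l : K.X i ⟶ J) (hk : K.d j i ≫ k = 0) (hl : K.d j i ≫ l = 0)
    (hkl : K.d j i ≫ (k + l) = 0) :
    hcls K (k + l) j hj hkl = hcls K k j hj hk + hcls K l j hj hl := by
  simp only [hcls]
  rw [← Preadditive.comp_add]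
  congr 1
  rw [← cancel_epi (K.pOpcycles i)]
  simp

lemma hcls_comp {J' : D} (k : K.X i ⟶ J) (hk : K.d j i ≫ k = 0) (u : J ⟶ J')
    (hku : K.d j i ≫ (k ≫ u) = 0) :
    hcls K (k ≫ u) j hj hku = hcls K k j hj hk ≫ u := by
  simp only [hcls]
  rw [Category.assoc]
  congr 1
  rw [← cancel_epi (K.pOpcycles i)]
  simp

lemma hcls_naturality {L : HomologicalComplex D c} (φ : K ⟶ L) (k : L.X i ⟶ J)
    (hk : L.d j i ≫ k = 0) (hk' : K.d j i ≫ (φ.f i ≫ k) = 0) :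
    HomologicalComplex.homologyMap φ i ≫ hcls L k j hj hk = hcls K (φ.f i ≫ k) j hj hk' := by
  simp [hcls]

lemma hcls_eq_zero_iff [Injective J] (k : K.X i ⟶ J) (hk : K.d j i ≫ k = 0) :
    hcls K k j hj hk = 0 ↔ ∃ l : K.X (c.next i) ⟶ J, K.d i (c.next i) ≫ l = k := by
  constructor
  · intro h1
    let S : ShortComplex D := ShortComplex.mk (K.homologyι i) (K.fromOpcycles i (c.next i)) (by simp)
    have hS : S.Exact := ShortComplex.exact_of_f_is_kernel _ (K.homologyIsKernel i _ rfl)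
    refine ⟨hS.descToInjective _ h1, ?_⟩
    have hv := hS.comp_descToInjective _ h1
    have : K.d i (c.next i) = K.pOpcycles i ≫ S.g := by simp [S]
    rw [this, Category.assoc, hv]
    simp
  · rintro ⟨l, hl⟩
    exact K.homologyι_descOpcycles_eq_zero_of_boundary k j hj (i' := c.next i) l hl.symm

end General

variable (Y) in
/-- The complex `Hom(P, Y)` in the opposite category. -/
def KC {X : ModuleCat.{0} R} (P : ProjectiveResolution X) :
    HomologicalComplex (ModuleCat.{0} R)ᵒᵖ (ComplexShape.down ℕ) :=
  ((homOp Y).mapHomologicalComplex (ComplexShape.down ℕ)).obj P.complex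

variable (Y n) in
/-- comparison of `FExt` with homology -/
def KCiso {X : ModuleCat.{0} R} (P : ProjectiveResolution X) :
    ((homOp Y).leftDerived n).obj X ≅ (KC Y P).homology n :=
  P.isoLeftDerivedObj (homOp Y) n

/-- cochains as morphisms in the opposite category -/
def hatC {X : ModuleCat.{0} R} (P : ProjectiveResolution X) (f : P.complex.X n ⟶ Y) :
    (KC Y P).X n ⟶ op (ModuleCat.of R R) := hatMor f

lemma hatC_d {X : ModuleCat.{0} R} (P : ProjectiveResolution X) {m : ℕ} (f : P.complex.X n ⟶ Y) :
    (KC Y P).d m n ≫ hatC P f = hatC P (P.complex.d m n ≫ f) :=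
  map_hatMor (P.complex.d m n) f

lemma hatC_inj {X : ModuleCat.{0} R} (P : ProjectiveResolution X) {f g : P.complex.X n ⟶ Y}
    (h : hatC P f = hatC P g) : f = g := hatMor_inj h

lemma hatC_zero {X : ModuleCat.{0} R} (P : ProjectiveResolution X) :
    hatC P (0 : P.complex.X n ⟶ Y) = 0 := hatMor_zero

lemma hatC_surj {X : ModuleCat.{0} R} (P : ProjectiveResolution X)
    (k : (KC Y P).X n ⟶ op (ModuleCat.of R R)) : ∃ f, hatC P f = k := hatMor_surj k

lemma hat_cond {X : ModuleCat.{0} R} (P : ProjectiveResolution X) (f : P.complex.X n ⟶ Y)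
    (hf : P.complex.d (n+1) n ≫ f = 0) : (KC Y P).d (n+1) n ≫ hatC P f = 0 := by
  rw [hatC_d, hf, hatC_zero]

/-- class of cocycle, as a morphism -/
def clsMor {X : ModuleCat.{0} R} (P : ProjectiveResolution X) (f : P.complex.X n ⟶ Y)
    (hf : P.complex.d (n+1) n ≫ f = 0) :
    ((homOp Y).leftDerived n).obj X ⟶ op (ModuleCat.of R R) :=
  (KCiso Y n P).hom ≫ hcls (KC Y P) (hatC P f) (n+1) (by simp) (hat_cond P f hf)

/-- class of a cocycle -/
def cls {X : ModuleCat.{0} R} (P : ProjectiveResolution X) (f : P.complex.X n ⟶ Y)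
    (hf : P.complex.d (n+1) n ≫ f = 0) : (FExt Y n).obj (op X) :=
  (clsMor P f hf).unop.hom (1 : R)

lemma clsMor_ext {X : ModuleCat.{0} R} {u v : ((homOp Y).leftDerived n).obj X ⟶ op (ModuleCat.of R R)}
    (h : u.unop.hom (1:R) = v.unop.hom (1:R)) : u = v := by
  apply Quiver.Hom.unop_inj
  apply ModuleCat.hom_ext
  apply LinearMap.ext_ring
  exact h

instance projSelf : Projective (ModuleCat.of R R) :=
  ModuleCat.projective_of_free (Module.Basis.singleton Unit R)

lemma cls_surj {X : ModuleCat.{0} R} (P : ProjectiveResolution X) (z : (FExt Y n).obj (op X)) :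
    ∃ f hf, cls P f hf = z := by
  let u : ((homOp Y).leftDerived n).obj X ⟶ op (ModuleCat.of R R) :=
    (ModuleCat.ofHom (LinearMap.toSpanSingleton R ((FExt Y n).obj (op X)) z)).op
  have hu : u.unop.hom (1:R) = z := one_smul _ _
  obtain ⟨k, hk, h⟩ := hcls_surj (KC Y P) (i := n) (j := n+1) (by simp) ((KCiso Y n P).inv ≫ u)
  obtain ⟨f, rfl⟩ := hatC_surj P k
  have hf' : P.complex.d (n+1) n ≫ f = 0 := by
    apply hatC_inj P
    rw [← hatC_d, hk, hatC_zero]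
  refine ⟨f, hf', ?_⟩
  have h2 : clsMor P f hf' = u := by
    rw [clsMor, h, Iso.hom_inv_id_assoc]
  rw [← hu, cls, h2]

lemma cls_add {X : ModuleCat.{0} R} (P : ProjectiveResolution X) (f g : P.complex.X n ⟶ Y)
    (hf : P.complex.d (n+1) n ≫ f = 0) (hg : P.complex.d (n+1) n ≫ g = 0)
    (hfg : P.complex.d (n+1) n ≫ (f + g) = 0) :
    cls P (f + g) hfg = cls P f hf + cls P g hg := by
  have : clsMor P (f + g) hfg = clsMor P f hf + clsMor P g hg := by
    simp only [clsMor]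
    rw [← Preadditive.comp_add]
    congr 1
    have h : hatC P (f + g) = hatC P f + hatC P g := hatMor_add f g
    simp only [h]
    exact hcls_add ..
  rw [cls, this]
  rfl

lemma cls_smul {X : ModuleCat.{0} R} (P : ProjectiveResolution X) (r : R) (f : P.complex.X n ⟶ Y)
    (hf : P.complex.d (n+1) n ≫ f = 0) (hrf : P.complex.d (n+1) n ≫ (r • f) = 0) :
    cls P (r • f) hrf = r • cls P f hf := by
  have : clsMor P (r • f) hrf = clsMor P f hf ≫ (r • 𝟙 (ModuleCat.of R R)).op := by
    simp only [clsMor, Category.assoc]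
    congr 1
    have h : hatC P (r • f) = hatC P f ≫ (r • 𝟙 (ModuleCat.of R R)).op := hatMor_smul r f
    simp only [h]
    exact hcls_comp ..
  rw [cls, this]
  exact (clsMor P f hf).unop.hom.map_smul r (1:R)

lemma cls_eq_zero_iff {X : ModuleCat.{0} R} (P : ProjectiveResolution X) (f : P.complex.X n ⟶ Y)
    (hf : P.complex.d (n+1) n ≫ f = 0) : cls P f hf = 0 ↔
    ∃ g, P.complex.d n ((ComplexShape.down ℕ).next n) ≫ g = f := by
  have h0 : cls P f hf = 0 ↔ clsMor P f hf = 0 := by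
    constructor
    · intro h
      apply clsMor_ext
      exact h
    · intro h
      rw [cls, h]
      rfl
  have h1 : clsMor P f hf = 0 ↔ hcls (KC Y P) (hatC P f) (n+1) (by simp) (hat_cond P f hf) = 0 := by
    rw [clsMor]
    exact ⟨fun h => by rwa [← cancel_epi (KCiso Y n P).hom, comp_zero],
      fun h => by rw [h, comp_zero]⟩
  rw [h0, h1, hcls_eq_zero_iff]
  constructor
  · rintro ⟨l, hl⟩
    obtain ⟨g, rfl⟩ := hatC_surj P l
    exact ⟨g, hatC_inj P (by rw [← hatC_d, hl])⟩
  · rintro ⟨g, hg⟩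
    exact ⟨hatC P g, by rw [hatC_d, hg]⟩

lemma map_cls {X X' : ModuleCat.{0} R} (P : ProjectiveResolution X) (Q : ProjectiveResolution X')
    (g : X ⟶ X') (φ : ProjectiveResolution.Hom P Q g) (f : Q.complex.X n ⟶ Y)
    (hf : Q.complex.d (n+1) n ≫ f = 0) :
    (FExt Y n).map g.op (cls Q f hf) = cls P (φ.hom.f n ≫ f) (by simp [← φ.hom.comm_assoc, hf]) := by
  have hφ : P.complex.d (n+1) n ≫ (φ.hom.f n ≫ f) = 0 := by simp [← φ.hom.comm_assoc, hf]
  let Φ : KC Y P ⟶ KC Y Q := ((homOp Y).mapHomologicalComplex (ComplexShape.down ℕ)).map φ.hom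
  have h1 : ((homOp Y).leftDerived n).map g =
      (KCiso Y n P).hom ≫ HomologicalComplex.homologyMap Φ n ≫ (KCiso Y n Q).inv :=
    Functor.leftDerived_map_eq (homOp Y) n g φ.hom φ.hom_comp_π
  have h2 : Φ.f n ≫ hatC Q f = hatC P (φ.hom.f n ≫ f) := map_hatMor _ _
  have : ((homOp Y).leftDerived n).map g ≫ clsMor Q f hf = clsMor P (φ.hom.f n ≫ f) hφ := by
    rw [h1, clsMor, clsMor]
    simp only [Category.assoc, Iso.inv_hom_id_assoc]
    congr 1
    rw [hcls_naturality (hk' := by rw [h2]; exact hat_cond P _ hφ)]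
    simp only [h2]
  rw [cls, cls, ← this]
  rfl

open Abelian in
lemma extMk_eq_zero_iff' {X : ModuleCat.{0} R} (P : ProjectiveResolution X) (f : P.complex.X n ⟶ Y)
    (hf : P.complex.d (n+1) n ≫ f = 0) : P.extMk f (n+1) rfl hf = 0 ↔
    ∃ g, P.complex.d n ((ComplexShape.down ℕ).next n) ≫ g = f := by
  cases n with
  | succ n =>
    have : (ComplexShape.down ℕ).next (n+1) = n := by simp
    rw [this]
    exact P.extMk_eq_zero_iff f _ rfl hf n rfl
  | zero =>
    have h1 : (∃ g, P.complex.d 0 ((ComplexShape.down ℕ).next 0) ≫ g = f) ↔ f = 0 := by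
      constructor
      · rintro ⟨g, rfl⟩
        rw [P.complex.shape, zero_comp]
        simp
      · rintro rfl
        exact ⟨0, by simp⟩
    rw [h1]
    simp only [← P.extEquivCohomologyClass.apply_eq_iff_eq,
      ProjectiveResolution.extEquivCohomologyClass_extMk, ProjectiveResolution.extEquivCohomologyClass_zero,
      CochainComplex.HomComplex.CohomologyClass.mk_eq_zero_iff]
    rw [CochainComplex.HomComplex.Cocycle.toSingleMk_mem_coboundaries_iff _ _ _ _ _ 1 (by simp)]
    constructor
    · rintro ⟨g, hg⟩
      have hz : IsZero (P.cochainComplex.X 1) := by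
        apply CochainComplex.isZero_of_isStrictlyLE _ 0 _ (by simp)
      rw [hz.eq_of_tgt (P.cochainComplex.d _ 1) 0, zero_comp] at hg
      rw [← cancel_epi (P.cochainComplexXIso (-(0:ℕ)) 0 rfl).hom, comp_zero]
      exact hg.symm
    · rintro rfl
      exact ⟨0, by simp⟩

/-- cocycles -/
def cocyc {X : ModuleCat.{0} R} (P : ProjectiveResolution X) (Y : ModuleCat.{0} R) (n : ℕ) :
    Submodule R (P.complex.X n ⟶ Y) where
  carrier := {f | P.complex.d (n+1) n ≫ f = 0}
  add_mem' := by
    intro a b ha hb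
    simp only [Set.mem_ofPred_eq] at *
    simp [ha, hb]
  zero_mem' := by simp
  smul_mem' := by
    intro r a ha
    simp only [Set.mem_ofPred_eq] at *
    simp [ha]

/-- class map -/
def clsL {X : ModuleCat.{0} R} (P : ProjectiveResolution X) (Y : ModuleCat.{0} R) (n : ℕ) :
    cocyc P Y n →ₗ[R] (FExt Y n).obj (op X) where
  toFun f := cls P f.1 f.2
  map_add' f g := cls_add P f.1 g.1 f.2 g.2 _
  map_smul' r f := cls_smul P r f.1 f.2 _

/-- class map -/
def extL {X : ModuleCat.{0} R} (P : ProjectiveResolution X) (Y : ModuleCat.{0} R) (n : ℕ) :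
    cocyc P Y n →ₗ[R] Abelian.Ext X Y n where
  toFun f := P.extMk f.1 (n+1) rfl f.2
  map_add' f g := (P.add_extMk f.1 g.1 _ rfl f.2 g.2).symm
  map_smul' r f := by
    have := P.extMk_comp_mk₀ f.1 _ rfl f.2 (r • 𝟙 Y)
    rw [RingHom.id_apply, Abelian.Ext.smul_eq_comp_mk₀, this]
    simp

lemma ker_eq {X : ModuleCat.{0} R} (P : ProjectiveResolution X) (Y : ModuleCat.{0} R) (n : ℕ) :
    LinearMap.ker (clsL P Y n) = LinearMap.ker (extL P Y n) := by
  ext f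
  rw [LinearMap.mem_ker, LinearMap.mem_ker]
  exact (cls_eq_zero_iff P f.1 f.2).trans (extMk_eq_zero_iff' P f.1 f.2).symm

lemma clsL_surj {X : ModuleCat.{0} R} (P : ProjectiveResolution X) (Y : ModuleCat.{0} R) (n : ℕ) :
    Function.Surjective (clsL P Y n) := fun z => by
  obtain ⟨f, hf, h⟩ := cls_surj P z
  exact ⟨⟨f, hf⟩, h⟩

lemma extL_surj {X : ModuleCat.{0} R} (P : ProjectiveResolution X) (Y : ModuleCat.{0} R) (n : ℕ) :
    Function.Surjective (extL P Y n) := fun z => by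
  obtain ⟨f, hf, h⟩ := P.extMk_surjective z (n+1) rfl
  exact ⟨⟨f, hf⟩, h⟩

/-- The comparison between the two definitions of Ext. -/
def extCompare (X Y : ModuleCat.{0} R) (n : ℕ) :
    (FExt Y n).obj (op X) ≃ₗ[R] Abelian.Ext X Y n :=
  (LinearMap.quotKerEquivOfSurjective _ (clsL_surj (projectiveResolution X) Y n)).symm ≪≫ₗ
  (Submodule.quotEquivOfEq _ _ (ker_eq (projectiveResolution X) Y n) ≪≫ₗ
  (LinearMap.quotKerEquivOfSurjective _ (extL_surj (projectiveResolution X) Y n)))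

lemma extCompare_cls (X Y : ModuleCat.{0} R) (n : ℕ) (f) (hf) :
    extCompare X Y n (cls (projectiveResolution X) f hf) =
      (projectiveResolution X).extMk f (n+1) rfl hf := by
  have h : (LinearMap.quotKerEquivOfSurjective _ (clsL_surj (projectiveResolution X) Y n)).symm
      (cls (projectiveResolution X) f hf) = Submodule.Quotient.mk ⟨f, hf⟩ := by
    rw [LinearEquiv.symm_apply_eq]
    rfl
  rw [extCompare, LinearEquiv.trans_apply, h]
  rfl

lemma extCompare_naturality {X X' : ModuleCat.{0} R} (Y : ModuleCat.{0} R) (n : ℕ) (g : X ⟶ X')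
    (z : (FExt Y n).obj (op X')) :
    extCompare X Y n ((FExt Y n).map g.op z) =
      (Abelian.Ext.mk₀ g).comp (extCompare X' Y n z) (zero_add n) := by
  obtain ⟨f, hf, rfl⟩ := cls_surj (projectiveResolution X') z
  let φ : ProjectiveResolution.Hom (projectiveResolution X) (projectiveResolution X') g :=
    ⟨ProjectiveResolution.lift g _ _, by
      simpa using ProjectiveResolution.lift_commutes_zero g _ _⟩
  rw [map_cls _ _ g φ, extCompare_cls, extCompare_cls, ProjectiveResolution.mk₀_comp_extMk f _ rfl hf φ]

end Bridge
section ExtPart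
open CategoryTheory.Abelian

variable {R : Type} [CommRing R] [IsNoetherianRing R]

lemma ext_vanish {h : ℕ} (x : Fin h → R) (hreg : RingTheory.Sequence.IsRegular R (List.ofFn x))
    (k : ℕ) (N : ModuleCat.{0} R) [Module.Finite R N]
    (hN : ∀ a ∈ (Ideal.span (Set.range x)) ^ k, ∀ b : N, a • b = 0) (i : ℕ) (hi : i < h) :
    Subsingleton (Ext N (ModuleCat.of R R) i) := by
  have hlist : Ideal.ofList (List.ofFn x) = Ideal.span (Set.range x) := by
    unfold Ideal.ofList
    congr 1
    ext r
    simp [List.mem_ofFn']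
  refine ModuleCat.subsingleton_ext_of_exists_isRegular (Ideal.span (Set.range x)) N ?_
    (ModuleCat.of R R) ?_ (List.ofFn x) ?_ hreg i (by simpa using hi)
  · rw [Module.support_eq_zeroLocus, PrimeSpectrum.zeroLocus_subset_zeroLocus_iff]
    intro a ha
    refine ⟨k, ?_⟩
    rw [Module.mem_annihilator]
    exact fun b => hN _ (Ideal.pow_mem_pow ha k) b
  · have := hreg.top_ne_smul
    rw [hlist] at this
    exact this.symm.lt_top
  · intro r hr
    rw [List.mem_ofFn'] at hr
    exact Ideal.subset_span hr

lemma ext_inj {h : ℕ} (x : Fin h → R) (hreg : RingTheory.Sequence.IsRegular R (List.ofFn x))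
    (k : ℕ) {B C : Type} [AddCommGroup B] [Module R B] [AddCommGroup C] [Module R C]
    [Module.Finite R B]
    (hB : ∀ a ∈ (Ideal.span (Set.range x)) ^ k, ∀ b : B, a • b = 0)
    (f : B →ₗ[R] C) (hf : Function.Surjective f)
    (z : Ext (ModuleCat.of R C) (ModuleCat.of R R) h)
    (hz : (Ext.mk₀ (ModuleCat.ofHom f)).comp z (zero_add h) = 0) : z = 0 := by
  obtain _ | h := h
  · have : Epi (ModuleCat.ofHom f) := (ModuleCat.epi_iff_surjective _).mpr hf
    apply Ext.precomp_mk₀_injective_of_epi _ (ModuleCat.ofHom f)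
    exact hz.trans (map_zero ((Ext.mk₀ (ModuleCat.ofHom f)).precomp (ModuleCat.of R R)
      (zero_add 0))).symm
  · obtain ⟨w, hw⟩ := Ext.contravariant_sequence_exact₃
      (LinearMap.shortExact_shortComplexKer hf) _ z hz (add_comm 1 h)
    have : Subsingleton (Ext (ModuleCat.of R (LinearMap.ker f)) (ModuleCat.of R R) h) := by
      refine ext_vanish x hreg k _ ?_ h (Nat.lt_succ_self h)
      intro a ha b
      exact Subtype.ext (hB a ha b.1)
    have hw0 : w = 0 := this.elim _ _
    rw [← hw, hw0, Ext.comp_zero]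

lemma ext_factor {h : ℕ} (x : Fin h → R) (hreg : RingTheory.Sequence.IsRegular R (List.ofFn x))
    (k : ℕ) (L J : Ideal R) (hL : (Ideal.span (Set.range x)) ^ k ≤ L) (hLJ : L ≤ J)
    (z : Ext (ModuleCat.of R (R ⧸ L)) (ModuleCat.of R R) h) (hz : ∀ a ∈ J, a • z = 0) :
    ∃ w : Ext (ModuleCat.of R (R ⧸ J)) (ModuleCat.of R R) h,
      (Ext.mk₀ (ModuleCat.ofHom (Submodule.mapQ L J LinearMap.id hLJ))).comp w (zero_add h) = z := by
  set q : (R ⧸ L) →ₗ[R] (R ⧸ J) := Submodule.mapQ L J LinearMap.id hLJ with hq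
  have hqs : Function.Surjective q := by
    intro y
    obtain ⟨r, rfl⟩ := Submodule.Quotient.mk_surjective _ y
    exact ⟨Submodule.Quotient.mk r, rfl⟩
  have hkB : ∀ a ∈ (Ideal.span (Set.range x)) ^ k, ∀ b : R ⧸ L, a • b = 0 := by
    intro a ha b
    obtain ⟨r, rfl⟩ := Submodule.Quotient.mk_surjective _ b
    rw [← Submodule.Quotient.mk_smul, Submodule.Quotient.mk_eq_zero]
    exact L.mul_mem_right _ (hL ha)
  refine Ext.contravariant_sequence_exact₂ (LinearMap.shortExact_shortComplexKer hqs) _ z ?_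
  obtain ⟨n, s, hs⟩ := Module.Finite.exists_fin (R := R) (M := LinearMap.ker q)
  have hex : ∀ i, ∃ a : R, a ∈ J ∧ (Submodule.Quotient.mk a : R ⧸ L) = (s i).1 := by
    intro i
    obtain ⟨a, ha⟩ := Submodule.Quotient.mk_surjective _ (s i).1
    refine ⟨a, ?_, ha⟩
    have h2 : q (Submodule.Quotient.mk a) = 0 := by
      rw [ha]; exact (s i).2
    exact (Submodule.Quotient.mk_eq_zero J).mp h2
  choose a haJ has using hex
  have hmem : ∀ b : Fin n → (R ⧸ L),
      (∑ i, a i • (LinearMap.proj i : (Fin n → (R ⧸ L)) →ₗ[R] (R ⧸ L))) b ∈ LinearMap.ker q := by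
    intro b
    rw [LinearMap.mem_ker, LinearMap.sum_apply, map_sum]
    refine Finset.sum_eq_zero fun i _ => ?_
    rw [LinearMap.smul_apply, map_smul]
    generalize q _ = y
    obtain ⟨r, rfl⟩ := Submodule.Quotient.mk_surjective _ y
    rw [← Submodule.Quotient.mk_smul, Submodule.Quotient.mk_eq_zero]
    exact J.mul_mem_right _ (haJ i)
  let p : (Fin n → (R ⧸ L)) →ₗ[R] LinearMap.ker q := LinearMap.codRestrict _ _ hmem
  have hp : Function.Surjective p := by
    rw [← LinearMap.range_eq_top, eq_top_iff, ← hs, Submodule.span_le]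
    rintro _ ⟨i, rfl⟩
    refine ⟨Pi.single i (Submodule.Quotient.mk 1), Subtype.ext ?_⟩
    change (∑ j, a j • (LinearMap.proj j : (Fin n → (R ⧸ L)) →ₗ[R] (R ⧸ L)))
      (Pi.single i (Submodule.Quotient.mk 1)) = (s i).1
    rw [LinearMap.sum_apply, Finset.sum_eq_single i]
    · rw [← has i, LinearMap.smul_apply, LinearMap.proj_apply, Pi.single_eq_same,
        ← Submodule.Quotient.mk_smul, smul_eq_mul, mul_one]
    · intro j _ hj
      rw [LinearMap.smul_apply, LinearMap.proj_apply, Pi.single_eq_of_ne hj, smul_zero]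
    · simp
  refine ext_inj x hreg k (fun c hc b => funext fun i => hkB c hc (b i)) p hp _ ?_
  have hfac : ModuleCat.ofHom p ≫ ModuleCat.ofHom (LinearMap.ker q).subtype =
      ∑ i, a i • ModuleCat.ofHom (LinearMap.proj i : (Fin n → (R ⧸ L)) →ₗ[R] (R ⧸ L)) := by
    apply ModuleCat.hom_ext
    rw [ModuleCat.hom_sum]
    rfl
  change (Ext.mk₀ (ModuleCat.ofHom p)).comp
    ((Ext.mk₀ (ModuleCat.ofHom (LinearMap.ker q).subtype)).comp z _) _ = 0
  rw [Ext.mk₀_comp_mk₀_assoc, hfac, Ext.mk₀_sum, Ext.sum_comp]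
  refine Finset.sum_eq_zero fun i _ => ?_
  rw [Ext.mk₀_smul, Ext.smul_comp, ← Ext.comp_smul, hz _ (haJ i), Ext.comp_zero]

end ExtPart

section ExtKilled
open CategoryTheory.Abelian
variable {R : Type} [CommRing R]

lemma ext_killed (J : Ideal R) (Y : ModuleCat.{0} R) (h : ℕ)
    (z : Ext (ModuleCat.of R (R ⧸ J)) Y h) (a : R) (ha : a ∈ J) : a • z = 0 := by
  have h1 : a • z = (Ext.mk₀ (a • 𝟙 (ModuleCat.of R (R ⧸ J)))).comp z (zero_add h) := by
    rw [Ext.mk₀_smul, Ext.smul_comp, Ext.mk₀_id_comp]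
  have h2 : a • 𝟙 (ModuleCat.of R (R ⧸ J)) = 0 := by
    apply ModuleCat.hom_ext
    apply LinearMap.ext
    intro y
    obtain ⟨r, rfl⟩ := Submodule.Quotient.mk_surjective _ y
    exact (Submodule.Quotient.mk_eq_zero J).mpr (J.mul_mem_right _ ha)
  rw [h1, h2, Ext.mk₀_zero, Ext.zero_comp]

end ExtKilled

section ColimPart
open Limits

lemma colim_equiv {R : Type} [CommRing R] {C : Type} [SmallCategory C] [IsFiltered C]
    (F G : C ⥤ ModuleCat.{0} R) (cF : Cocone F) (cG : Cocone G) (hF : IsColimit cF)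
    (hG : IsColimit cG) (τ : F ⟶ G) (L : C → Ideal R)
    (hτ : ∀ c (z : F.obj c), τ.app c z = 0 → z = 0)
    (hGi : ∀ {c d} (f : c ⟶ d) (z : G.obj c), G.map f z = 0 → z = 0)
    (hL : ∀ {c d} (_ : c ⟶ d), L d ≤ L c)
    (hk : ∀ c (z : F.obj c), ∀ a ∈ L c, a • z = 0)
    (hfac : ∀ c (z : G.obj c), (∀ a ∈ L c, a • z = 0) → ∃ w, τ.app c w = z)
    (U : Submodule R cG.pt) (hU : ∀ y, y ∈ U ↔ ∃ c, ∀ a ∈ L c, a • y = 0) :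
    Nonempty (cF.pt ≃ₗ[R] U) := by
  have hGj : ∀ c (z : G.obj c), cG.ι.app c z = 0 → z = 0 := by
    intro c z hz
    obtain ⟨k, f, g, hfg⟩ := Concrete.isColimit_exists_of_rep_eq G hG z (0 : G.obj c)
      (hz.trans (map_zero (cG.ι.app c).hom).symm)
    exact hGi f z (hfg.trans (map_zero (G.map g).hom))
  let φ : cF.pt ⟶ cG.pt := hF.desc ⟨cG.pt, τ ≫ cG.ι⟩
  have hφ : ∀ c (z : F.obj c), φ (cF.ι.app c z) = cG.ι.app c (τ.app c z) := by
    intro c z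
    have := hF.fac ⟨cG.pt, τ ≫ cG.ι⟩ c
    have h2 := congrArg (fun g => g.hom z) this
    exact h2
  have hinj : Function.Injective φ.hom := by
    rw [injective_iff_map_eq_zero]
    intro y hy
    obtain ⟨c, z, rfl⟩ := Concrete.isColimit_exists_rep F hF y
    have h0 : cG.ι.app c (τ.app c z) = 0 := (hφ c z).symm.trans hy
    have h1 := hτ c z (hGj c _ h0)
    rw [h1]
    exact map_zero (cF.ι.app c).hom
  have hrange : LinearMap.range φ.hom = U := by
    ext y
    rw [hU, LinearMap.mem_range]
    constructor
    · rintro ⟨u, rfl⟩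
      obtain ⟨c, z, rfl⟩ := Concrete.isColimit_exists_rep F hF u
      refine ⟨c, fun a ha => ?_⟩
      have h1 : a • φ.hom (cF.ι.app c z) = φ.hom ((cF.ι.app c).hom (a • z)) := by
        rw [map_smul, map_smul]
      refine h1.trans ?_
      rw [hk c z a ha, map_zero, map_zero]
    · rintro ⟨d, hd⟩
      obtain ⟨c, z, rfl⟩ := Concrete.isColimit_exists_rep G hG y
      let e := IsFiltered.max c d
      let f : c ⟶ e := IsFiltered.leftToMax c d
      let g : d ⟶ e := IsFiltered.rightToMax c d
      have hz : cG.ι.app e (G.map f z) = cG.ι.app c z :=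
        congrArg (fun t => t.hom z) (cG.w f)
      have hkill : ∀ a ∈ L e, a • (G.map f z) = 0 := by
        intro a ha
        apply hGj e
        refine (map_smul (cG.ι.app e).hom a _).trans ?_
        refine (congrArg (fun t => a • t) hz).trans ?_
        exact hd a (hL g ha)
      obtain ⟨w, hw⟩ := hfac e _ hkill
      refine ⟨cF.ι.app e w, ?_⟩
      refine (hφ e w).trans ?_
      rw [hw]
      exact hz
  exact ⟨LinearEquiv.ofInjective φ.hom hinj ≪≫ₗ LinearEquiv.ofEq _ _ hrange⟩

end ColimPart

noncomputable section Final
open Limits Opposite localCohomology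

variable {R : Type} [CommRing R]

/-- the evaluated diagram -/
abbrev lcDiag (I : Ideal R) (h : ℕ) (Y : ModuleCat.{0} R) : ℕᵒᵖᵒᵖ ⥤ ModuleCat.{0} R :=
  (ringModIdeals (idealPowersDiagram I)).op ⋙ FExt Y h

lemma lc_colimit (I : Ideal R) (h : ℕ) (Y : ModuleCat.{0} R) :
    ∃ (c : Cocone (lcDiag I h Y)) (_ : IsColimit c), c.pt = (localCohomology I h).obj Y := by
  have := hasColimitDiagram.{0, 0} (idealPowersDiagram I) h
  let c := ((evaluation (ModuleCat.{0} R) (ModuleCat.{0} R)).obj Y).mapCocone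
    (colimit.cocone (diagram (idealPowersDiagram I) h))
  have hc : IsColimit c := isColimitOfPreserves _ (colimit.isColimit _)
  exact ⟨c, hc, rfl⟩

/-- the comparison of the systems `R / Jⁿ → R / Iⁿ`. -/
def compSys {J I : Ideal R} (hJI : J ≤ I) :
    ringModIdeals (idealPowersDiagram J) ⟶ ringModIdeals (idealPowersDiagram I) where
  app t := ModuleCat.ofHom (Submodule.mapQ (J ^ unop t) (I ^ unop t) LinearMap.id
    (Ideal.pow_right_mono hJI _))
  naturality s t f := by
    apply ModuleCat.hom_ext
    apply LinearMap.ext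
    intro y
    obtain ⟨r, rfl⟩ := Submodule.Quotient.mk_surjective _ y
    rfl

lemma mapQ_surj {L J : Ideal R} (hLJ : L ≤ J) :
    Function.Surjective (Submodule.mapQ L J LinearMap.id hLJ : (R ⧸ L) →ₗ[R] (R ⧸ J)) := by
  intro y
  obtain ⟨r, rfl⟩ := Submodule.Quotient.mk_surjective _ y
  exact ⟨Submodule.Quotient.mk r, rfl⟩

lemma quot_killed (L : Ideal R) : ∀ a ∈ L, ∀ b : R ⧸ L, a • b = 0 := by
  intro a ha b
  obtain ⟨r, rfl⟩ := Submodule.Quotient.mk_surjective _ b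
  exact (Submodule.Quotient.mk_eq_zero L).mpr (L.mul_mem_right _ ha)

lemma fext_inj [IsNoetherianRing R] {h : ℕ} (x : Fin h → R)
    (hreg : RingTheory.Sequence.IsRegular R (List.ofFn x)) (k : ℕ) (L : Ideal R)
    (hLJ : (Ideal.span (Set.range x)) ^ k ≤ L)
    (z : (FExt (ModuleCat.of R R) h).obj (op (ModuleCat.of R (R ⧸ L))))
    (hz : (FExt (ModuleCat.of R R) h).map (ModuleCat.ofHom
      (Submodule.mapQ ((Ideal.span (Set.range x)) ^ k) L LinearMap.id hLJ)).op z = 0) : z = 0 := by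
  apply (extCompare _ _ _).injective
  rw [map_zero]
  refine ext_inj x hreg k (quot_killed _) _ (mapQ_surj hLJ) _ ?_
  rw [← extCompare_naturality, hz, map_zero]

lemma fext_factor [IsNoetherianRing R] {h : ℕ} (x : Fin h → R)
    (hreg : RingTheory.Sequence.IsRegular R (List.ofFn x)) (k : ℕ) (J : Ideal R)
    (hLJ : (Ideal.span (Set.range x)) ^ k ≤ J)
    (z : (FExt (ModuleCat.of R R) h).obj
      (op (ModuleCat.of R (R ⧸ (Ideal.span (Set.range x)) ^ k))))
    (hz : ∀ a ∈ J, a • z = 0) :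
    ∃ w, (FExt (ModuleCat.of R R) h).map (ModuleCat.ofHom
      (Submodule.mapQ ((Ideal.span (Set.range x)) ^ k) J LinearMap.id hLJ)).op w = z := by
  obtain ⟨w, hw⟩ := ext_factor x hreg k _ J le_rfl hLJ (extCompare _ _ _ z) (by
    intro a ha
    rw [← map_smul, hz a ha, map_zero])
  refine ⟨(extCompare _ _ _).symm w, ?_⟩
  apply (extCompare _ _ _).injective
  rw [extCompare_naturality, LinearEquiv.apply_symm_apply, hw]

lemma fext_killed (J : Ideal R) (Y : ModuleCat.{0} R) (h : ℕ)
    (z : (FExt Y h).obj (op (ModuleCat.of R (R ⧸ J)))) (a : R) (ha : a ∈ J) : a • z = 0 := by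
  apply (extCompare _ _ _).injective
  rw [map_smul, ext_killed J Y h _ a ha, map_zero]

theorem lc_main [IsNoetherianRing R]
    (I : Ideal R) (h : ℕ) (x : Fin h → R) (hxI : ∀ i, x i ∈ I)
    (hreg : RingTheory.Sequence.IsRegular R (List.ofFn x)) :
    Nonempty
      (((localCohomology I h).obj (ModuleCat.of R R)) ≃ₗ[R]
        ↥(⨆ n : ℕ,
          Submodule.torsionBySet R
            ((localCohomology (Ideal.span (Set.range x)) h).obj (ModuleCat.of R R))
            ((I ^ n : Ideal R) : Set R))) := by
  have hJI : Ideal.span (Set.range x) ≤ I := by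
    rw [Ideal.span_le]
    rintro _ ⟨i, rfl⟩
    exact hxI i
  obtain ⟨cF, hF, eF⟩ := lc_colimit I h (ModuleCat.of R R)
  obtain ⟨cG, hG, eG⟩ := lc_colimit (Ideal.span (Set.range x)) h (ModuleCat.of R R)
  rw [← eF, ← eG]
  refine colim_equiv (lcDiag I h (ModuleCat.of R R))
    (lcDiag (Ideal.span (Set.range x)) h (ModuleCat.of R R)) cF cG hF hG
    (Functor.whiskerRight (NatTrans.op (compSys hJI)) (FExt (ModuleCat.of R R) h))
    (fun c => I ^ (unop (unop c))) ?_ ?_ ?_ ?_ ?_ _ ?_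
  · intro c z hz
    exact fext_inj x hreg (unop (unop c)) (I ^ (unop (unop c))) (Ideal.pow_right_mono hJI _) z hz
  · intro c d f z hz
    refine fext_inj x hreg (unop (unop d)) ((Ideal.span (Set.range x)) ^ (unop (unop c)))
      (Ideal.pow_le_pow_right (leOfHom f.unop.unop)) z hz
  · intro c d f
    exact Ideal.pow_le_pow_right (leOfHom f.unop.unop)
  · intro c z a ha
    exact fext_killed _ _ _ z a ha
  · intro c z hz
    exact fext_factor x hreg (unop (unop c)) (I ^ (unop (unop c))) (Ideal.pow_right_mono hJI _) z hz
  · intro y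
    rw [Submodule.mem_iSup_of_directed]
    · constructor
      · rintro ⟨n, hn⟩
        refine ⟨op (op n), fun a ha => ?_⟩
        rw [Submodule.mem_torsionBySet_iff] at hn
        exact hn ⟨a, ha⟩
      · rintro ⟨c, hc⟩
        refine ⟨unop (unop c), ?_⟩
        rw [Submodule.mem_torsionBySet_iff]
        exact fun a => hc a.1 a.2
    · refine Monotone.directed_le ?_
      intro m n hmn
      exact Submodule.torsionBySet_le_torsionBySet_of_subset (Ideal.pow_le_pow_right hmn)

end Final


/-- Let `(R, m)` be a noetherian local ring, `I` an ideal of `R`,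
`h ∈ ℕ`, and `x = x₁,…,x_h ∈ I` an `R`-regular sequence.  Then
`H^h_I(R) = Γ_I(H^h_{xR}(R))`; in particular `H^h_I(R)` is (canonically identified with)
a submodule of `H^h_{xR}(R)`.  Here `Γ_I(M) = ⨆ n (0 :_M Iⁿ)` is the `I`-torsion
functor. -/
theorem stmt11 {R : Type} [CommRing R] [IsNoetherianRing R] [IsLocalRing R]
    (I : Ideal R) (h : ℕ) (x : Fin h → R) (hxI : ∀ i, x i ∈ I)
    (hreg : RingTheory.Sequence.IsRegular R (List.ofFn x)) :
    Nonempty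
      (((localCohomology I h).obj (ModuleCat.of R R)) ≃ₗ[R]
        ↥(⨆ n : ℕ,
          Submodule.torsionBySet R
            ((localCohomology (Ideal.span (Set.range x)) h).obj (ModuleCat.of R R))
            ((I ^ n : Ideal R) : Set R))) := by
  exact lc_main I h x hxI hreg
end
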